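/- Let u be a regular solution of −Δ_p u = f(u) in the unit ball B₁ ⊂ ℝⁿ, with f ∈ C¹(ℝ), and set c(x) := x·∇u(x). Then for every ξ ∈ C¹ with compact support contained in the open set B₁ ∩ {|∇u| > 0} one has the identity ∫ |∇u|^{p−2} ∇c·∇ξ dx + (p−2) ∫ |∇u|^{p−4} (∇c·∇u)(∇u·∇ξ) dx − ∫ f′(u) c ξ dx = p ∫ |∇u|^{p−2} ∇u·∇ξ dx, all integrals being over B₁ ∩ {|∇u| > 0}. (This is the weak formulation of div(|∇u|^{p−2}∇c) + f′(u)c + (p−2) div(|∇u|^{p−4}(∇c·∇u)∇u) = p div(|∇u|^{p−2}∇u) in B₁ ∩ {|∇u| > 0}.) -/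

import Mathlib

open MeasureTheory Metric Set Filter
open scoped RealInnerProductSpace

noncomputable section

abbrev Euc (n : ℕ) := EuclideanSpace ℝ (Fin n)

/-- `u` is a regular solution of `−Δ_p u = f(u)` in the open set `U ⊆ ℝⁿ`:
`u ∈ C¹(U)`, `f ∘ u ∈ L^∞(U)`, and the equation holds in the weak sense against
all `C¹` test functions with compact support in `U`. -/
def IsRegularSolution (n : ℕ) (p : ℝ) (U : Set (Euc n)) (f : ℝ → ℝ) (u : Euc n → ℝ) : Prop :=
  ContDiffOn ℝ 1 u U ∧
  (∃ C : ℝ, ∀ x ∈ U, |f (u x)| ≤ C) ∧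
  ∀ ξ : Euc n → ℝ, ContDiff ℝ 1 ξ → HasCompactSupport ξ → tsupport ξ ⊆ U →
    ∫ x in U, ‖gradient u x‖ ^ (p - 2) * ⟪gradient u x, gradient ξ x⟫
      = ∫ x in U, f (u x) * ξ x

/-- `u` is a stable regular solution of `−Δ_p u = f(u)` in `U`: the second variation of the
energy is nonnegative on all Lipschitz test functions with compact support in `U`. -/
def IsStableRegularSolution (n : ℕ) (p : ℝ) (U : Set (Euc n)) (f : ℝ → ℝ)
    (u : Euc n → ℝ) : Prop :=
  IsRegularSolution n p U f u ∧
  ∀ ξ : Euc n → ℝ, (∃ K, LipschitzWith K ξ) → HasCompactSupport ξ → tsupport ξ ⊆ U →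
    0 ≤ (∫ x in U ∩ {y | 0 < ‖gradient u y‖},
          (‖gradient u x‖ ^ (p - 2) * ‖gradient ξ x‖ ^ 2
            + (p - 2) * ‖gradient u x‖ ^ (p - 4) * ⟪gradient u x, gradient ξ x⟫ ^ 2))
        - ∫ x in U, deriv f (u x) * ξ x ^ 2

/-- The radial derivative `u_r(x) = (x/|x|)·∇u(x)` (junk value `0` at `x = 0`). -/
def radialDeriv {n : ℕ} (u : Euc n → ℝ) (x : Euc n) : ℝ := ⟪x, gradient u x⟫ / ‖x‖

/-- The dimension condition (★): `n < p + 4p/(p−1)` if `p ≥ 2`, and `n < 5p` if `1 < p < 2`. -/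
def DimensionCondition (n : ℕ) (p : ℝ) : Prop :=
  (2 ≤ p → (n : ℝ) < p + 4 * p / (p - 1)) ∧ (p < 2 → (n : ℝ) < 5 * p)

/-! ### Gradients, traces and the divergence theorem -/

section Preliminaries

open scoped Topology ContDiff
open Module (finrank)

variable {E : Type*} [NormedAddCommGroup E] [InnerProductSpace ℝ E] [FiniteDimensional ℝ E]

lemma inner_gradient_eq_fderiv (u : E → ℝ) (x v : E) : ⟪gradient u x, v⟫ = fderiv ℝ u x v :=
  inner_gradient_left

lemma ContDiff.contDiff_gradient {m k : ℕ∞} {u : E → ℝ} (hu : ContDiff ℝ k u)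
    (hmk : m + 1 ≤ k) : ContDiff ℝ m (gradient u) := by
  have h : ContDiff ℝ m (fderiv ℝ u) := hu.fderiv_right (by exact_mod_cast hmk)
  exact ((InnerProductSpace.toDual ℝ E).symm.toContinuousLinearEquiv.contDiff).comp h

lemma ContDiff.continuous_gradient {u : E → ℝ} (hu : ContDiff ℝ 1 u) :
    Continuous (gradient u) :=
  (hu.contDiff_gradient (m := 0) (k := 1) (by simp)).continuous

lemma ContDiff.hasGradientAt {u : E → ℝ} (hu : ContDiff ℝ 1 u) (x : E) :
    HasGradientAt u (gradient u x) x :=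
  (hu.differentiable (by simp) x).hasGradientAt

lemma gradient_eq_zero_of_notMem_tsupport {u : E → ℝ} {x : E} (hx : x ∉ tsupport u) :
    gradient u x = 0 := by
  have : fderiv ℝ u x = 0 := by
    by_contra h
    exact hx (support_fderiv_subset ℝ h)
  simp [gradient, this]

lemma hasCompactSupport_gradient {u : E → ℝ} (hu : HasCompactSupport u) :
    HasCompactSupport (gradient u) :=
  hu.mono' fun x hx => by
    by_contra h
    exact hx (gradient_eq_zero_of_notMem_tsupport h)

/-- The trace of a continuous linear endomorphism, in an orthonormal basis. -/
def opTrace (L : E →L[ℝ] E) : ℝ :=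
  ∑ i, ⟪L (stdOrthonormalBasis ℝ E i), stdOrthonormalBasis ℝ E i⟫

lemma opTrace_add (L M : E →L[ℝ] E) : opTrace (L + M) = opTrace L + opTrace M := by
  simp [opTrace, inner_add_left, Finset.sum_add_distrib]

lemma opTrace_smul (c : ℝ) (L : E →L[ℝ] E) : opTrace (c • L) = c * opTrace L := by
  simp [opTrace, inner_smul_left, Finset.mul_sum]

lemma abs_opTrace_le (L : E →L[ℝ] E) : |opTrace L| ≤ finrank ℝ E * ‖L‖ := by
  refine (Finset.abs_sum_le_sum_abs _ _).trans ?_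
  have : ∀ i ∈ (Finset.univ : Finset (Fin (finrank ℝ E))),
      |⟪L (stdOrthonormalBasis ℝ E i), stdOrthonormalBasis ℝ E i⟫| ≤ ‖L‖ := by
    intro i _
    refine (abs_real_inner_le_norm _ _).trans ?_
    have h1 := L.le_opNorm (stdOrthonormalBasis ℝ E i)
    have h2 : ‖stdOrthonormalBasis ℝ E i‖ = 1 := (stdOrthonormalBasis ℝ E).norm_eq_one i
    rw [h2, mul_one] at h1; rw [h2, mul_one]
    linarith
  exact (Finset.sum_le_sum this).trans (by simp)

lemma le_opTrace {L : E →L[ℝ] E} {c : ℝ} (hL : ∀ v, c * ‖v‖ ^ 2 ≤ ⟪L v, v⟫) :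
    finrank ℝ E * c ≤ opTrace L := by
  have : ∀ i ∈ (Finset.univ : Finset (Fin (finrank ℝ E))),
      c ≤ ⟪L (stdOrthonormalBasis ℝ E i), stdOrthonormalBasis ℝ E i⟫ := by
    intro i _
    have := hL (stdOrthonormalBasis ℝ E i)
    rwa [(stdOrthonormalBasis ℝ E).norm_eq_one i, one_pow, mul_one] at this
  refine le_trans (by simp) (Finset.sum_le_sum this)

lemma continuous_opTrace : Continuous (opTrace : (E →L[ℝ] E) → ℝ) := by
  unfold opTrace
  fun_prop

variable [MeasurableSpace E] [BorelSpace E]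

lemma Continuous.integrableOn_closedBall {F : Type*} [NormedAddCommGroup F] {h : E → F}
    (hh : Continuous h) (x : E) (r : ℝ) : IntegrableOn h (closedBall x r) :=
  hh.continuousOn.integrableOn_compact (isCompact_closedBall x r)

/-- The divergence theorem for a `C¹` vector field against a `C¹` function, one of them being
compactly supported. -/
theorem integral_inner_gradient_eq {X : E → E} {w : E → ℝ} (hX : ContDiff ℝ 1 X)
    (hw : ContDiff ℝ 1 w) (hc : HasCompactSupport X ∨ HasCompactSupport w) :
    ∫ x, ⟪X x, gradient w x⟫ = - ∫ x, opTrace (fderiv ℝ X x) * w x := by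
  set b := stdOrthonormalBasis ℝ E
  have hX' : Continuous (fderiv ℝ X) := hX.continuous_fderiv (by simp)
  have hw' : Continuous (fderiv ℝ w) := hw.continuous_fderiv (by simp)
  have hXc := hX.continuous
  have hwc := hw.continuous
  have hf : ∀ i x, fderiv ℝ (fun y => ⟪X y, b i⟫) x (b i) = ⟪fderiv ℝ X x (b i), b i⟫ := by
    intro i x
    have h1 : HasFDerivAt X (fderiv ℝ X x) x := (hX.differentiable (by simp) x).hasFDerivAt
    have h2 := h1.inner ℝ (hasFDerivAt_const (b i) x)
    rw [h2.fderiv]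
    simp
  have cs : ∀ {g1 : E → ℝ} {g2 : E → ℝ}, Continuous g1 → Continuous g2 →
      (HasCompactSupport X → HasCompactSupport g1) →
      (HasCompactSupport w → HasCompactSupport g2) → Integrable (fun x => g1 x * g2 x) := by
    intro g1 g2 h1 h2 h3 h4
    refine (h1.mul h2).integrable_of_hasCompactSupport ?_
    rcases hc with hc | hc
    · exact (h3 hc).mul_right
    · exact (h4 hc).mul_left
  have csX : ∀ i, HasCompactSupport X → HasCompactSupport (fun x => ⟪X x, b i⟫) := fun i h =>
    h.comp_left (g := fun y => ⟪y, b i⟫) (by simp)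
  have csX' : ∀ i, HasCompactSupport X →
      HasCompactSupport (fun x => ⟪fderiv ℝ X x (b i), b i⟫) := fun i h =>
    (h.fderiv ℝ).comp_left (g := fun L : E →L[ℝ] E => ⟪L (b i), b i⟫) (by simp)
  have csw' : ∀ i, HasCompactSupport w → HasCompactSupport (fun x => fderiv ℝ w x (b i)) :=
    fun i h => (h.fderiv ℝ).comp_left (g := fun L : E →L[ℝ] ℝ => L (b i)) (by simp)
  have i1 : ∀ i, Integrable (fun x => ⟪X x, b i⟫ * fderiv ℝ w x (b i)) := fun i =>
    cs (by fun_prop) (by fun_prop) (csX i) (csw' i)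
  have i2 : ∀ i, Integrable (fun x => ⟪fderiv ℝ X x (b i), b i⟫ * w x) := fun i =>
    cs (by fun_prop) (by fun_prop) (csX' i) id
  have key : ∀ i, ∫ x, ⟪X x, b i⟫ * fderiv ℝ w x (b i)
      = - ∫ x, ⟪fderiv ℝ X x (b i), b i⟫ * w x := by
    intro i
    have := integral_mul_fderiv_eq_neg_fderiv_mul_of_integrable (μ := (volume : Measure E))
      (f := fun x => ⟪X x, b i⟫) (g := w) (v := b i)
      (by simpa only [hf] using i2 i) (i1 i)
      (cs (by fun_prop) (by fun_prop) (csX i) id)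
      (fun x _ => (hX.differentiable (by simp) x).inner ℝ (differentiableAt_const _))
      (fun x _ => hw.differentiable (by simp) x)
    simpa only [hf] using this
  calc ∫ x, ⟪X x, gradient w x⟫
      = ∫ x, ∑ i, ⟪X x, b i⟫ * fderiv ℝ w x (b i) := by
        congr 1
        ext x
        rw [← b.sum_inner_mul_inner]
        refine Finset.sum_congr rfl fun i _ => ?_
        rw [real_inner_comm (gradient w x), inner_gradient_eq_fderiv]
    _ = ∑ i, ∫ x, ⟪X x, b i⟫ * fderiv ℝ w x (b i) := integral_finsetSum _ fun i _ => i1 i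
    _ = ∑ i, - ∫ x, ⟪fderiv ℝ X x (b i), b i⟫ * w x := Finset.sum_congr rfl fun i _ => key i
    _ = - ∫ x, opTrace (fderiv ℝ X x) * w x := by
        rw [Finset.sum_neg_distrib, ← integral_finsetSum _ fun i _ => i2 i]
        simp [opTrace, Finset.sum_mul, b]

end Preliminaries

/-! ### Second-order Taylor expansion and averaging kernels adapted to a constant coefficient operator -/

section Kernel

open scoped Topology ContDiff
open Module (finrank)

variable {E : Type*} [NormedAddCommGroup E] [InnerProductSpace ℝ E] [FiniteDimensional ℝ E]

lemma norm_sub_sub_le_of_lipschitz_fderiv {F G : Type*} [NormedAddCommGroup F] [NormedSpace ℝ F]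
    [NormedAddCommGroup G] [NormedSpace ℝ G] {X : F → G} {X' : F → F →L[ℝ] G} {K : ℝ} {s : Set F}
    (hs : Convex ℝ s) (hX : ∀ q ∈ s, HasFDerivAt X (X' q) q)
    (hK : ∀ q ∈ s, ∀ q' ∈ s, ‖X' q' - X' q‖ ≤ K * ‖q' - q‖) {q q' : F} (hq : q ∈ s)
    (hq' : q' ∈ s) : ‖X q' - X q - X' q (q' - q)‖ ≤ K * ‖q' - q‖ ^ 2 := by
  have hsub : segment ℝ q q' ⊆ s := hs.segment_subset hq hq'
  by_cases hne : q' = q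
  · simp [hne]
  have hpos : 0 < ‖q' - q‖ := norm_pos_iff.2 (sub_ne_zero.2 hne)
  have hK0 : 0 ≤ K := by
    have := (norm_nonneg _).trans (hK q hq q' hq')
    exact nonneg_of_mul_nonneg_left this hpos
  have := (convex_segment (𝕜 := ℝ) q q').norm_image_sub_le_of_norm_hasFDerivWithin_le'
    (f := X) (f' := X') (φ := X' q) (C := K * ‖q' - q‖)
    (fun x hx => (hX x (hsub hx)).hasFDerivWithinAt)
    (fun x hx => (hK q hq x (hsub hx)).trans
      (mul_le_mul_of_nonneg_left (norm_sub_le_of_mem_segment hx) hK0))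
    (left_mem_segment ℝ q q') (right_mem_segment ℝ q q')
  calc _ ≤ _ := this
    _ = _ := by ring

lemma exists_lipschitz_of_contDiff_hasCompactSupport {F G : Type*} [NormedAddCommGroup F]
    [NormedSpace ℝ F] [NormedAddCommGroup G] [NormedSpace ℝ G] {X : F → G} (hX : ContDiff ℝ 1 X) (hc : HasCompactSupport X) :
    ∃ K : ℝ, 0 ≤ K ∧ ∀ x y, ‖X x - X y‖ ≤ K * ‖x - y‖ := by
  obtain ⟨K, hK⟩ := ContDiff.lipschitzWith_of_hasCompactSupport hc hX (by simp)
  refine ⟨K, K.2, fun x y => ?_⟩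
  simpa [dist_eq_norm] using hK.dist_le_mul x y

/-- The Hessian of `ψ` as an endomorphism. -/
def hess (ψ : E → ℝ) (x : E) : E →L[ℝ] E := fderiv ℝ (gradient ψ) x

lemma hess_symm {ψ : E → ℝ} (hψ : ContDiff ℝ 2 ψ) (x v w : E) :
    ⟪hess ψ x v, w⟫ = ⟪v, hess ψ x w⟫ := by
  have h1 : ∀ a b, ⟪hess ψ x a, b⟫ = fderiv ℝ (fderiv ℝ ψ) x a b := by
    intro a b
    have hd : DifferentiableAt ℝ (gradient ψ) x :=
      ((hψ.contDiff_gradient (m := 1) (k := 2) (by norm_num)).differentiable (by simp)) x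
    have h2 : HasFDerivAt (fun y => ⟪gradient ψ y, b⟫) _ x :=
      hd.hasFDerivAt.inner ℝ (hasFDerivAt_const b x)
    have hd' : DifferentiableAt ℝ (fderiv ℝ ψ) x :=
      ((hψ.fderiv_right (m := 1) (by norm_num)).differentiable (by simp)) x
    have h3 : HasFDerivAt (fun y => fderiv ℝ ψ y b) _ x :=
      hd'.hasFDerivAt.clm_apply (hasFDerivAt_const b x)
    have h4 : (fun y => ⟪gradient ψ y, b⟫) = fun y => fderiv ℝ ψ y b := by
      ext y; exact inner_gradient_eq_fderiv ψ y b
    rw [h4] at h2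
    have := DFunLike.congr_fun (h2.unique h3) a
    simpa [hess] using this
  rw [h1, real_inner_comm, h1]
  exact (hψ.contDiffAt.isSymmSndFDerivAt (by simp)) v w

lemma taylor_two_of_hasCompactSupport {ψ : E → ℝ} (hψ : ContDiff ℝ 3 ψ)
    (hc : HasCompactSupport ψ) : ∃ C : ℝ, 0 ≤ C ∧ ∀ x y,
      |ψ (y + x) - ψ y - ⟪gradient ψ y, x⟫ - ⟪hess ψ y x, x⟫ / 2| ≤ C * ‖x‖ ^ 3 := by
  have hg : ContDiff ℝ 2 (gradient ψ) := hψ.contDiff_gradient (m := 2) (k := 3) (by norm_num)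
  have hgc := hasCompactSupport_gradient hc
  obtain ⟨K, hK0, hK⟩ := exists_lipschitz_of_contDiff_hasCompactSupport (X := hess ψ)
    (hg.fderiv_right (m := 1) (by norm_num)) (hgc.fderiv ℝ)
  refine ⟨K, hK0, fun x y => ?_⟩
  have hR : ∀ z, HasFDerivAt
      (fun z => ψ (y + z) - ψ y - ⟪gradient ψ y, z⟫ - ⟪hess ψ y z, z⟫ / 2)
      (InnerProductSpace.toDual ℝ E (gradient ψ (y + z) - gradient ψ y - hess ψ y z)) z := by
    intro z
    have h1 : HasFDerivAt (fun z => ψ (y + z)) (fderiv ℝ ψ (y + z)) z := by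
      have := (hψ.differentiable (by simp) (y + z)).hasFDerivAt
      simpa [Function.comp_def] using this.comp z ((hasFDerivAt_id z).const_add y)
    have h2 : HasFDerivAt (fun z => ⟪gradient ψ y, z⟫) _ z :=
      (hasFDerivAt_const (gradient ψ y) z).inner ℝ (hasFDerivAt_id z)
    have h3 : HasFDerivAt (fun z => ⟪hess ψ y z, z⟫) _ z :=
      (hess ψ y).hasFDerivAt.inner ℝ (hasFDerivAt_id z)
    refine ((((h1.sub_const (ψ y)).sub h2).sub (h3.mul_const (2 : ℝ)⁻¹))).congr_fderiv ?_
    ext v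
    have h5 : ⟪hess ψ y v, z⟫ = ⟪hess ψ y z, v⟫ := by
      rw [hess_symm (hψ.of_le (by norm_num)), real_inner_comm]
    simp [h5]
    ring
  have := (convex_closedBall (0 : E) ‖x‖).norm_image_sub_le_of_norm_hasFDerivWithin_le
    (C := K * ‖x‖ ^ 2) (fun z _ => (hR z).hasFDerivWithinAt)
    (fun z hz => by
      rw [LinearIsometryEquiv.norm_map]
      have h1 := norm_sub_sub_le_of_lipschitz_fderiv (X := gradient ψ) (X' := hess ψ) (K := K)
        (s := univ) convex_univ
        (fun q _ => (hg.differentiable (by simp) q).hasFDerivAt)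
        (fun q _ q' _ => hK q' q) (mem_univ y) (mem_univ (y + z))
      rw [add_sub_cancel_left] at h1
      refine h1.trans (mul_le_mul_of_nonneg_left ?_ hK0)
      gcongr
      simpa using hz)
    (mem_closedBall_self (norm_nonneg x)) (show x ∈ closedBall (0 : E) ‖x‖ by simp)
  simp only [add_zero, sub_self, inner_zero_right, map_zero, zero_div, sub_zero,
    Real.norm_eq_abs] at this
  calc _ ≤ _ := this
    _ = _ := by ring

variable [MeasurableSpace E] [BorelSpace E]

/-- A smooth kernel of mass one adapted to the constant coefficient operator `div (B ∇ ·)`. -/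
lemma exists_adapted_kernel [Nontrivial E] {B : E →L[ℝ] E} {l : ℝ} (hl : 0 < l)
    (hBs : ∀ x y, ⟪B x, y⟫ = ⟪x, B y⟫) (hB : ∀ v, l * ‖v‖ ^ 2 ≤ ⟪B v, v⟫) :
    ∃ θ φ : E → ℝ, ContDiff ℝ ∞ θ ∧ ContDiff ℝ ∞ φ ∧ tsupport θ ⊆ closedBall 0 1 ∧
      tsupport φ ⊆ closedBall 0 1 ∧ (∀ z, B (gradient θ z) = -(φ z) • z) ∧ ∫ z, φ z = 1 := by
  have hinj : Function.Injective B := by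
    rw [injective_iff_map_eq_zero]
    intro v hv
    have := hB v
    rw [hv, inner_zero_left] at this
    by_contra h
    have : 0 < l * ‖v‖ ^ 2 := by have := norm_pos_iff.2 h; positivity
    linarith
  set S : E →L[ℝ] E :=
    ((LinearEquiv.ofInjectiveEndo (B : E →ₗ[ℝ] E) hinj).symm : E →ₗ[ℝ] E).toContinuousLinearMap
    with hS
  have hBS : ∀ x, B (S x) = x := fun x =>
    (LinearEquiv.ofInjectiveEndo (B : E →ₗ[ℝ] E) hinj).apply_symm_apply x
  have hSs : ∀ x y, ⟪S x, y⟫ = ⟪x, S y⟫ := by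
    intro x y
    conv_lhs => rw [← hBS y]
    rw [← hBs, hBS]
  set μ : ℝ := l / (‖B‖ + 1) ^ 2
  have hμ : 0 < μ := by positivity
  have hSpos : ∀ x, μ * ‖x‖ ^ 2 ≤ ⟪S x, x⟫ := by
    intro x
    have h1 : ‖x‖ ≤ (‖B‖ + 1) * ‖S x‖ := by
      conv_lhs => rw [← hBS x]
      refine (B.le_opNorm _).trans ?_
      gcongr
      linarith
    have h2 := hB (S x)
    rw [hBS, real_inner_comm] at h2
    refine le_trans ?_ h2
    rw [div_mul_eq_mul_div, div_le_iff₀ (by positivity)]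
    have : ‖x‖ ^ 2 ≤ ((‖B‖ + 1) * ‖S x‖) ^ 2 := by gcongr
    calc l * ‖x‖ ^ 2 ≤ l * ((‖B‖ + 1) * ‖S x‖) ^ 2 := by gcongr
      _ = _ := by ring
  set Θ : ℝ → ℝ := fun s => Real.smoothTransition (1 - s / μ) with hΘ
  have hΘs : ContDiff ℝ ∞ Θ :=
    Real.smoothTransition.contDiff.comp (contDiff_const.sub (contDiff_id.div_const μ))
  have hΘ0 : ∀ s, μ ≤ s → Θ s = 0 := by
    intro s hs
    apply Real.smoothTransition.zero_of_nonpos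
    rw [sub_nonpos, le_div_iff₀ hμ]; linarith
  have hΘanti : Antitone Θ := by
    intro s t hst
    apply Real.smoothTransition.monotone
    gcongr
  set Q : E → ℝ := fun x => ⟪S x, x⟫ with hQ
  have hQs : ContDiff ℝ ∞ Q := S.contDiff.inner ℝ contDiff_id
  have hQ1 : ∀ x, 1 ≤ ‖x‖ → μ ≤ Q x := by
    intro x hx
    refine le_trans ?_ (hSpos x)
    have : 1 ≤ ‖x‖ ^ 2 := by nlinarith
    nlinarith
  have hQd : ∀ x, HasGradientAt Q ((2 : ℝ) • S x) x := by
    intro x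
    rw [hasGradientAt_iff_hasFDerivAt]
    refine (S.hasFDerivAt.inner ℝ (hasFDerivAt_id x)).congr_fderiv ?_
    ext v
    have : ⟪S v, x⟫ = ⟪S x, v⟫ := by rw [hSs, real_inner_comm]
    simp [this]
    ring
  have hΘ' : ContDiff ℝ ∞ (deriv Θ) := (contDiff_infty_iff_deriv.1 hΘs).2
  set θ : E → ℝ := fun x => Θ (Q x) with hθ
  have hθs : ContDiff ℝ ∞ θ := hΘs.comp hQs
  set φ : E → ℝ := fun x => -2 * deriv Θ (Q x) with hφ
  have hφs : ContDiff ℝ ∞ φ := contDiff_const.mul (hΘ'.comp hQs)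
  have hθg : ∀ x, HasGradientAt θ ((2 * deriv Θ (Q x)) • S x) x := by
    intro x
    have h1 : HasDerivAt Θ (deriv Θ (Q x)) (Q x) :=
      (hΘs.differentiable (by simp) (Q x)).hasDerivAt
    have h2 := h1.comp_hasFDerivAt x (hasGradientAt_iff_hasFDerivAt.1 (hQd x))
    rw [hasGradientAt_iff_hasFDerivAt]
    refine h2.congr_fderiv ?_
    ext v
    simp
    ring
  have hsθ : tsupport θ ⊆ closedBall 0 1 := by
    refine closure_minimal ?_ isClosed_closedBall
    intro x hx
    by_contra h
    simp only [mem_closedBall, dist_zero_right, not_le] at h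
    exact hx (hΘ0 _ (hQ1 x h.le))
  have hBg : ∀ z, B (gradient θ z) = -(φ z) • z := by
    intro z
    rw [(hθg z).gradient, map_smul, hBS]
    simp [hφ]
  have hsφ : tsupport φ ⊆ closedBall 0 1 := by
    refine closure_minimal ?_ isClosed_closedBall
    intro x hx
    by_contra h
    have h1 : x ∉ tsupport θ := fun h2 => h (hsθ h2)
    have h2 := hBg x
    rw [gradient_eq_zero_of_notMem_tsupport h1, map_zero] at h2
    have h3 : x ≠ 0 := by
      rintro rfl; simp at h
    have := (smul_eq_zero.1 h2.symm).resolve_right h3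
    exact hx (by simpa using this)
  have hφnn : 0 ≤ φ := fun x => by
    have : deriv Θ (Q x) ≤ 0 := hΘanti.deriv_nonpos
    simp only [hφ, Pi.zero_apply]; linarith
  have hφc : HasCompactSupport φ :=
    (isCompact_closedBall (0 : E) 1).of_isClosed_subset (isClosed_tsupport φ) hsφ
  have hφne : ∃ x, φ x ≠ 0 := by
    by_contra! h
    have h1 : ∀ x, fderiv ℝ θ x = 0 := by
      intro x
      have h2 := hBg x
      rw [h x] at h2
      have h3 : gradient θ x = 0 := hinj (by simpa using h2)
      ext v
      rw [← inner_gradient_eq_fderiv, h3]; simp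
    obtain ⟨x, hx⟩ := exists_norm_eq E (c := 2) (by norm_num)
    have h4 := is_const_of_fderiv_eq_zero (𝕜 := ℝ) (hθs.differentiable (by simp)) h1 0 x
    have h5 : θ x = 0 := hΘ0 _ (hQ1 x (by rw [hx]; norm_num))
    have h6 : θ 0 = 1 := by simp [hθ, hQ, hΘ]
    rw [h5, h6] at h4
    norm_num at h4
  obtain ⟨x0, hx0⟩ := hφne
  have hpos : 0 < ∫ z, φ z :=
    hφs.continuous.integral_pos_of_hasCompactSupport_nonneg_nonzero hφc hφnn hx0
  set c := (∫ z, φ z)⁻¹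
  refine ⟨fun x => c * θ x, fun x => c * φ x, contDiff_const.mul hθs, contDiff_const.mul hφs,
    (closure_mono fun x hx => ?_).trans hsθ, (closure_mono fun x hx => ?_).trans hsφ, ?_, ?_⟩
  · exact fun h => hx (by simp [h])
  · exact fun h => hx (by simp [h])
  · intro z
    have : HasGradientAt (fun x => c * θ x) (c • gradient θ z) z := by
      rw [hasGradientAt_iff_hasFDerivAt]
      have := (hasGradientAt_iff_hasFDerivAt.1 (hθs.differentiable (by simp) z).hasGradientAt).const_mul c
      simpa using this
    rw [this.gradient, map_smul, hBg, smul_smul]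
    congr 1; ring
  · rw [integral_const_mul, inv_mul_cancel₀ hpos.ne']

end Kernel

/-! ### Weak equations and the Caccioppoli inequality -/

section Caccioppoli

open scoped Topology ContDiff
open Module (finrank)

variable {E : Type*} [NormedAddCommGroup E] [InnerProductSpace ℝ E] [FiniteDimensional ℝ E]
  [MeasurableSpace E] [BorelSpace E]

/-- `w` is a weak solution of `-div (B ∇w + F) = G` in `s`. -/
def WeakEq (B : E →L[ℝ] E) (F : E → E) (G w : E → ℝ) (s : Set E) : Prop :=
  ∀ ξ : E → ℝ, ContDiff ℝ 1 ξ → HasCompactSupport ξ → tsupport ξ ⊆ s →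
    ∫ x, ⟪B (gradient w x) + F x, gradient ξ x⟫ = ∫ x, G x * ξ x

lemma integrable_inner_gradient {X : E → E} {ξ : E → ℝ} (hX : Continuous X)
    (hξ : ContDiff ℝ 1 ξ) (hc : HasCompactSupport ξ) :
    Integrable (fun x => ⟪X x, gradient ξ x⟫) := by
  have hg := hξ.continuous_gradient
  refine (hX.inner hg).integrable_of_hasCompactSupport ?_
  exact (hasCompactSupport_gradient hc).mono fun x hx h => hx (by simp [h])

lemma integrable_mul_of_hasCompactSupport {G ξ : E → ℝ} (hG : Continuous G)
    (hξ : Continuous ξ) (hc : HasCompactSupport ξ) : Integrable (fun x => G x * ξ x) :=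
  (hG.mul hξ).integrable_of_hasCompactSupport hc.mul_left

lemma caccioppoli_pointwise {l β K ε η g w e1 e2 e3 e4 e5 : ℝ} (hl : 0 < l)
    (hK : 0 ≤ K) (hβ : 0 ≤ β) (hε : 0 ≤ ε) (hε1 : ε ≤ 1) (hεl : ε ≤ l / 8) (hη : 0 ≤ η)
    (hη1 : η ≤ 1) (hg : 0 ≤ g)
    (h1 : l * g ^ 2 ≤ e1) (h2 : |e2| ≤ β * g * K) (h3 : |e3| ≤ ε * (g + 1) * g)
    (h4 : |e4| ≤ ε * (g + 1) * K) (h5 : |e5| ≤ ε) :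
    l / 4 * (η ^ 2 * g ^ 2) ≤ η ^ 2 * e1 + 2 * η * w * e2 + η ^ 2 * e3 + 2 * η * w * e4
      - e5 * (η ^ 2 * w) + (4 * β ^ 2 * K ^ 2 / l + 8 * K ^ 2 / l + K ^ 2 + l + 3) * (w ^ 2 + 1) := by
  have hη2 : η ^ 2 ≤ 1 := by nlinarith
  have a1 : l * (η ^ 2 * g ^ 2) ≤ η ^ 2 * e1 := by nlinarith [sq_nonneg η]
  have key : ∀ b : ℝ, 0 ≤ b → 2 * b * (η * |w|) * g ≤ l / 4 * (η ^ 2 * g ^ 2) + 4 * b ^ 2 / l * w ^ 2 := by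
    intro b hb
    have h : 0 ≤ (l / 2 * (η * g) - 2 * b * |w|) ^ 2 / l := by positivity
    have : (l / 2 * (η * g) - 2 * b * |w|) ^ 2 / l
        = l / 4 * (η ^ 2 * g ^ 2) + 4 * b ^ 2 / l * |w| ^ 2 - 2 * b * (η * |w|) * g := by
      field_simp
      ring
    rw [sq_abs] at this
    linarith
  have a2 : -(l / 4 * (η ^ 2 * g ^ 2) + 4 * (β * K) ^ 2 / l * w ^ 2) ≤ 2 * η * w * e2 := by
    have : |2 * η * w * e2| ≤ 2 * (β * K) * (η * |w|) * g := by
      rw [abs_mul, abs_mul, abs_mul, abs_of_nonneg hη, abs_two]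
      calc 2 * η * |w| * |e2| ≤ 2 * η * |w| * (β * g * K) := by gcongr
        _ = _ := by ring
    have := (abs_le.1 (this.trans (key _ (by positivity)))).1
    linarith
  have a3 : -(3 / 16 * l * (η ^ 2 * g ^ 2) + l) ≤ η ^ 2 * e3 := by
    have h : |e3| ≤ 3 / 16 * l * g ^ 2 + l := by
      refine h3.trans ?_
      nlinarith [sq_nonneg (g - 1), mul_nonneg hε (sq_nonneg (g - 1)),
        mul_nonneg (sub_nonneg.2 hεl) (sq_nonneg g)]
    have h' := (abs_le.1 h).1
    nlinarith [sq_nonneg η]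
  have a4 : -(l / 4 * (η ^ 2 * g ^ 2) + 4 * K ^ 2 / l * w ^ 2 + K ^ 2 + w ^ 2)
      ≤ 2 * η * w * e4 := by
    have : |2 * η * w * e4| ≤ 2 * K * (η * |w|) * g + 2 * K * |w| := by
      rw [abs_mul, abs_mul, abs_mul, abs_of_nonneg hη, abs_two]
      calc 2 * η * |w| * |e4| ≤ 2 * η * |w| * (1 * (g + 1) * K) := by
            gcongr; exact h4.trans (by gcongr)
        _ = 2 * K * (η * |w|) * g + η * (2 * K * |w|) := by ring
        _ ≤ 2 * K * (η * |w|) * g + 1 * (2 * K * |w|) := by gcongr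
        _ = _ := by ring
    have h6 : 2 * K * |w| ≤ K ^ 2 + w ^ 2 := by nlinarith [sq_nonneg (K - |w|), sq_abs w]
    have := (abs_le.1 (this.trans (add_le_add (key K hK) h6))).1
    linarith
  have a5 : e5 * (η ^ 2 * w) ≤ w ^ 2 + 1 := by
    refine (le_abs_self _).trans ?_
    rw [abs_mul, abs_mul, abs_of_nonneg (sq_nonneg η)]
    have : |e5| * (η ^ 2 * |w|) ≤ 1 * (1 * |w|) := by gcongr; linarith
    nlinarith [sq_nonneg (|w| - 1), sq_abs w]
  have b1 : 0 ≤ 4 * (β * K) ^ 2 / l := by positivity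
  have b2 : 0 ≤ 4 * K ^ 2 / l := by positivity
  have b3 : (4 * β ^ 2 * K ^ 2 / l + 8 * K ^ 2 / l + K ^ 2 + l + 3)
    = 4 * (β * K) ^ 2 / l + 2 * (4 * K ^ 2 / l) + K ^ 2 + l + 3 := by ring
  rw [b3]
  nlinarith [sq_nonneg w, mul_nonneg b2 (sq_nonneg w), mul_nonneg (sq_nonneg K) (sq_nonneg w),
    mul_nonneg hl.le (sq_nonneg w), mul_nonneg hl.le (mul_nonneg (sq_nonneg η) (sq_nonneg g))]

/-- Caccioppoli's inequality. -/
lemma caccioppoli {B : E →L[ℝ] E} {l : ℝ} (hl : 0 < l) (hB : ∀ v, l * ‖v‖ ^ 2 ≤ ⟪B v, v⟫) :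
    ∃ C : ℝ, 0 ≤ C ∧ ∀ (w : E → ℝ) (F : E → E) (G : E → ℝ) (ε : ℝ), ContDiff ℝ 1 w →
      Continuous F → Continuous G → 0 ≤ ε → ε ≤ 1 → ε ≤ l / 8 →
      (∀ x ∈ ball (0 : E) 1, ‖F x‖ ≤ ε * (‖gradient w x‖ + 1)) →
      (∀ x ∈ ball (0 : E) 1, |G x| ≤ ε) → WeakEq B F G w (ball 0 1) →
      ∫ x in closedBall 0 1, w x ^ 2 ≤ 1 →
      ∫ x in closedBall 0 (3 / 4), ‖gradient w x‖ ^ 2 ≤ C := by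
  let b : ContDiffBump (0 : E) := ⟨3 / 4, 7 / 8, by norm_num, by norm_num⟩
  have hbs : ContDiff ℝ 1 b := b.contDiff
  have hbc : HasCompactSupport b := b.hasCompactSupport
  obtain ⟨K, hK⟩ : ∃ K, ∀ x, ‖gradient b x‖ ≤ K :=
    hbs.continuous_gradient.bounded_above_of_compact_support (hasCompactSupport_gradient hbc)
  have hK0 : 0 ≤ K := (norm_nonneg _).trans (hK 0)
  set C0 : ℝ := 4 * ‖B‖ ^ 2 * K ^ 2 / l + 8 * K ^ 2 / l + K ^ 2 + l + 3
  have hC0 : 0 ≤ C0 := by positivity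
  set V : ℝ := volume.real (closedBall (0 : E) 1)
  refine ⟨4 / l * (C0 * (1 + V)), by positivity, ?_⟩
  intro w F G ε hw hF hG hε hε1 hεl hFb hGb hweak hw2
  have hwc := hw.continuous
  have hgc := hw.continuous_gradient
  set ξ : E → ℝ := fun x => b x ^ 2 * w x with hξ
  have hξs : ContDiff ℝ 1 ξ := (hbs.pow 2).mul hw
  have hts : tsupport ξ ⊆ tsupport b := closure_mono fun x hx h => hx (by simp [hξ, h])
  have htb : tsupport b ⊆ ball (0 : E) 1 := by
    rw [b.tsupport_eq]
    exact closedBall_subset_ball (by change (7 / 8 : ℝ) < 1; norm_num)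
  have hξc : HasCompactSupport ξ := hbc.of_isClosed_subset (isClosed_tsupport ξ) hts
  have hgξ : ∀ x, gradient ξ x = b x ^ 2 • gradient w x + (2 * b x * w x) • gradient b x := by
    intro x
    refine HasGradientAt.gradient ?_
    have h1 := hasGradientAt_iff_hasFDerivAt.1 (hw.hasGradientAt x)
    have h2 := hasGradientAt_iff_hasFDerivAt.1 (hbs.hasGradientAt x)
    rw [hasGradientAt_iff_hasFDerivAt]
    refine ((h2.pow 2).mul h1).congr_fderiv ?_
    ext v
    simp
    ring
  set Φ : E → ℝ := fun x => ⟪B (gradient w x) + F x, gradient ξ x⟫ - G x * ξ x with hΦ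
  have i1 := integrable_inner_gradient (X := fun x => B (gradient w x) + F x) (by fun_prop) hξs hξc
  have i2 := integrable_mul_of_hasCompactSupport hG hξs.continuous hξc
  have hΦi : Integrable Φ := i1.sub i2
  have hΦ0 : ∫ x, Φ x = 0 := by
    rw [integral_sub i1 i2, hweak ξ hξs hξc (hts.trans htb), sub_self]
  have i3 : IntegrableOn (fun x => C0 * (w x ^ 2 + 1)) (closedBall 0 1) :=
    Continuous.integrableOn_closedBall (by fun_prop) _ _
  have i4 : IntegrableOn (fun x => l / 4 * ‖gradient w x‖ ^ 2) (closedBall 0 (3 / 4)) :=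
    Continuous.integrableOn_closedBall (by fun_prop) _ _
  have hpt : ∀ x, (closedBall 0 (3 / 4)).indicator (fun x => l / 4 * ‖gradient w x‖ ^ 2) x
      ≤ Φ x + (closedBall 0 1).indicator (fun x => C0 * (w x ^ 2 + 1)) x := by
    intro x
    have hpos : (closedBall 0 (3 / 4)).indicator (fun x => l / 4 * ‖gradient w x‖ ^ 2) x
        ≤ l / 4 * (b x ^ 2 * ‖gradient w x‖ ^ 2) := by
      by_cases hx : x ∈ closedBall (0 : E) (3 / 4)
      · rw [indicator_of_mem hx, b.one_of_mem_closedBall hx]; simp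
      · rw [indicator_of_notMem hx]; positivity
    refine hpos.trans ?_
    by_cases hx : x ∈ ball (0 : E) 1
    · rw [indicator_of_mem (ball_subset_closedBall hx)]
      have h2 : |⟪B (gradient w x), gradient b x⟫| ≤ ‖B‖ * ‖gradient w x‖ * K :=
        (abs_real_inner_le_norm _ _).trans
          (mul_le_mul (B.le_opNorm _) (hK x) (norm_nonneg _) (by positivity))
      have h3 : |⟪F x, gradient w x⟫| ≤ ε * (‖gradient w x‖ + 1) * ‖gradient w x‖ :=
        (abs_real_inner_le_norm _ _).trans
          (mul_le_mul_of_nonneg_right (hFb x hx) (norm_nonneg _))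
      have h4 : |⟪F x, gradient b x⟫| ≤ ε * (‖gradient w x‖ + 1) * K :=
        (abs_real_inner_le_norm _ _).trans
          (mul_le_mul (hFb x hx) (hK x) (norm_nonneg _) (by positivity))
      have := caccioppoli_pointwise (w := w x) (η := b x) hl hK0 (norm_nonneg B) hε hε1 hεl b.nonneg
        b.le_one (norm_nonneg (gradient w x)) (hB _) h2 h3 h4 (hGb x hx)
      refine this.trans (le_of_eq ?_)
      simp only [hΦ]
      rw [hgξ]
      simp only [hξ, C0, inner_add_left, inner_add_right, inner_smul_right]
      ring
    · have hbx : b x = 0 := image_eq_zero_of_notMem_tsupport fun h => hx (htb h)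
      have : 0 ≤ (closedBall 0 1).indicator (fun x => C0 * (w x ^ 2 + 1)) x :=
        indicator_nonneg (fun x _ => by positivity) x
      simp only [hΦ]
      rw [hgξ]
      simp only [hξ, hbx]
      simpa using this
  have hint := integral_mono (i4.integrable_indicator measurableSet_closedBall)
    (hΦi.add (i3.integrable_indicator measurableSet_closedBall)) hpt
  simp only [Pi.add_apply] at hint
  rw [integral_add hΦi (i3.integrable_indicator measurableSet_closedBall), hΦ0,
    integral_indicator measurableSet_closedBall, integral_indicator measurableSet_closedBall,
    integral_const_mul, integral_const_mul,
    integral_add (Continuous.integrableOn_closedBall (by fun_prop) _ _)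
      (continuous_const.integrableOn_closedBall _ _)] at hint
  simp only [integral_const, measureReal_restrict_apply_univ, smul_eq_mul, mul_one] at hint
  have : l / 4 * ∫ x in closedBall 0 (3 / 4), ‖gradient w x‖ ^ 2 ≤ C0 * (1 + V) := by
    refine hint.trans ?_
    rw [zero_add]
    gcongr
  rw [div_mul_eq_mul_div, le_div_iff₀ hl]
  linarith

end Caccioppoli

/-! ### Mollification of weak solutions -/

section Mollification

open scoped Topology ContDiff
open Module (finrank)

variable {E : Type*} [NormedAddCommGroup E] [InnerProductSpace ℝ E] [FiniteDimensional ℝ E]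
  [MeasurableSpace E] [BorelSpace E]

lemma integral_comp_sub_smul (h : E → ℝ) (x : E) {t : ℝ} (ht : 0 < t) :
    ∫ z, h (x - t • z) = (t ^ finrank ℝ E)⁻¹ * ∫ y, h y := by
  rw [Measure.integral_comp_smul_of_nonneg volume (fun y => h (x - y)) t (hR := ht.le),
    integral_sub_left_eq_self h volume x, smul_eq_mul]

omit [MeasurableSpace E] [BorelSpace E] in
lemma gradient_comp_sub_smul {θ : E → ℝ} (hθ : ContDiff ℝ 1 θ) (x : E) (s : ℝ) (y : E) :
    gradient (fun y => θ (s • (x - y))) y = -(s • gradient θ (s • (x - y))) := by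
  refine HasGradientAt.gradient ?_
  have h1 := hasGradientAt_iff_hasFDerivAt.1 (hθ.hasGradientAt (s • (x - y)))
  have h2 : HasFDerivAt (fun y => s • (x - y)) (s • (-ContinuousLinearMap.id ℝ E)) y :=
    ((hasFDerivAt_id y).const_sub x).const_smul s
  rw [hasGradientAt_iff_hasFDerivAt]
  refine (h1.comp y h2).congr_fderiv ?_
  ext v
  simp

variable {B : E →L[ℝ] E} {θ φ : E → ℝ} {w G : E → ℝ} {F : E → E}

lemma mollify_slice (hBs : ∀ x y, ⟪B x, y⟫ = ⟪x, B y⟫) (hθ : ContDiff ℝ 1 θ)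
    (hθs : tsupport θ ⊆ closedBall 0 1) (hφθ : ∀ z, B (gradient θ z) = -(φ z) • z)
    (hF : Continuous F) (hG : Continuous G) (hw : ContDiff ℝ 1 w)
    (hweak : WeakEq B F G w (ball 0 1)) {x : E} (hx : ‖x‖ ≤ 1 / 2) {t : ℝ} (ht : 0 < t)
    (ht' : t ≤ 1 / 4) :
    ∫ z, φ z * ⟪gradient w (x - t • z), z⟫
      = ∫ z, (⟪F (x - t • z), gradient θ z⟫ + t * G (x - t • z) * θ z) := by
  set ξ : E → ℝ := fun y => θ (t⁻¹ • (x - y)) with hξ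
  have hξ1 : ContDiff ℝ 1 ξ := hθ.comp (contDiff_const.smul (contDiff_const.sub contDiff_id))
  have hs : tsupport ξ ⊆ closedBall 0 (3 / 4) := by
    refine closure_minimal (fun y hy => ?_) isClosed_closedBall
    have h1 : t⁻¹ • (x - y) ∈ closedBall (0 : E) 1 := hθs (subset_tsupport _ hy)
    rw [mem_closedBall_zero_iff, norm_smul, norm_inv, Real.norm_of_nonneg ht.le,
      inv_mul_le_iff₀ ht, mul_one] at h1
    rw [mem_closedBall_zero_iff]
    have := norm_sub_norm_le y x
    rw [norm_sub_rev] at this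
    linarith
  have hξc : HasCompactSupport ξ :=
    (isCompact_closedBall (0 : E) (3 / 4)).of_isClosed_subset (isClosed_tsupport ξ) hs
  have hθc : HasCompactSupport θ :=
    (isCompact_closedBall (0 : E) 1).of_isClosed_subset (isClosed_tsupport θ) hθs
  have h := hweak ξ hξ1 hξc (hs.trans (closedBall_subset_ball (by norm_num)))
  have e1 := integral_comp_sub_smul
    (fun y => ⟪B (gradient w y) + F y, gradient ξ y⟫) x ht
  have e2 := integral_comp_sub_smul (fun y => G y * ξ y) x ht
  rw [h, ← e2] at e1
  have hsm : ∀ z, t⁻¹ • (x - (x - t • z)) = z := fun z => by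
    rw [sub_sub_cancel, smul_smul, inv_mul_cancel₀ ht.ne', one_smul]
  simp only [hξ, gradient_comp_sub_smul hθ, hsm] at e1
  have hwc := hw.continuous_gradient
  have i1 : Integrable (fun z => ⟪B (gradient w (x - t • z)), gradient θ z⟫) :=
    integrable_inner_gradient (by fun_prop) hθ hθc
  have i2 : Integrable (fun z => ⟪F (x - t • z), gradient θ z⟫) :=
    integrable_inner_gradient (by fun_prop) hθ hθc
  have i3 : Integrable (fun z => t * G (x - t • z) * θ z) :=
    integrable_mul_of_hasCompactSupport (by fun_prop) hθ.continuous hθc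
  have e3 : ∀ z, ⟪B (gradient w (x - t • z)) + F (x - t • z), -(t⁻¹ • gradient θ z)⟫
      = -t⁻¹ * (⟪B (gradient w (x - t • z)), gradient θ z⟫
        + ⟪F (x - t • z), gradient θ z⟫) := by
    intro z
    rw [inner_neg_right, inner_smul_right, inner_add_left]
    ring
  simp only [e3] at e1
  rw [integral_const_mul, integral_add i1 i2] at e1
  have e4 : ∫ z, t * G (x - t • z) * θ z = t * ∫ z, G (x - t • z) * θ z := by
    rw [← integral_const_mul]; simp only [mul_assoc]
  have e5 : ∫ z, φ z * ⟪gradient w (x - t • z), z⟫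
      = - ∫ z, ⟪B (gradient w (x - t • z)), gradient θ z⟫ := by
    rw [← integral_neg]
    congr 1; ext z
    rw [hBs, hφθ, inner_smul_right]
    ring
  rw [integral_add i2 i3, e4, e5, ← e1]
  field_simp
  ring

lemma mollify_sub_eq (hBs : ∀ x y, ⟪B x, y⟫ = ⟪x, B y⟫) (hθ : ContDiff ℝ 1 θ)
    (hφ : Continuous φ)
    (hθs : tsupport θ ⊆ closedBall 0 1) (hφs : tsupport φ ⊆ closedBall 0 1)
    (hφθ : ∀ z, B (gradient θ z) = -(φ z) • z) (hφ1 : ∫ z, φ z = 1)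
    (hF : Continuous F) (hG : Continuous G) (hw : ContDiff ℝ 1 w)
    (hweak : WeakEq B F G w (ball 0 1)) {x : E} (hx : ‖x‖ ≤ 1 / 2) :
    w x - ∫ z, w (x - (1 / 4 : ℝ) • z) * φ z
      = ∫ p in Ioc (0 : ℝ) (1 / 4) ×ˢ closedBall (0 : E) 1,
        (⟪F (x - p.1 • p.2), gradient θ p.2⟫ + p.1 * G (x - p.1 • p.2) * θ p.2) := by
  have hwc := hw.continuous
  have hgc := hw.continuous_gradient
  have hθg := hθ.continuous_gradient
  have hθc := hθ.continuous
  have hφc : HasCompactSupport φ :=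
    (isCompact_closedBall (0 : E) 1).of_isClosed_subset (isClosed_tsupport φ) hφs
  have hpi : ∀ {k : ℝ × E → ℝ}, Continuous k →
      IntegrableOn k (Ioc (0 : ℝ) (1 / 4) ×ˢ closedBall (0 : E) 1) := fun hk =>
    (hk.continuousOn.integrableOn_compact (isCompact_Icc.prod (isCompact_closedBall _ _))).mono_set
      (prod_mono_left Ioc_subset_Icc_self)
  have hout : ∀ {k : E → ℝ}, (∀ z, z ∉ closedBall (0 : E) 1 → k z = 0) →
      ∫ z in closedBall (0 : E) 1, k z = ∫ z, k z := fun hk =>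
    setIntegral_eq_integral_of_forall_compl_eq_zero hk
  have hφ0 : ∀ z, z ∉ closedBall (0 : E) 1 → φ z = 0 := fun z hz =>
    image_eq_zero_of_notMem_tsupport fun h => hz (hφs h)
  have hθ0 : ∀ z, z ∉ closedBall (0 : E) 1 → θ z = 0 := fun z hz =>
    image_eq_zero_of_notMem_tsupport fun h => hz (hθs h)
  have hgθ0 : ∀ z, z ∉ closedBall (0 : E) 1 → gradient θ z = 0 := fun z hz =>
    gradient_eq_zero_of_notMem_tsupport fun h => hz (hθs h)
  have ftc : ∀ z, w x - w (x - (1 / 4 : ℝ) • z)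
      = ∫ t in Ioc (0 : ℝ) (1 / 4), ⟪gradient w (x - t • z), z⟫ := by
    intro z
    have hd : ∀ t ∈ uIcc (0 : ℝ) (1 / 4),
        HasDerivAt (fun t : ℝ => - w (x - t • z)) ⟪gradient w (x - t • z), z⟫ t := by
      intro t _
      have h1 := hasGradientAt_iff_hasFDerivAt.1 (hw.hasGradientAt (x - t • z))
      have h2 : HasDerivAt (fun t : ℝ => x - t • z) (-z) t := by
        simpa using ((hasDerivAt_id t).smul_const z).const_sub x
      have h3 : HasDerivAt (fun t : ℝ => - w (x - t • z)) _ t := (h1.comp_hasDerivAt t h2).neg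
      convert h3 using 1
      simp
    have h := intervalIntegral.integral_eq_sub_of_hasDerivAt hd
      (Continuous.intervalIntegrable (by fun_prop) _ _)
    rw [intervalIntegral.integral_of_le (by norm_num)] at h
    rw [h]
    simp only [zero_smul, sub_zero]
    ring
  calc w x - ∫ z, w (x - (1 / 4 : ℝ) • z) * φ z
      = ∫ z, φ z * (w x - w (x - (1 / 4 : ℝ) • z)) := by
        have h1 : ∫ z, w x * φ z = w x := by rw [integral_const_mul, hφ1, mul_one]
        conv_lhs => rw [← h1]
        rw [← integral_sub (integrable_mul_of_hasCompactSupport (by fun_prop) hφ hφc)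
          (integrable_mul_of_hasCompactSupport (by fun_prop) hφ hφc)]
        congr 1; ext z; ring
    _ = ∫ z in closedBall (0 : E) 1, ∫ t in Ioc (0 : ℝ) (1 / 4),
          φ z * ⟪gradient w (x - t • z), z⟫ := by
        rw [← hout fun z hz => by rw [hφ0 z hz, zero_mul]]
        congr 1; ext z
        rw [ftc, integral_const_mul]
    _ = ∫ t in Ioc (0 : ℝ) (1 / 4), ∫ z in closedBall (0 : E) 1,
          φ z * ⟪gradient w (x - t • z), z⟫ := by
        have hi := hpi (k := fun p => φ p.2 * ⟪gradient w (x - p.1 • p.2), p.2⟫) (by fun_prop)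
        rw [IntegrableOn, Measure.volume_eq_prod, ← Measure.prod_restrict] at hi
        exact (integral_integral_swap hi).symm
    _ = ∫ t in Ioc (0 : ℝ) (1 / 4), ∫ z in closedBall (0 : E) 1,
          (⟪F (x - t • z), gradient θ z⟫ + t * G (x - t • z) * θ z) := by
        refine setIntegral_congr_fun measurableSet_Ioc fun t ht => ?_
        rw [hout fun z hz => by rw [hφ0 z hz, zero_mul],
          hout fun z hz => by rw [hθ0 z hz, hgθ0 z hz, inner_zero_right, mul_zero, add_zero]]
        exact mollify_slice hBs hθ hθs hφθ hF hG hw hweak hx ht.1 ht.2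
    _ = _ := by
        exact (setIntegral_prod (fun p : ℝ × E => ⟪F (x - p.1 • p.2), gradient θ p.2⟫
          + p.1 * G (x - p.1 • p.2) * θ p.2) (hpi (by fun_prop))).symm

lemma sq_integral_le {α : Type*} [MeasurableSpace α] {μ : Measure α} [IsFiniteMeasure μ]
    {k : α → ℝ} (hk : Integrable k μ) (hk2 : Integrable (fun a => k a ^ 2) μ) :
    (∫ a, k a ∂μ) ^ 2 ≤ μ.real univ * ∫ a, k a ^ 2 ∂μ := by
  set M := μ.real univ with hM
  set m := ∫ a, k a ∂μ with hm
  rcases eq_or_lt_of_le (measureReal_nonneg : 0 ≤ μ.real univ) with h0 | h0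
  · have hμ : μ = 0 := by
      rw [← Measure.measure_univ_eq_zero]
      exact (measureReal_eq_zero_iff).1 h0.symm
    simp [hm, hM, hμ]
  have h : 0 ≤ ∫ a, (M * k a - m) ^ 2 ∂μ := integral_nonneg fun a => sq_nonneg _
  have e : ∀ a, (M * k a - m) ^ 2 = M ^ 2 * k a ^ 2 - 2 * M * m * k a + m ^ 2 := fun a => by ring
  simp only [e] at h
  have i1 : Integrable (fun a => M ^ 2 * k a ^ 2) μ := hk2.const_mul _
  have i2 : Integrable (fun a => 2 * M * m * k a) μ := hk.const_mul _
  have i3 : Integrable (fun a => M ^ 2 * k a ^ 2 - 2 * M * m * k a) μ := i1.sub i2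
  rw [integral_add i3 (integrable_const _), integral_sub i1 i2, integral_const_mul, integral_const_mul,
    integral_const, smul_eq_mul, ← hm, ← hM] at h
  have h2 : 0 ≤ M * (M * (∫ a, k a ^ 2 ∂μ) - m ^ 2) := by nlinarith
  have := nonneg_of_mul_nonneg_right h2 h0
  linarith

lemma setIntegral_comp_sub_le {h : E → ℝ} (hh : Continuous h) (h0 : ∀ x, 0 ≤ h x) {r s : ℝ}
    {v : E} (hv : r + ‖v‖ ≤ s) :
    ∫ x in closedBall (0 : E) r, h (x - v) ≤ ∫ x in closedBall (0 : E) s, h x := by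
  rw [← integral_indicator measurableSet_closedBall, ← integral_indicator measurableSet_closedBall,
    ← integral_sub_right_eq_self ((closedBall (0 : E) s).indicator h) v]
  refine integral_mono_of_nonneg (ae_of_all _ fun x => indicator_nonneg (fun _ _ => h0 _) _)
    ?_ (ae_of_all _ fun x => ?_)
  · exact ((hh.integrableOn_closedBall 0 s).integrable_indicator
      measurableSet_closedBall).comp_sub_right v
  · by_cases hx : x ∈ closedBall (0 : E) r
    · have hx' : x - v ∈ closedBall (0 : E) s := by
        rw [mem_closedBall_zero_iff] at hx ⊢
        linarith [norm_sub_le x v]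
      simp [indicator_of_mem hx, indicator_of_mem hx']
    · rw [indicator_of_notMem hx]
      exact indicator_nonneg (fun _ _ => h0 _) _

lemma mollify_sub_L2_le (hBs : ∀ x y, ⟪B x, y⟫ = ⟪x, B y⟫) (hθ : ContDiff ℝ 1 θ)
    (hφ : Continuous φ)
    (hθs : tsupport θ ⊆ closedBall 0 1) (hφs : tsupport φ ⊆ closedBall 0 1)
    (hφθ : ∀ z, B (gradient θ z) = -(φ z) • z) (hφ1 : ∫ z, φ z = 1) :
    ∃ C : ℝ, 0 ≤ C ∧ ∀ (w : E → ℝ) (F : E → E) (G : E → ℝ) (ε : ℝ), ContDiff ℝ 1 w →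
      Continuous F → Continuous G → 0 ≤ ε →
      (∀ x ∈ ball (0 : E) 1, ‖F x‖ ≤ ε * (‖gradient w x‖ + 1)) →
      (∀ x ∈ ball (0 : E) 1, |G x| ≤ ε) → WeakEq B F G w (ball 0 1) →
      ∫ x in closedBall (0 : E) (1 / 2), (w x - ∫ z, w (x - (1 / 4 : ℝ) • z) * φ z) ^ 2
        ≤ C * ε ^ 2 * ((∫ x in closedBall (0 : E) (3 / 4), ‖gradient w x‖ ^ 2) + 1) := by
  have hθc : HasCompactSupport θ :=
    (isCompact_closedBall (0 : E) 1).of_isClosed_subset (isClosed_tsupport θ) hθs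
  have hφc : HasCompactSupport φ :=
    (isCompact_closedBall (0 : E) 1).of_isClosed_subset (isClosed_tsupport φ) hφs
  have hθg := hθ.continuous_gradient
  obtain ⟨K₁, hK₁⟩ := hθc.exists_bound_of_continuous hθ.continuous
  obtain ⟨K₂, hK₂⟩ := (hasCompactSupport_gradient hθc).exists_bound_of_continuous hθg
  set K := max K₁ K₂ with hK
  have hK0 : 0 ≤ K := (norm_nonneg _).trans ((hK₁ 0).trans (le_max_left _ _))
  set S : Set (ℝ × E) := Ioc (0 : ℝ) (1 / 4) ×ˢ closedBall (0 : E) 1 with hS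
  have hSm : MeasurableSet S := measurableSet_Ioc.prod measurableSet_closedBall
  have hSK : S ⊆ Icc (0 : ℝ) (1 / 4) ×ˢ closedBall (0 : E) 1 := prod_mono_left Ioc_subset_Icc_self
  have hKc : IsCompact (Icc (0 : ℝ) (1 / 4) ×ˢ closedBall (0 : E) 1) :=
    isCompact_Icc.prod (isCompact_closedBall _ _)
  have hpi : ∀ {k : ℝ × E → ℝ}, Continuous k → IntegrableOn k S := fun hk =>
    (hk.continuousOn.integrableOn_compact hKc).mono_set hSK
  have hSf : volume S < ⊤ := (measure_mono hSK).trans_lt hKc.measure_lt_top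
  have : IsFiniteMeasure (volume.restrict S) := ⟨by simpa using hSf⟩
  set V := (volume.restrict S).real univ with hV
  have hV0 : 0 ≤ V := measureReal_nonneg
  set A := closedBall (0 : E) (1 / 2) with hA
  set W := volume.real A with hW
  have hW0 : 0 ≤ W := measureReal_nonneg
  refine ⟨8 * K ^ 2 * V ^ 2 * (1 + W), by positivity, fun w F G ε hw hF hG hε hFb hGb hweak => ?_⟩
  have hwc := hw.continuous
  have hgc := hw.continuous_gradient
  set I := ∫ x in closedBall (0 : E) (3 / 4), ‖gradient w x‖ ^ 2 with hI
  have hI0 : 0 ≤ I := setIntegral_nonneg measurableSet_closedBall fun _ _ => by positivity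
  set h : E → ℝ × E → ℝ := fun x p => ‖gradient w (x - p.1 • p.2)‖ ^ 2 + 1 with hh
  have hsmall : ∀ p ∈ S, ‖p.1 • p.2‖ ≤ 1 / 4 := by
    rintro ⟨t, z⟩ ⟨ht, hz⟩
    rw [norm_smul, Real.norm_of_nonneg ht.1.le]
    have hz : ‖z‖ ≤ 1 := by simpa using hz
    have ht2 : t ≤ 1 / 4 := ht.2
    have ht1 : 0 < t := ht.1
    change t * ‖z‖ ≤ 1 / 4
    nlinarith [norm_nonneg z]
  have hpt : ∀ x ∈ A, (w x - ∫ z, w (x - (1 / 4 : ℝ) • z) * φ z) ^ 2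
      ≤ 8 * K ^ 2 * ε ^ 2 * V * ∫ p in S, h x p := by
    intro x hx
    have hx : ‖x‖ ≤ 1 / 2 := by simpa [hA] using hx
    rw [mollify_sub_eq hBs hθ hφ hθs hφs hφθ hφ1 hF hG hw hweak hx]
    have hθc' := hθ.continuous
    refine (sq_integral_le (hpi (by fun_prop)) (hpi (by fun_prop))).trans ?_
    rw [← hV, mul_comm _ V, mul_assoc]
    refine mul_le_mul_of_nonneg_left ?_ hV0
    rw [← integral_const_mul]
    refine setIntegral_mono_on (hpi (by fun_prop)) (hpi (by fun_prop)) hSm fun p hp => ?_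
    have hb : x - p.1 • p.2 ∈ ball (0 : E) 1 := by
      rw [mem_ball_zero_iff]
      linarith [norm_sub_le x (p.1 • p.2), hsmall p hp]
    set g := ‖gradient w (x - p.1 • p.2)‖ with hg
    have hg0 : 0 ≤ g := norm_nonneg _
    have b1 : |⟪F (x - p.1 • p.2), gradient θ p.2⟫| ≤ ε * (g + 1) * K :=
      (abs_real_inner_le_norm _ _).trans (mul_le_mul (hFb _ hb)
        ((hK₂ _).trans (le_max_right _ _)) (norm_nonneg _) (by positivity))
    have b2 : |p.1 * G (x - p.1 • p.2) * θ p.2| ≤ ε * (g + 1) * K := by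
      rw [abs_mul, abs_mul]
      refine mul_le_mul ?_ ((hK₁ _).trans (le_max_left _ _)) (abs_nonneg _) (by positivity)
      have t1 : |p.1| ≤ 1 := by
        rw [abs_of_pos hp.1.1]; linarith [hp.1.2]
      calc |p.1| * |G (x - p.1 • p.2)| ≤ 1 * ε := by
            gcongr; exact hGb _ hb
        _ ≤ ε * (g + 1) := by nlinarith
    have b3 : |⟪F (x - p.1 • p.2), gradient θ p.2⟫ + p.1 * G (x - p.1 • p.2) * θ p.2|
        ≤ 2 * K * ε * (g + 1) := by
      refine (abs_add_le _ _).trans ?_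
      linarith
    calc _ ≤ (2 * K * ε * (g + 1)) ^ 2 := sq_le_sq.2 (b3.trans (le_abs_self _))
      _ = 4 * K ^ 2 * ε ^ 2 * (g + 1) ^ 2 := by ring
      _ ≤ 4 * K ^ 2 * ε ^ 2 * (2 * (g ^ 2 + 1)) := by
        gcongr; nlinarith [sq_nonneg (g - 1)]
      _ = _ := by simp only [hh]; ring
  have hJ : Continuous fun x => ∫ z, w (x - (1 / 4 : ℝ) • z) * φ z := by
    have : ∀ x, ∫ z, w (x - (1 / 4 : ℝ) • z) * φ z
        = ∫ z in closedBall (0 : E) 1, w (x - (1 / 4 : ℝ) • z) * φ z := fun x =>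
      (setIntegral_eq_integral_of_forall_compl_eq_zero fun z hz => by
        rw [image_eq_zero_of_notMem_tsupport fun h => hz (hφs h), mul_zero]).symm
    simp only [this]
    exact continuous_parametric_integral_of_continuous (by fun_prop) (isCompact_closedBall _ _)
  have hfub : Integrable (Function.uncurry h) ((volume.restrict A).prod (volume.restrict S)) := by
    rw [Measure.prod_restrict, ← Measure.volume_eq_prod]
    have hc : Continuous (Function.uncurry h) := by
      simp only [hh, Function.uncurry_def]
      fun_prop
    exact (hc.continuousOn.integrableOn_compact
      ((isCompact_closedBall (0 : E) (1 / 2)).prod hKc)).mono_set (prod_mono_right hSK)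
  have hin : ∀ p ∈ S, ∫ x in A, h x p ≤ I + W := by
    intro p hp
    simp only [hh]
    rw [integral_add (Continuous.integrableOn_closedBall (by fun_prop) _ _)
      (Continuous.integrableOn_closedBall (by fun_prop) _ _)]
    have h1 := setIntegral_comp_sub_le (h := fun x => ‖gradient w x‖ ^ 2) (by fun_prop)
      (fun _ => by positivity) (r := 1 / 2) (s := 3 / 4) (v := p.1 • p.2)
      (by linarith [hsmall p hp])
    have h2 : ∫ _ in A, (1 : ℝ) = W := by simp [hW]
    rw [h2]
    linarith
  calc _ ≤ ∫ x in A, 8 * K ^ 2 * ε ^ 2 * V * ∫ p in S, h x p :=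
        setIntegral_mono_on (Continuous.integrableOn_closedBall (by fun_prop) _ _)
          (hfub.integral_prod_left.const_mul _) measurableSet_closedBall hpt
    _ = 8 * K ^ 2 * ε ^ 2 * V * ∫ p in S, ∫ x in A, h x p := by
        rw [integral_const_mul, integral_integral_swap hfub]
    _ ≤ 8 * K ^ 2 * ε ^ 2 * V * ∫ p in S, (I + W) := by
        gcongr 1
        refine setIntegral_mono_on hfub.integral_prod_right (integrable_const _) hSm hin
    _ = 8 * K ^ 2 * V ^ 2 * ε ^ 2 * (I + W) := by
        rw [integral_const, smul_eq_mul, ← hV]; ring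
    _ ≤ 8 * K ^ 2 * V ^ 2 * ε ^ 2 * ((1 + W) * (I + 1)) := by
        gcongr; nlinarith
    _ = _ := by ring

end Mollification

/-! ### Quadratic approximation of weak solutions at one scale -/

section QuadraticApproximation

open scoped Topology ContDiff
open Module (finrank)

variable {E : Type*} [NormedAddCommGroup E] [InnerProductSpace ℝ E] [FiniteDimensional ℝ E]
  [MeasurableSpace E] [BorelSpace E]

omit [MeasurableSpace E] [BorelSpace E] in
lemma continuous_hess {ψ : E → ℝ} (hψ : ContDiff ℝ 2 ψ) : Continuous (hess ψ) := by
  have h : ContDiff ℝ ((1 : ℕ∞) : WithTop ℕ∞) (gradient ψ) :=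
    ContDiff.contDiff_gradient (k := 2) hψ (by norm_num)
  exact h.continuous_fderiv (by norm_num)

omit [MeasurableSpace E] [BorelSpace E] in
lemma exists_bound_of_tsupport_subset {V : Type*} [NormedAddCommGroup V] {h : E → V} {r : ℝ}
    (hh : Continuous h) (hs : ∀ x, x ∉ closedBall (0 : E) r → h x = 0) :
    ∃ K, 0 ≤ K ∧ ∀ x, ‖h x‖ ≤ K := by
  obtain ⟨K, hK⟩ := (isCompact_closedBall (0 : E) r).exists_bound_of_continuousOn hh.continuousOn
  refine ⟨max K 0, le_max_right _ _, fun x => ?_⟩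
  by_cases hx : x ∈ closedBall (0 : E) r
  · exact (hK x hx).trans (le_max_left _ _)
  · rw [hs x hx, norm_zero]; exact le_max_right _ _

omit [MeasurableSpace E] [BorelSpace E] in
lemma opTrace_comp_integral {α : Type*} [MeasurableSpace α] {μ : Measure α} (B : E →L[ℝ] E)
    {h : α → E →L[ℝ] E} (hh : Integrable h μ) :
    opTrace (B.comp (∫ a, h a ∂μ)) = ∫ a, opTrace (B.comp (h a)) ∂μ := by
  let T : (E →L[ℝ] E) →L[ℝ] ℝ :=
    { toFun := fun L => opTrace (B.comp L)
      map_add' := fun L M => by rw [ContinuousLinearMap.comp_add, opTrace_add]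
      map_smul' := fun c L => by
        rw [ContinuousLinearMap.comp_smul, opTrace_smul, RingHom.id_apply, smul_eq_mul]
      cont := continuous_opTrace.comp (by fun_prop) }
  exact (T.integral_comp_comm hh).symm

lemma norm_integral_smul_le {V : Type*} [NormedAddCommGroup V] [NormedSpace ℝ V]
    {w : E → ℝ} (hw : Continuous w) {h : E → V} {K r : ℝ} (hK0 : 0 ≤ K)
    (hK : ∀ x ∈ closedBall (0 : E) r, ‖h x‖ ≤ K) :
    ‖∫ x in closedBall (0 : E) r, w x • h x‖
      ≤ K * ((∫ x in closedBall (0 : E) r, w x ^ 2) + volume.real (closedBall (0 : E) r)) := by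
  have e : (∫ x in closedBall (0 : E) r, w x ^ 2) + volume.real (closedBall (0 : E) r)
      = ∫ x in closedBall (0 : E) r, (w x ^ 2 + 1) := by
    rw [integral_add (Continuous.integrableOn_closedBall (by fun_prop) _ _)
      (Continuous.integrableOn_closedBall (by fun_prop) _ _)]
    simp
  rw [e, ← integral_const_mul]
  refine norm_integral_le_of_norm_le (Continuous.integrableOn_closedBall (by fun_prop) _ _) ?_
  refine (ae_restrict_iff' measurableSet_closedBall).2 (ae_of_all _ fun x hx => ?_)
  rw [norm_smul, mul_comm]
  refine mul_le_mul (hK x hx) ?_ (norm_nonneg _) hK0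
  rw [Real.norm_eq_abs, ← sq_abs]
  nlinarith [sq_nonneg (|w x| - 1), abs_nonneg (w x)]

variable {B : E →L[ℝ] E} {l : ℝ}

set_option maxHeartbeats 1000000 in
lemma exists_quadratic_approx [Nontrivial E] (hl : 0 < l)
    (hBs : ∀ x y, ⟪B x, y⟫ = ⟪x, B y⟫) (hB : ∀ v, l * ‖v‖ ^ 2 ≤ ⟪B v, v⟫) :
    ∃ C : ℝ, 1 ≤ C ∧ ∀ (w : E → ℝ) (F : E → E) (G : E → ℝ) (ε : ℝ), ContDiff ℝ 1 w →
      Continuous F → Continuous G → 0 ≤ ε → ε ≤ 1 → ε ≤ l / 8 →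
      (∀ x ∈ ball (0 : E) 1, ‖F x‖ ≤ ε * (‖gradient w x‖ + 1)) →
      (∀ x ∈ ball (0 : E) 1, |G x| ≤ ε) → WeakEq B F G w (ball 0 1) →
      ∫ x in closedBall (0 : E) 1, w x ^ 2 ≤ 1 →
      ∃ (a : ℝ) (q : E) (H : E →L[ℝ] E), |a| ≤ C ∧ ‖q‖ ≤ C ∧ ‖H‖ ≤ C ∧
        (∀ x y, ⟪H x, y⟫ = ⟪x, H y⟫) ∧ |opTrace (B.comp H)| ≤ C * ε ∧
        ∀ r, 0 ≤ r → r ≤ 1 / 2 →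
          ∫ x in closedBall (0 : E) r, (w x - (a + ⟪q, x⟫ + ⟪H x, x⟫ / 2)) ^ 2
            ≤ C * (r ^ (finrank ℝ E + 6) + ε ^ 2) := by
  obtain ⟨θ, φ, hθ, hφ, hθs, hφs, hφθ, hφ1⟩ := exists_adapted_kernel hl hBs hB
  obtain ⟨C₁, hC₁0, hC₁⟩ := caccioppoli hl hB
  obtain ⟨C₂, hC₂0, hC₂⟩ := mollify_sub_L2_le hBs (hθ.of_le (by exact_mod_cast le_top))
    hφ.continuous hθs hφs hφθ hφ1
  set d := finrank ℝ E with hd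
  set ψ : E → ℝ := fun v => (4 : ℝ) ^ d * φ (-(4 : ℝ) • v) with hψ
  have hψc : ContDiff ℝ ∞ ψ := contDiff_const.mul (hφ.comp (contDiff_const.smul contDiff_id))
  have hψs : tsupport ψ ⊆ closedBall 0 (1 / 4) := by
    refine closure_minimal (fun y hy => ?_) isClosed_closedBall
    have h0 : φ (-(4 : ℝ) • y) ≠ 0 := right_ne_zero_of_mul (Function.mem_support.1 hy)
    have h1 : -(4 : ℝ) • y ∈ closedBall (0 : E) 1 := hφs (subset_tsupport _ h0)
    rw [mem_closedBall_zero_iff, norm_smul] at h1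
    rw [mem_closedBall_zero_iff]
    norm_num at h1
    linarith
  have hψcs : HasCompactSupport ψ :=
    (isCompact_closedBall (0 : E) (1 / 4)).of_isClosed_subset (isClosed_tsupport ψ) hψs
  have hψ1 : ContDiff ℝ 1 ψ := hψc.of_le (by exact_mod_cast le_top)
  have hψ2 : ContDiff ℝ 2 ψ := by exact_mod_cast contDiff_infty.1 hψc 2
  have hψ3 : ContDiff ℝ 3 ψ := by exact_mod_cast contDiff_infty.1 hψc 3
  have hgψ : ContDiff ℝ ((1 : ℕ∞) : WithTop ℕ∞) (gradient ψ) :=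
    ContDiff.contDiff_gradient (k := 2) hψ2 (by norm_num)
  have hhc := continuous_hess hψ2
  have hgc := hψ1.continuous_gradient
  have hψcont := hψ1.continuous
  have ψ0 : ∀ z, z ∉ closedBall (0 : E) (1 / 4) → ψ z = 0 := fun z hz =>
    image_eq_zero_of_notMem_tsupport fun h => hz (hψs h)
  have gψ0 : ∀ z, z ∉ closedBall (0 : E) (1 / 4) → gradient ψ z = 0 := fun z hz =>
    gradient_eq_zero_of_notMem_tsupport fun h => hz (hψs h)
  have hess0 : ∀ z, z ∉ closedBall (0 : E) (1 / 4) → hess ψ z = 0 := fun z hz => by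
    have : (gradient ψ) =ᶠ[𝓝 z] fun _ => 0 := by
      filter_upwards [isClosed_closedBall.isOpen_compl.mem_nhds hz] with y hy using gψ0 y hy
    rw [hess, this.fderiv_eq, fderiv_fun_const, Pi.zero_apply]
  obtain ⟨K₀, hK₀0, hK₀⟩ := exists_bound_of_tsupport_subset hψcont ψ0
  obtain ⟨K₁, hK₁0, hK₁⟩ := exists_bound_of_tsupport_subset hgc gψ0
  obtain ⟨K₂, hK₂0, hK₂⟩ := exists_bound_of_tsupport_subset hhc hess0
  obtain ⟨C₃, hC₃0, hC₃⟩ := taylor_two_of_hasCompactSupport hψ3 hψcs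
  set V := volume.real (closedBall (0 : E) 1) with hV
  have hV0 : 0 ≤ V := measureReal_nonneg
  set V' := volume.real (closedBall (0 : E) (3 / 4)) with hV'
  have hV'0 : 0 ≤ V' := measureReal_nonneg
  set D := K₀ * (1 + V) + K₁ * (1 + V) + K₂ * (1 + V) + (K₁ * (C₁ + 2 * V') + K₀ * V')
    + 2 * ((C₃ * (1 + V)) ^ 2 * V) + 2 * (C₂ * (C₁ + 1)) with hD
  have d0 : 0 ≤ K₀ * (1 + V) := by positivity
  have d1 : 0 ≤ K₁ * (1 + V) := by positivity
  have d2 : 0 ≤ K₂ * (1 + V) := by positivity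
  have d3 : 0 ≤ K₁ * (C₁ + 2 * V') + K₀ * V' := by positivity
  have d4 : 0 ≤ 2 * ((C₃ * (1 + V)) ^ 2 * V) := by positivity
  have d5 : 0 ≤ 2 * (C₂ * (C₁ + 1)) := by positivity
  refine ⟨1 + D, by linarith, fun w F G ε hw hF hG hε hε1 hεl hFb hGb hweak hw2 => ?_⟩
  have hwc := hw.continuous
  have hwg := hw.continuous_gradient
  have hgrad := hC₁ w F G ε hw hF hG hε hε1 hεl hFb hGb hweak hw2
  have hmol := hC₂ w F G ε hw hF hG hε hFb hGb hweak
  set a := ∫ y in closedBall (0 : E) 1, w y • ψ y with ha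
  set q := -∫ y in closedBall (0 : E) 1, w y • gradient ψ y with hq
  set H := ∫ y in closedBall (0 : E) 1, w y • hess ψ y with hH
  have hVle : (∫ x in closedBall (0 : E) 1, w x ^ 2) + V ≤ 1 + V := by linarith
  have ba : |a| ≤ K₀ * (1 + V) := (norm_integral_smul_le hwc hK₀0 fun x _ => hK₀ x).trans
    (mul_le_mul_of_nonneg_left hVle hK₀0)
  have bq : ‖q‖ ≤ K₁ * (1 + V) := by
    rw [hq, norm_neg]
    exact (norm_integral_smul_le hwc hK₁0 fun x _ => hK₁ x).trans
      (mul_le_mul_of_nonneg_left hVle hK₁0)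
  have bH : ‖H‖ ≤ K₂ * (1 + V) := (norm_integral_smul_le hwc hK₂0 fun x _ => hK₂ x).trans
    (mul_le_mul_of_nonneg_left hVle hK₂0)
  have iH : IntegrableOn (fun y => w y • hess ψ y) (closedBall (0 : E) 1) :=
    Continuous.integrableOn_closedBall (by fun_prop) _ _
  have iq : IntegrableOn (fun y => w y • gradient ψ y) (closedBall (0 : E) 1) :=
    Continuous.integrableOn_closedBall (by fun_prop) _ _
  have ia : IntegrableOn (fun y => w y • ψ y) (closedBall (0 : E) 1) :=
    Continuous.integrableOn_closedBall (by fun_prop) _ _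
  have Happ : ∀ x y, ⟪H x, y⟫ = ∫ z in closedBall (0 : E) 1, w z * ⟪hess ψ z x, y⟫ := by
    intro x y
    rw [hH, ContinuousLinearMap.integral_apply iH, real_inner_comm,
      ← integral_inner (iH.apply_continuousLinearMap x)]
    congr 1; ext z
    rw [smul_apply, inner_smul_right, real_inner_comm]
  have qapp : ∀ x, ⟪q, x⟫ = -∫ z in closedBall (0 : E) 1, w z * ⟪gradient ψ z, x⟫ := by
    intro x
    rw [hq, inner_neg_left, real_inner_comm, ← integral_inner iq]
    congr 2; ext z
    rw [inner_smul_right, real_inner_comm]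
  have Hsym : ∀ x y, ⟪H x, y⟫ = ⟪x, H y⟫ := by
    intro x y
    rw [real_inner_comm (H y) x, Happ, Happ]
    congr 1; ext z
    rw [hess_symm hψ2, real_inner_comm]
  have hsub : closedBall (0 : E) (1 / 4) ⊆ closedBall 0 (3 / 4) :=
    closedBall_subset_closedBall (by norm_num)
  have btr : |opTrace (B.comp H)| ≤ (K₁ * (C₁ + 2 * V') + K₀ * V') * ε := by
    have e1 : opTrace (B.comp H) = ∫ y, opTrace (B.comp (hess ψ y)) * w y := by
      rw [← setIntegral_eq_integral_of_forall_compl_eq_zero (s := closedBall (0 : E) 1)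
        (f := fun y => opTrace (B.comp (hess ψ y)) * w y), hH, opTrace_comp_integral B iH]
      · congr 1; ext y
        rw [ContinuousLinearMap.comp_smul, opTrace_smul, mul_comm]
      · intro y hy
        rw [hess0 y fun h => hy (closedBall_subset_closedBall (by norm_num) h)]
        have : opTrace (0 : E →L[ℝ] E) = 0 := by
          simpa using opTrace_smul (0 : ℝ) (0 : E →L[ℝ] E)
        rw [ContinuousLinearMap.comp_zero, this, zero_mul]
    have hX : ContDiff ℝ 1 fun x => B (gradient ψ x) := B.contDiff.comp hgψ
    have hXc : HasCompactSupport fun x => B (gradient ψ x) :=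
      (hasCompactSupport_gradient hψcs).comp_left (g := B) (map_zero B)
    have e2 := integral_inner_gradient_eq hX hw (Or.inl hXc)
    have e3 : ∀ x, fderiv ℝ (fun x => B (gradient ψ x)) x = B.comp (hess ψ x) := fun x =>
      (B.hasFDerivAt.comp x ((hgψ.differentiable (by norm_num)) x).hasFDerivAt).fderiv
    simp only [e3] at e2
    have e4 := hweak ψ hψ1 hψcs (hψs.trans (closedBall_subset_ball (by norm_num)))
    have i1 : Integrable (fun x => ⟪B (gradient w x), gradient ψ x⟫) :=
      integrable_inner_gradient (by fun_prop) hψ1 hψcs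
    have i2 : Integrable (fun x => ⟪F x, gradient ψ x⟫) :=
      integrable_inner_gradient (by fun_prop) hψ1 hψcs
    simp only [inner_add_left] at e4
    rw [integral_add i1 i2] at e4
    have e5 : ∫ x, ⟪B (gradient w x), gradient ψ x⟫ = ∫ x, ⟪B (gradient ψ x), gradient w x⟫ := by
      congr 1; ext x
      rw [hBs, real_inner_comm]
    have e6 : opTrace (B.comp H) = (∫ x, ⟪F x, gradient ψ x⟫) - ∫ x, G x * ψ x := by
      rw [e1]; linarith
    have hb : ∀ x ∈ closedBall (0 : E) (3 / 4), x ∈ ball (0 : E) 1 := fun x hx =>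
      closedBall_subset_ball (by norm_num) hx
    have b1 : |∫ x, ⟪F x, gradient ψ x⟫| ≤ K₁ * (C₁ + 2 * V') * ε := by
      rw [← setIntegral_eq_integral_of_forall_compl_eq_zero (s := closedBall (0 : E) (3 / 4))
        fun x hx => by rw [gψ0 x fun h => hx (hsub h), inner_zero_right]]
      refine (norm_integral_le_of_norm_le
        (g := fun x => K₁ * ε * (‖gradient w x‖ ^ 2 + 2)) (f := fun x => ⟪F x, gradient ψ x⟫)
        (Continuous.integrableOn_closedBall (by fun_prop) _ _)
        ((ae_restrict_iff' measurableSet_closedBall).2 (ae_of_all _ fun x hx => ?_))).trans ?_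
      · calc ‖⟪F x, gradient ψ x⟫‖ ≤ ‖F x‖ * ‖gradient ψ x‖ := abs_real_inner_le_norm _ _
          _ ≤ ε * (‖gradient w x‖ + 1) * K₁ := by
            gcongr
            · exact hFb x (hb x hx)
            · exact hK₁ x
          _ = K₁ * ε * (‖gradient w x‖ + 1) := by ring
          _ ≤ _ := by
            refine mul_le_mul_of_nonneg_left ?_ (by positivity)
            nlinarith [sq_nonneg (‖gradient w x‖ - 1), norm_nonneg (gradient w x)]
      · rw [integral_const_mul, integral_add (Continuous.integrableOn_closedBall (by fun_prop) _ _)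
          (Continuous.integrableOn_closedBall (by fun_prop) _ _), integral_const, smul_eq_mul,
          measureReal_restrict_apply_univ, ← hV']
        calc _ ≤ K₁ * ε * (C₁ + V' * 2) := by gcongr
          _ = _ := by ring
    have b2 : |∫ x, G x * ψ x| ≤ K₀ * V' * ε := by
      rw [← setIntegral_eq_integral_of_forall_compl_eq_zero (s := closedBall (0 : E) (3 / 4))
        fun x hx => by rw [ψ0 x fun h => hx (hsub h), mul_zero]]
      rw [← Real.norm_eq_abs]
      refine (norm_setIntegral_le_of_norm_le_const (C := ε * K₀) (isCompact_closedBall _ _).measure_lt_top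
        fun x hx => ?_).trans_eq ?_
      · rw [norm_mul]
        exact mul_le_mul (hGb x (hb x hx)) (hK₀ x) (norm_nonneg _) hε
      · rw [← hV']; ring
    rw [e6]
    refine (abs_sub _ _).trans ?_
    linarith
  refine ⟨a, q, H, by linarith, by linarith, by linarith, Hsym, ?_, fun r hr hr2 => ?_⟩
  · refine btr.trans (mul_le_mul_of_nonneg_right (by linarith) hε)
  set J : E → ℝ := fun x => ∫ z, w (x - (1 / 4 : ℝ) • z) * φ z with hJ
  have Jeq : ∀ x ∈ closedBall (0 : E) (1 / 2),
      J x = ∫ y in closedBall (0 : E) 1, w y * ψ (y - x) := by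
    intro x hx
    have h1 := integral_comp_sub_smul (fun y => w y * ψ (y - x)) x (t := 1 / 4) (by norm_num)
    have h2 : ∀ z, ψ (x - (1 / 4 : ℝ) • z - x) = (4 : ℝ) ^ d * φ z := by
      intro z
      simp only [hψ]
      rw [sub_sub_cancel_left, smul_neg, neg_smul, neg_neg, smul_smul]
      norm_num
    rw [setIntegral_eq_integral_of_forall_compl_eq_zero (s := closedBall (0 : E) 1)]
    · simp only [h2] at h1
      have h3 : ∀ z, w (x - (1 / 4 : ℝ) • z) * ((4 : ℝ) ^ d * φ z)
          = (4 : ℝ) ^ d * (w (x - (1 / 4 : ℝ) • z) * φ z) := fun z => by ring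
      simp only [h3] at h1
      rw [integral_const_mul, one_div, inv_pow, inv_inv] at h1
      have := mul_left_cancel₀ (pow_ne_zero d (by norm_num : (4 : ℝ) ≠ 0)) h1
      simpa [hJ] using this
    · intro y hy
      rw [ψ0, mul_zero]
      rw [mem_closedBall_zero_iff] at hx hy ⊢
      intro h
      have := norm_sub_norm_le y x
      linarith
  have htay : ∀ x ∈ closedBall (0 : E) (1 / 2),
      |J x - (a + ⟪q, x⟫ + ⟪H x, x⟫ / 2)| ≤ C₃ * ‖x‖ ^ 3 * (1 + V) := by
    intro x hx
    have e : J x - (a + ⟪q, x⟫ + ⟪H x, x⟫ / 2) = ∫ y in closedBall (0 : E) 1,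
        w y • (ψ (-x + y) - ψ y - ⟪gradient ψ y, -x⟫ - ⟪hess ψ y (-x), -x⟫ / 2) := by
      have e1 : ∀ y, w y • (ψ (-x + y) - ψ y - ⟪gradient ψ y, -x⟫ - ⟪hess ψ y (-x), -x⟫ / 2)
          = w y * ψ (y - x) - w y • ψ y + w y * ⟪gradient ψ y, x⟫
            - w y * ⟪hess ψ y x, x⟫ / 2 := by
        intro y
        rw [map_neg, inner_neg_neg, inner_neg_right, neg_add_eq_sub, smul_eq_mul, smul_eq_mul]
        ring
      simp only [e1]
      have j1 : IntegrableOn (fun y => w y * ψ (y - x)) (closedBall (0 : E) 1) :=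
        Continuous.integrableOn_closedBall (by fun_prop) _ _
      have j2 : IntegrableOn (fun y => w y * ⟪gradient ψ y, x⟫) (closedBall (0 : E) 1) :=
        Continuous.integrableOn_closedBall (by fun_prop) _ _
      have j3 : IntegrableOn (fun y => w y * ⟪hess ψ y x, x⟫ / 2) (closedBall (0 : E) 1) :=
        Continuous.integrableOn_closedBall (by fun_prop) _ _
      have j4 : IntegrableOn (fun y => w y * ψ (y - x) - w y • ψ y) (closedBall (0 : E) 1) :=
        j1.sub ia
      have j5 : IntegrableOn (fun y => w y * ψ (y - x) - w y • ψ y + w y * ⟪gradient ψ y, x⟫)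
        (closedBall (0 : E) 1) := j4.add j2
      rw [integral_sub j5 j3, integral_add j4 j2, integral_sub j1 ia, integral_div, Jeq x hx,
        qapp, Happ, ← ha]
      ring
    rw [e, ← Real.norm_eq_abs]
    refine (norm_integral_smul_le hwc (K := C₃ * ‖x‖ ^ 3) (by positivity) fun y _ => ?_).trans
      (mul_le_mul_of_nonneg_left hVle (by positivity))
    have := hC₃ (-x) y
    rw [norm_neg, add_comm] at this
    exact this
  have hJc : Continuous J := by
    have : ∀ x, J x
        = ∫ z in closedBall (0 : E) 1, w (x - (1 / 4 : ℝ) • z) * φ z := fun x =>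
      (setIntegral_eq_integral_of_forall_compl_eq_zero fun z hz => by
        rw [image_eq_zero_of_notMem_tsupport fun h => hz (hφs h), mul_zero]).symm
    have hφc := hφ.continuous
    rw [funext this]
    exact continuous_parametric_integral_of_continuous (by fun_prop) (isCompact_closedBall _ _)
  have hr12 : closedBall (0 : E) r ⊆ closedBall 0 (1 / 2) := closedBall_subset_closedBall hr2
  have hvol : volume.real (closedBall (0 : E) r) = r ^ d * V := by
    rw [hV, Measure.real, Measure.addHaar_closedBall' volume (0 : E) hr]
    simp [hd, Measure.real, hr]
  calc ∫ x in closedBall (0 : E) r, (w x - (a + ⟪q, x⟫ + ⟪H x, x⟫ / 2)) ^ 2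
      ≤ ∫ x in closedBall (0 : E) r,
          (2 * (w x - J x) ^ 2 + 2 * (C₃ * r ^ 3 * (1 + V)) ^ 2) := by
        refine setIntegral_mono_on (Continuous.integrableOn_closedBall (by fun_prop) _ _)
          (Continuous.integrableOn_closedBall (by fun_prop) _ _) measurableSet_closedBall
          fun x hx => ?_
        have h1 := htay x (hr12 hx)
        have hxr : ‖x‖ ≤ r := mem_closedBall_zero_iff.1 hx
        have h2 : |J x - (a + ⟪q, x⟫ + ⟪H x, x⟫ / 2)| ≤ C₃ * r ^ 3 * (1 + V) :=
          h1.trans (by gcongr)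
        have h3 : (J x - (a + ⟪q, x⟫ + ⟪H x, x⟫ / 2)) ^ 2 ≤ (C₃ * r ^ 3 * (1 + V)) ^ 2 :=
          sq_le_sq.2 (h2.trans (le_abs_self _))
        nlinarith [sq_nonneg ((w x - J x) - (J x - (a + ⟪q, x⟫ + ⟪H x, x⟫ / 2)))]
    _ = 2 * (∫ x in closedBall (0 : E) r, (w x - J x) ^ 2)
          + 2 * (C₃ * r ^ 3 * (1 + V)) ^ 2 * (r ^ d * V) := by
        rw [integral_add (Continuous.integrableOn_closedBall (by fun_prop) _ _)
          (Continuous.integrableOn_closedBall (by fun_prop) _ _), integral_const_mul,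
          integral_const, smul_eq_mul, measureReal_restrict_apply_univ, hvol]
        ring
    _ ≤ 2 * (C₂ * ε ^ 2 * (C₁ + 1)) + 2 * (C₃ * r ^ 3 * (1 + V)) ^ 2 * (r ^ d * V) := by
        gcongr
        refine (setIntegral_mono_set (Continuous.integrableOn_closedBall (by fun_prop) _ _)
          (ae_of_all _ fun x => sq_nonneg _) (ae_of_all _ hr12)).trans ?_
        refine hmol.trans ?_
        gcongr
    _ = 2 * (C₂ * (C₁ + 1)) * ε ^ 2 + 2 * ((C₃ * (1 + V)) ^ 2 * V) * r ^ (d + 6) := by ring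
    _ ≤ (1 + D) * ε ^ 2 + (1 + D) * r ^ (d + 6) := by
        gcongr <;> linarith
    _ = _ := by ring

end QuadraticApproximation

/-! ### Subtraction of quadratic polynomials and rescaling -/

section Rescaling

open scoped Topology ContDiff
open Module (finrank)

variable {E : Type*} [NormedAddCommGroup E] [InnerProductSpace ℝ E] [FiniteDimensional ℝ E]
  [MeasurableSpace E] [BorelSpace E]

/-- The quadratic polynomial `a + ⟪q, x⟫ + ⟪M x, x⟫ / 2`. -/
def quad (a : ℝ) (q : E) (M : E →L[ℝ] E) (x : E) : ℝ := a + ⟪q, x⟫ + ⟪M x, x⟫ / 2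

omit [FiniteDimensional ℝ E] [MeasurableSpace E] [BorelSpace E] in
lemma contDiff_quad (a : ℝ) (q : E) (M : E →L[ℝ] E) : ContDiff ℝ 1 (quad a q M) := by
  unfold quad
  exact (contDiff_const.add (contDiff_const.inner ℝ contDiff_id)).add
    ((M.contDiff.inner ℝ contDiff_id).div_const _)

omit [MeasurableSpace E] [BorelSpace E] in
lemma hasGradientAt_quad (a : ℝ) (q : E) {M : E →L[ℝ] E} (hM : ∀ x y, ⟪M x, y⟫ = ⟪x, M y⟫)
    (x : E) : HasGradientAt (quad a q M) (q + M x) x := by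
  rw [hasGradientAt_iff_hasFDerivAt]
  have h1 : HasFDerivAt (fun x => a + ⟪q, x⟫) (innerSL ℝ q) x :=
    ((innerSL ℝ q).hasFDerivAt).const_add a
  have h2 := ((M.hasFDerivAt (x := x)).inner ℝ (hasFDerivAt_id x)).const_mul (1 / 2 : ℝ)
  refine (h1.add h2).congr_of_eventuallyEq (Eventually.of_forall fun y => ?_) |>.congr_fderiv ?_
  · simp [quad]; ring
  · ext v
    simp [hM v x, real_inner_comm v (M x)]
    ring

omit [MeasurableSpace E] [BorelSpace E] in
lemma gradient_comp_smul {θ : E → ℝ} (hθ : ContDiff ℝ 1 θ) (s : ℝ) (y : E) :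
    gradient (fun y => θ (s • y)) y = s • gradient θ (s • y) := by
  refine HasGradientAt.gradient ?_
  have h1 := hasGradientAt_iff_hasFDerivAt.1 (hθ.hasGradientAt (s • y))
  have h2 : HasFDerivAt (fun y : E => s • y) (s • (ContinuousLinearMap.id ℝ E)) y :=
    (hasFDerivAt_id y).const_smul s
  rw [hasGradientAt_iff_hasFDerivAt]
  refine (h1.comp y h2).congr_fderiv ?_
  ext v
  simp

omit [MeasurableSpace E] [BorelSpace E] in
lemma gradient_rescale {u : E → ℝ} (hu : ContDiff ℝ 1 u) (a : ℝ) (q : E) {M : E →L[ℝ] E}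
    (hM : ∀ x y, ⟪M x, y⟫ = ⟪x, M y⟫) (r c : ℝ) (y : E) :
    gradient (fun y => c * (u (r • y) - quad a q M (r • y))) y
      = (c * r) • (gradient u (r • y) - (q + M (r • y))) := by
  have h1 : ContDiff ℝ 1 fun x => c * (u x - quad a q M x) :=
    contDiff_const.mul (hu.sub (contDiff_quad a q M))
  rw [gradient_comp_smul h1 r y]
  have h2 : HasGradientAt (fun x => c * (u x - quad a q M x))
      (c • (gradient u (r • y) - (q + M (r • y)))) (r • y) := by
    have h3 := hasGradientAt_iff_hasFDerivAt.1 (hu.hasGradientAt (r • y))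
    have h4 := hasGradientAt_iff_hasFDerivAt.1 (hasGradientAt_quad a q hM (r • y))
    rw [hasGradientAt_iff_hasFDerivAt]
    refine ((h3.sub h4).const_mul c).congr_fderiv ?_
    rw [LinearIsometryEquiv.map_smul, ← LinearIsometryEquiv.map_sub]
  rw [h2.gradient, smul_smul, mul_comm]

variable {B D : E →L[ℝ] E} {u g : E → ℝ} {F : E → E}

lemma WeakEq.comp_smul (h : WeakEq B F g u (ball 0 1)) {r : ℝ} (hr : 0 < r) (hr1 : r ≤ 1)
    {ξ : E → ℝ} (hξ : ContDiff ℝ 1 ξ) (hξs : tsupport ξ ⊆ ball 0 1) :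
    ∫ y, ⟪B (gradient u (r • y)) + F (r • y), gradient ξ y⟫ = r * ∫ y, g (r • y) * ξ y := by
  set ζ : E → ℝ := fun x => ξ (r⁻¹ • x) with hζ
  have hζ1 : ContDiff ℝ 1 ζ := hξ.comp (contDiff_const.smul contDiff_id)
  have hζs : tsupport ζ ⊆ (fun x => r⁻¹ • x) ⁻¹' tsupport ξ :=
    closure_minimal (fun x hx => subset_tsupport ξ hx)
      ((isClosed_tsupport ξ).preimage (by fun_prop))
  have hζb : tsupport ζ ⊆ ball 0 1 := fun x hx => by
    have h1 := hξs (hζs hx)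
    rw [mem_ball_zero_iff, norm_smul, norm_inv, Real.norm_of_nonneg hr.le,
      inv_mul_lt_iff₀ hr] at h1
    rw [mem_ball_zero_iff]
    linarith
  have hζc : HasCompactSupport ζ :=
    (isCompact_closedBall (0 : E) 1).of_isClosed_subset (isClosed_tsupport ζ)
      (hζb.trans ball_subset_closedBall)
  have e := h ζ hζ1 hζc hζb
  have e1 := Measure.integral_comp_smul_of_nonneg (E := E) volume
    (fun x => ⟪B (gradient u x) + F x, gradient ζ x⟫) r (hR := hr.le)
  have e2 := Measure.integral_comp_smul_of_nonneg (E := E) volume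
    (fun x => g x * ζ x) r (hR := hr.le)
  rw [e, ← e2] at e1
  have hsm : ∀ y : E, r⁻¹ • r • y = y := fun y => by
    rw [smul_smul, inv_mul_cancel₀ hr.ne', one_smul]
  simp only [hζ, gradient_comp_smul hξ, hsm, inner_smul_right] at e1
  rw [integral_const_mul] at e1
  rw [← e1, ← mul_assoc, mul_inv_cancel₀ hr.ne', one_mul]

lemma WeakEq.rescale (hF : Continuous F) (hu : ContDiff ℝ 1 u) (hg : Continuous g)
    (h : WeakEq B F g u (ball 0 1)) (a : ℝ) (q n₀ : E) {M : E →L[ℝ] E}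
    (hM : ∀ x y, ⟪M x, y⟫ = ⟪x, M y⟫) {g₀ : ℝ} (htr : opTrace ((B + D).comp M) = -g₀)
    {r : ℝ} (hr : 0 < r) (hr1 : r ≤ 1) (c : ℝ) :
    WeakEq B (fun y => (c * r) • (F (r • y) - (n₀ + D (M (r • y)))))
      (fun y => (c * r ^ 2) * (g (r • y) - g₀))
      (fun y => c * (u (r • y) - quad a q M (r • y))) (ball 0 1) := by
  intro ξ hξ hξc hξs
  have hgc := hu.continuous_gradient
  have e1 := h.comp_smul hr hr1 hξ hξs
  have e2 := integral_inner_gradient_eq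
    (X := fun y => (B q + n₀) + (r • (B + D).comp M) y) (contDiff_const.add
      (r • (B + D).comp M).contDiff) hξ (Or.inr hξc)
  have e3 : ∀ y, fderiv ℝ (fun y => (B q + n₀) + (r • (B + D).comp M) y) y
      = r • (B + D).comp M := fun y =>
    (((r • (B + D).comp M).hasFDerivAt (x := y)).const_add (B q + n₀)).fderiv
  simp only [e3, opTrace_smul, htr] at e2
  rw [integral_const_mul] at e2
  simp only [gradient_rescale hu a q hM]
  have i1 : Integrable fun y => ⟪B (gradient u (r • y)) + F (r • y), gradient ξ y⟫ :=
    integrable_inner_gradient (by fun_prop) hξ hξc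
  have i2 : Integrable fun y => ⟪(B q + n₀) + (r • (B + D).comp M) y, gradient ξ y⟫ :=
    integrable_inner_gradient (by fun_prop) hξ hξc
  have e4 : ∀ y, ⟪B ((c * r) • (gradient u (r • y) - (q + M (r • y))))
        + (c * r) • (F (r • y) - (n₀ + D (M (r • y)))), gradient ξ y⟫
      = (c * r) * (⟪B (gradient u (r • y)) + F (r • y), gradient ξ y⟫
        - ⟪(B q + n₀) + (r • (B + D).comp M) y, gradient ξ y⟫) := by
    intro y
    rw [← inner_sub_left, ← real_inner_smul_left]
    congr 1
    simp only [map_smul, map_sub, map_add, smul_apply, ContinuousLinearMap.comp_apply,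
      add_apply]
    module
  simp only [e4]
  rw [integral_const_mul, integral_sub i1 i2, e1, e2]
  have i3 : Integrable fun y => g (r • y) * ξ y :=
    integrable_mul_of_hasCompactSupport (by fun_prop) hξ.continuous hξc
  have i4 : Integrable fun y => g₀ * ξ y :=
    integrable_mul_of_hasCompactSupport (by fun_prop) hξ.continuous hξc
  have e5 : ∀ y, c * r ^ 2 * (g (r • y) - g₀) * ξ y
      = c * r ^ 2 * (g (r • y) * ξ y - g₀ * ξ y) := fun y => by ring
  simp only [e5]
  rw [integral_const_mul, integral_sub i3 i4, integral_const_mul]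
  ring

lemma setIntegral_closedBall_comp_smul (h : E → ℝ) {r : ℝ} (hr : 0 < r) (s : ℝ) :
    ∫ y in closedBall (0 : E) s, h (r • y)
      = (r ^ finrank ℝ E)⁻¹ * ∫ x in closedBall (0 : E) (r * s), h x := by
  have e := Measure.setIntegral_comp_smul_of_pos (E := E) volume h (closedBall 0 s) hr
  rw [e, smul_closedBall' hr.ne', smul_zero, Real.norm_of_nonneg hr.le, smul_eq_mul]

lemma measureReal_closedBall_zero {r : ℝ} (hr : 0 ≤ r) :
    volume.real (closedBall (0 : E) r) = r ^ finrank ℝ E * volume.real (closedBall (0 : E) 1) := by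
  rw [Measure.real, Measure.addHaar_closedBall' volume (0 : E) hr]
  simp [Measure.real, hr]

end Rescaling

/-! ### Improvement of the quadratic approximation from one scale to the next -/

section ApproximationStep

open scoped Topology ContDiff
open Module (finrank)

variable {E : Type*} [NormedAddCommGroup E] [InnerProductSpace ℝ E] [FiniteDimensional ℝ E]
  [MeasurableSpace E] [BorelSpace E]

/-- `quad a q M` approximates `u` at scale `σ ^ (2 * k)`, and solves the linearized equation. -/
structure QuadApprox (B : E →L[ℝ] E) (N' : E → E →L[ℝ] E) (u : E → ℝ) (g₀ C κ σ : ℝ) (k : ℕ)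
    (a : ℝ) (q : E) (M : E →L[ℝ] E) : Prop where
  symm : ∀ x y, ⟪M x, y⟫ = ⟪x, M y⟫
  trace : opTrace ((B + N' q).comp M) = -g₀
  norm_q : ‖q‖ ≤ C * κ * (3 - 2 * σ ^ k)
  norm_M : ‖M‖ ≤ C * κ * (3 - 2 * σ ^ k)
  l2 : ∫ x in closedBall (0 : E) (σ ^ (2 * k)), (u x - quad a q M x) ^ 2
    ≤ κ ^ 2 * (σ ^ (2 * k)) ^ (finrank ℝ E + 5)

variable {B : E →L[ℝ] E} {l : ℝ}

omit [MeasurableSpace E] [BorelSpace E] in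
lemma half_le_opTrace_add [Nontrivial E] (hl : 0 < l) (hB : ∀ v, l * ‖v‖ ^ 2 ≤ ⟪B v, v⟫)
    {D : E →L[ℝ] E} {ε : ℝ} (hε : ε ≤ l / 8) (hD : ‖D‖ ≤ ε) : l / 2 ≤ opTrace (B + D) := by
  have h1 : ∀ v, (7 / 8 * l) * ‖v‖ ^ 2 ≤ ⟪(B + D) v, v⟫ := by
    intro v
    rw [add_apply, inner_add_left]
    have h2 : |⟪D v, v⟫| ≤ l / 8 * ‖v‖ ^ 2 := by
      calc |⟪D v, v⟫| ≤ ‖D v‖ * ‖v‖ := abs_real_inner_le_norm _ _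
        _ ≤ (‖D‖ * ‖v‖) * ‖v‖ := by gcongr; exact D.le_opNorm v
        _ = ‖D‖ * ‖v‖ ^ 2 := by ring
        _ ≤ _ := by gcongr; linarith
    have := hB v
    have := neg_le_of_abs_le h2
    linarith
  have h2 := le_opTrace h1
  have h3 : (1 : ℝ) ≤ finrank ℝ E := by exact_mod_cast Module.finrank_pos
  nlinarith

omit [MeasurableSpace E] [BorelSpace E] in
lemma exists_trace_correction [Nontrivial E] (hl : 0 < l) (hB : ∀ v, l * ‖v‖ ^ 2 ≤ ⟪B v, v⟫)
    {D : E →L[ℝ] E} {ε : ℝ} (hε : ε ≤ l / 8) (hD : ‖D‖ ≤ ε) (b : ℝ) :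
    ∃ s, s * opTrace (B + D) = b ∧ |s| ≤ 2 / l * |b| := by
  have h := half_le_opTrace_add hl hB hε hD
  have h0 : 0 < opTrace (B + D) := by linarith
  refine ⟨b / opTrace (B + D), div_mul_cancel₀ _ h0.ne', ?_⟩
  rw [abs_div, abs_of_pos h0, div_le_iff₀ h0]
  calc |b| = 2 / l * |b| * (l / 2) := by field_simp
    _ ≤ _ := by gcongr

lemma sub_sq_le_two_mul_sq_add {X Y Z : ℝ} (h : (2 * Y) ^ 2 ≤ Z) : (X - Y) ^ 2 ≤ 2 * X ^ 2 + Z := by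
  nlinarith [sq_nonneg (X + Y)]

set_option maxHeartbeats 4000000 in
lemma exists_quadApprox_step [Nontrivial E] (hl : 0 < l)
    (hBs : ∀ x y, ⟪B x, y⟫ = ⟪x, B y⟫) (hB : ∀ v, l * ‖v‖ ^ 2 ≤ ⟪B v, v⟫) :
    ∃ C ε σ : ℝ, 1 ≤ C ∧ 0 < ε ∧ ε ≤ 1 ∧ ε ≤ l / 8 ∧ 0 < σ ∧ σ ≤ 1 / 2 ∧
      ∀ (N : E → E) (N' : E → E →L[ℝ] E) (K δ κ : ℝ), 0 ≤ K → 0 < κ →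
      (∀ q ∈ closedBall (0 : E) δ, HasFDerivAt N (N' q) q) →
      (∀ q ∈ closedBall (0 : E) δ, ‖N' q‖ ≤ ε) →
      (∀ q ∈ closedBall (0 : E) δ, ∀ q' ∈ closedBall (0 : E) δ, ‖N' q' - N' q‖ ≤ K * ‖q' - q‖) →
      6 * C * κ ≤ δ → 9 * K * C ^ 2 * κ ≤ ε →
      ∀ (u g : E → ℝ) (L : ℝ), ContDiff ℝ 1 u → Continuous g → (∀ x, ‖gradient u x‖ ≤ δ) →
      WeakEq B (fun x => N (gradient u x)) g u (ball 0 1) →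
      0 ≤ L → (∀ x ∈ ball (0 : E) 1, |g x - g 0| ≤ L * ‖x‖) → L ≤ ε * κ →
      ∀ (k : ℕ) (a : ℝ) (q : E) (M : E →L[ℝ] E), QuadApprox B N' u (g 0) C κ σ k a q M →
      ∃ (a' : ℝ) (q' : E) (M' : E →L[ℝ] E), QuadApprox B N' u (g 0) C κ σ (k + 1) a' q' M' ∧
        |a' - a| ≤ C * κ * (σ ^ 5) ^ k ∧ ‖q' - q‖ ≤ C * κ * (σ ^ 3) ^ k ∧
        ‖M' - M‖ ≤ C * κ * σ ^ k := by
  obtain ⟨C₀, hC₀, hstep⟩ := exists_quadratic_approx hl hBs hB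
  set d := finrank ℝ E with hd
  have hC₀' : 0 < C₀ := by linarith
  set V := volume.real (closedBall (0 : E) 1) with hV
  have hV0 : 0 ≤ V := measureReal_nonneg
  set Cs := 2 / l * (C₀ + d * C₀ + d) with hCs
  have hCs0 : 0 < Cs := by positivity
  set σ := 1 / (2 * C₀) with hσ
  have hσ0 : 0 < σ := by positivity
  have hσC : 2 * C₀ * σ = 1 := by rw [hσ]; field_simp
  have hσ2 : σ ≤ 1 / 2 := by nlinarith
  set ρ := σ ^ 2 with hρ
  have hρ0 : 0 < ρ := by positivity
  have hρ1 : ρ ≤ 1 / 2 := by nlinarith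
  have hρC : 2 * C₀ * ρ ≤ 1 / 2 := by
    calc 2 * C₀ * ρ = (2 * C₀ * σ) * σ := by rw [hρ]; ring
      _ ≤ 1 / 2 := by rw [hσC]; linarith
  set X := 2 * C₀ + Cs ^ 2 * V with hX
  have hX0 : 0 < X := by positivity
  set ε := min (min 1 (l / 8)) (min (C₀ / Cs) (ρ ^ (d + 5) / (2 * X))) with hε
  have hε0 : 0 < ε := by simp only [hε, lt_min_iff]; refine ⟨⟨?_, ?_⟩, ?_, ?_⟩ <;> positivity
  have hε1 : ε ≤ 1 := (min_le_left _ _).trans (min_le_left _ _)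
  have hεl : ε ≤ l / 8 := (min_le_left _ _).trans (min_le_right _ _)
  have hεs : Cs * ε ≤ C₀ := by
    have : ε ≤ C₀ / Cs := (min_le_right _ _).trans (min_le_left _ _)
    rwa [le_div_iff₀ hCs0, mul_comm] at this
  have hεX : 2 * X * ε ^ 2 ≤ ρ ^ (d + 5) := by
    have : ε ≤ ρ ^ (d + 5) / (2 * X) := (min_le_right _ _).trans (min_le_right _ _)
    rw [le_div_iff₀ (by positivity), mul_comm] at this
    calc 2 * X * ε ^ 2 = 2 * X * ε * ε := by ring
      _ ≤ 2 * X * ε * 1 := by gcongr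
      _ ≤ _ := by linarith
  refine ⟨2 * C₀, ε, σ, by linarith, hε0, hε1, hεl, hσ0, hσ2, ?_⟩
  intro N N' K δ κ hK hκ hN hNε hNK hδκ hKκ u g L hu hg huδ hweak hL hgL hLκ k a q M hQ
  set C := 2 * C₀ with hC
  set t := σ ^ k with ht
  have ht0 : 0 < t := by positivity
  have ht1 : t ≤ 1 := pow_le_one₀ hσ0.le (by linarith)
  have hr : σ ^ (2 * k) = t ^ 2 := by rw [ht, ← pow_mul, mul_comm]
  set r := t ^ 2 with hrdef
  have hr0 : 0 < r := by positivity
  have hr1 : r ≤ 1 := pow_le_one₀ ht0.le ht1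
  have hCκ : 0 < C * κ := by positivity
  have hCκt : 0 ≤ C * κ * t := by positivity
  have hq3 : ‖q‖ ≤ 3 * C * κ := hQ.norm_q.trans (by linarith)
  have hM3 : ‖M‖ ≤ 3 * C * κ := hQ.norm_M.trans (by linarith)
  have hgc := hu.continuous_gradient
  have hNc : Continuous fun x => N (gradient u x) := by
    have : ContinuousOn N (closedBall 0 δ) := fun q hq => (hN q hq).continuousAt.continuousWithinAt
    exact this.comp_continuous hgc fun x => mem_closedBall_zero_iff.2 (huδ x)
  set c := 1 / (κ * t ^ 5) with hc
  have hcr : c * r = 1 / (κ * t ^ 3) := by rw [hc, hrdef]; field_simp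
  have hcr2 : c * r ^ 2 = 1 / (κ * t) := by rw [hc, hrdef]; field_simp
  have hc0 : 0 < c := by positivity
  set w : E → ℝ := fun y => c * (u (r • y) - quad a q M (r • y)) with hw
  have hw1 : ContDiff ℝ 1 w := contDiff_const.mul
    ((hu.comp (contDiff_const.smul contDiff_id)).sub
      ((contDiff_quad a q M).comp (contDiff_const.smul contDiff_id)))
  have hweak' := hweak.rescale (D := N' q) hNc hu hg a q (N q) hQ.symm hQ.trace hr0 hr1 c
  have hqδ : q ∈ closedBall (0 : E) δ := mem_closedBall_zero_iff.2 (by linarith)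
  have hqM : ∀ y ∈ ball (0 : E) 1, ‖M (r • y)‖ ≤ 3 * C * κ * r := by
    intro y hy
    rw [mem_ball_zero_iff] at hy
    calc ‖M (r • y)‖ ≤ ‖M‖ * ‖r • y‖ := M.le_opNorm _
      _ = ‖M‖ * r * ‖y‖ := by rw [norm_smul, Real.norm_of_nonneg hr0.le]; ring
      _ ≤ ‖M‖ * r * 1 := by gcongr
      _ ≤ _ := by rw [mul_one]; gcongr
  have hFb : ∀ y ∈ ball (0 : E) 1,
      ‖(c * r) • (N (gradient u (r • y)) - (N q + N' q (M (r • y))))‖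
        ≤ ε * (‖gradient w y‖ + 1) := by
    intro y hy
    have hm := hqM y hy
    set m := M (r • y) with hmdef
    have hmδ : q + m ∈ closedBall (0 : E) δ := by
      rw [mem_closedBall_zero_iff]
      have : 3 * C * κ * r ≤ 3 * C * κ * 1 := by gcongr
      linarith [norm_add_le q m]
    have h1 : ‖N (gradient u (r • y)) - N (q + m)‖ ≤ ε * ‖gradient u (r • y) - (q + m)‖ :=
      (convex_closedBall (0 : E) δ).norm_image_sub_le_of_norm_hasFDerivWithin_le
        (fun x hx => (hN x hx).hasFDerivWithinAt) hNε hmδ (mem_closedBall_zero_iff.2 (huδ _))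
    have h2 : ‖N (q + m) - N q - N' q m‖ ≤ K * ‖m‖ ^ 2 := by
      have := norm_sub_sub_le_of_lipschitz_fderiv (convex_closedBall (0 : E) δ) hN hNK
        hqδ hmδ
      simpa using this
    have h3 : K * ‖m‖ ^ 2 ≤ ε * (κ * t ^ 3) := by
      calc K * ‖m‖ ^ 2 ≤ K * (3 * C * κ * r) ^ 2 := by gcongr
        _ = 9 * K * C ^ 2 * κ * (κ * t ^ 4) := by rw [hrdef]; ring
        _ ≤ ε * (κ * t ^ 3) := by
          gcongr ?_ * (κ * ?_)
          exact pow_le_pow_of_le_one ht0.le ht1 (by norm_num)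
    have h4 : ‖N (gradient u (r • y)) - (N q + N' q m)‖
        ≤ ε * ‖gradient u (r • y) - (q + m)‖ + ε * (κ * t ^ 3) := by
      have : N (gradient u (r • y)) - (N q + N' q m)
          = (N (gradient u (r • y)) - N (q + m)) + (N (q + m) - N q - N' q m) := by abel
      rw [this]
      exact (norm_add_le _ _).trans (add_le_add h1 (h2.trans h3))
    rw [hw, gradient_rescale hu a q hQ.symm, norm_smul, norm_smul, Real.norm_of_nonneg (by positivity), ← hmdef]
    calc c * r * ‖N (gradient u (r • y)) - (N q + N' q m)‖
        ≤ c * r * (ε * ‖gradient u (r • y) - (q + m)‖ + ε * (κ * t ^ 3)) := by gcongr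
      _ = ε * (c * r * ‖gradient u (r • y) - (q + m)‖ + c * r * (κ * t ^ 3)) := by ring
      _ = _ := by
        have : c * r * (κ * t ^ 3) = 1 := by rw [hcr]; field_simp
        rw [this]
  have hGb : ∀ y ∈ ball (0 : E) 1, |c * r ^ 2 * (g (r • y) - g 0)| ≤ ε := by
    intro y hy
    have hy1 : ‖y‖ < 1 := mem_ball_zero_iff.1 hy
    have hn : ‖r • y‖ ≤ r := by
      rw [norm_smul, Real.norm_of_nonneg hr0.le]
      exact mul_le_of_le_one_right hr0.le hy1.le
    have hry : r • y ∈ ball (0 : E) 1 := by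
      rw [mem_ball_zero_iff, norm_smul, Real.norm_of_nonneg hr0.le]
      exact (mul_le_of_le_one_left (norm_nonneg y) hr1).trans_lt hy1
    rw [abs_mul, abs_of_pos (by positivity)]
    calc c * r ^ 2 * |g (r • y) - g 0| ≤ c * r ^ 2 * (L * r) := by
          gcongr; exact (hgL _ hry).trans (by gcongr)
      _ = L / κ * t := by rw [hcr2, hrdef]; field_simp
      _ ≤ ε * 1 := by
        gcongr
        rwa [div_le_iff₀ hκ]
      _ = ε := mul_one _
  have hw2 : ∫ y in closedBall (0 : E) 1, w y ^ 2 ≤ 1 := by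
    have e := setIntegral_closedBall_comp_smul (E := E)
      (fun x => (c * (u x - quad a q M x)) ^ 2) hr0 1
    simp only [hw]
    rw [e, mul_one]
    simp only [mul_pow]
    rw [integral_const_mul]
    have h := hQ.l2
    rw [hr] at h
    calc (r ^ finrank ℝ E)⁻¹ * (c ^ 2 * ∫ x in closedBall (0 : E) r, (u x - quad a q M x) ^ 2)
        ≤ (r ^ finrank ℝ E)⁻¹ * (c ^ 2 * (κ ^ 2 * r ^ (finrank ℝ E + 5))) := by gcongr
      _ = 1 := by rw [hc, pow_add, hrdef]; field_simp
  have hFc : Continuous fun y => (c * r) • (N (gradient u (r • y)) - (N q + N' q (M (r • y)))) := by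
    have := hNc.comp (continuous_const_smul r)
    exact (this.sub (by fun_prop)).const_smul (c * r)
  obtain ⟨a', q', H, ha', hq', hH, hHs, hHt, hint⟩ := hstep w _ _ ε hw1
    hFc (by fun_prop) hε0.le hε1 hεl hFb hGb hweak' hw2
  have hκt : 0 < κ * t := by positivity
  set q₁ := q + (κ * t ^ 3) • q' with hq₁
  have hσ3 : (σ ^ 3) ^ k = t ^ 3 := by rw [ht, ← pow_mul, ← pow_mul, mul_comm]
  have hσ5 : (σ ^ 5) ^ k = t ^ 5 := by rw [ht, ← pow_mul, ← pow_mul, mul_comm]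
  have dq : ‖q₁ - q‖ ≤ C₀ * κ * t ^ 3 := by
    rw [hq₁, add_sub_cancel_left, norm_smul, Real.norm_of_nonneg (by positivity)]
    calc κ * t ^ 3 * ‖q'‖ ≤ κ * t ^ 3 * C₀ := by gcongr
      _ = _ := by ring
  have ht3 : t ^ 3 ≤ t := by
    calc t ^ 3 ≤ t ^ 1 := pow_le_pow_of_le_one ht0.le ht1 (by norm_num)
      _ = t := pow_one t
  have hσt : σ ^ (k + 1) ≤ t / 2 := by
    rw [pow_succ, ← ht]
    have := mul_le_mul_of_nonneg_left hσ2 ht0.le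
    linarith
  have hq₁n : ‖q₁‖ ≤ C * κ * (3 - 2 * σ ^ (k + 1)) := by
    have h1 := norm_add_le q (q₁ - q)
    rw [add_sub_cancel] at h1
    have h2 : C₀ * κ * t ^ 3 ≤ C * κ * t := by
      rw [hC]; gcongr; linarith
    have h3 := hQ.norm_q
    rw [← ht] at h3
    have h4 := mul_nonneg hCκ.le (by linarith : 0 ≤ t - 2 * σ ^ (k + 1))
    linarith
  have hq₁3 : ‖q₁‖ ≤ 3 * C * κ := by
    have h4 : 0 ≤ C * κ * σ ^ (k + 1) := by positivity
    linarith
  have hq₁δ : q₁ ∈ closedBall (0 : E) δ := mem_closedBall_zero_iff.2 (by linarith)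
  have tr1 : |opTrace ((N' q₁).comp H)| ≤ d * C₀ * ε := by
    refine (abs_opTrace_le _).trans ?_
    calc (d : ℝ) * ‖(N' q₁).comp H‖ ≤ d * (ε * C₀) := by
          gcongr
          exact (ContinuousLinearMap.opNorm_comp_le _ _).trans
            (mul_le_mul (hNε _ hq₁δ) hH (norm_nonneg _) hε0.le)
      _ = _ := by ring
  have tr2 : |opTrace ((N' q₁ - N' q).comp M)| ≤ κ * t * (d * ε) := by
    refine (abs_opTrace_le _).trans ?_
    have h1 : ‖(N' q₁ - N' q).comp M‖ ≤ K * (C₀ * κ * t ^ 3) * (3 * C * κ) :=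
      (ContinuousLinearMap.opNorm_comp_le _ _).trans
        (mul_le_mul ((hNK q hqδ q₁ hq₁δ).trans (by gcongr)) hM3 (norm_nonneg _) (by positivity))
    have h2 : K * (C₀ * κ * t ^ 3) * (3 * C * κ) ≤ κ * t * ε := by
      have : 3 * K * C₀ * C * κ ≤ 9 * K * C ^ 2 * κ := by
        calc 3 * K * C₀ * C * κ ≤ 3 * K * (3 * C) * C * κ := by gcongr; linarith
          _ = _ := by ring
      calc K * (C₀ * κ * t ^ 3) * (3 * C * κ) = κ * t ^ 3 * (3 * K * C₀ * C * κ) := by ring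
        _ ≤ κ * t * ε := by gcongr; linarith
    calc (d : ℝ) * ‖(N' q₁ - N' q).comp M‖ ≤ d * (κ * t * ε) := by gcongr; linarith
      _ = _ := by ring
  obtain ⟨s, hs, hsb⟩ := exists_trace_correction hl hB hεl (hNε q₁ hq₁δ)
    (-(opTrace (B.comp H) + opTrace ((N' q₁).comp H)
      + (κ * t)⁻¹ * opTrace ((N' q₁ - N' q).comp M)))
  have hsε : |s| ≤ Cs * ε := by
    have h1 : |(κ * t)⁻¹ * opTrace ((N' q₁ - N' q).comp M)| ≤ d * ε := by
      rw [abs_mul, abs_inv, abs_of_pos hκt, inv_mul_le_iff₀ hκt]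
      exact tr2
    have h2 : |(-(opTrace (B.comp H) + opTrace ((N' q₁).comp H)
        + (κ * t)⁻¹ * opTrace ((N' q₁ - N' q).comp M)))| ≤ C₀ * ε + d * C₀ * ε + d * ε := by
      rw [abs_neg]
      exact (abs_add_le _ _).trans (add_le_add ((abs_add_le _ _).trans (add_le_add hHt tr1)) h1)
    refine hsb.trans ?_
    calc 2 / l * _ ≤ 2 / l * (C₀ * ε + d * C₀ * ε + d * ε) := by gcongr
      _ = _ := by rw [hCs]; ring
  set H₁ := H + s • ContinuousLinearMap.id ℝ E with hH₁
  have hH₁n : ‖H₁‖ ≤ C := by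
    calc ‖H₁‖ ≤ ‖H‖ + |s| * ‖ContinuousLinearMap.id ℝ E‖ := by
          refine (norm_add_le _ _).trans ?_
          rw [norm_smul, Real.norm_eq_abs]
      _ ≤ C₀ + (Cs * ε) * 1 := by gcongr; exact ContinuousLinearMap.norm_id_le
      _ ≤ C := by linarith
  have hH₁s : ∀ x y, ⟪H₁ x, y⟫ = ⟪x, H₁ y⟫ := by
    intro x y
    simp [hH₁, inner_add_left, inner_add_right, real_inner_smul_left, real_inner_smul_right, hHs]
  have dM : ‖(M + (κ * t) • H₁) - M‖ ≤ C * κ * t := by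
    rw [add_sub_cancel_left, norm_smul, Real.norm_of_nonneg hκt.le]
    calc κ * t * ‖H₁‖ ≤ κ * t * C := by gcongr
      _ = _ := by ring
  refine ⟨a + κ * t ^ 5 * a', q₁, M + (κ * t) • H₁, ⟨?_, ?_, hq₁n, ?_, ?_⟩, ?_, ?_, dM⟩
  · intro x y
    simp [inner_add_left, inner_add_right, real_inner_smul_left, real_inner_smul_right, hH₁s,
      hQ.symm]
  · have e : (B + N' q₁).comp (M + (κ * t) • H₁)
        = (B + N' q).comp M + (N' q₁ - N' q).comp M
          + (κ * t) • (B.comp H + (N' q₁).comp H + s • (B + N' q₁)) := by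
      ext x
      simp [hH₁]
    rw [e, opTrace_add, opTrace_add, opTrace_smul, opTrace_add, opTrace_add, opTrace_smul,
      hQ.trace, hs]
    field_simp
    ring
  · have h1 := norm_add_le M ((M + (κ * t) • H₁) - M)
    rw [add_sub_cancel] at h1
    have h3 := hQ.norm_M
    rw [← ht] at h3
    have h4 := mul_nonneg hCκ.le (by linarith : 0 ≤ t - 2 * σ ^ (k + 1))
    linarith
  · have hrρ : σ ^ (2 * (k + 1)) = r * ρ := by rw [hrdef, hρ, ht]; ring
    rw [hrρ]
    set P := quad (a + κ * t ^ 5 * a') q₁ (M + (κ * t) • H₁) with hP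
    have hPc : Continuous P := (contDiff_quad _ _ _).continuous
    have huc := hu.continuous
    have hwc := hw1.continuous
    have hQ'c : Continuous (quad a' q' H₁) := (contDiff_quad _ _ _).continuous
    have hpt : ∀ y, (u (r • y) - P (r • y)) ^ 2
        = (κ * t ^ 5) ^ 2 * (w y - quad a' q' H₁ y) ^ 2 := by
      intro y
      rw [← mul_pow]
      congr 1
      have hc1 : κ * t ^ 5 * c = 1 := by rw [hc]; field_simp
      have e1 : P (r • y) = quad a q M (r • y) + κ * t ^ 5 * quad a' q' H₁ y := by
        simp only [hP, quad, hq₁, map_smul, real_inner_smul_left, real_inner_smul_right,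
          add_apply, smul_apply, inner_add_left, hrdef]
        ring
      rw [e1, mul_sub, hw]
      linear_combination (-(u (r • y) - quad a q M (r • y))) * hc1
    have e := setIntegral_closedBall_comp_smul (E := E) (fun x => (u x - P x) ^ 2) hr0 ρ
    rw [inv_mul_eq_div, eq_div_iff (by positivity)] at e
    rw [← e]
    simp only [hpt]
    rw [integral_const_mul]
    have hfin : ∫ y in closedBall (0 : E) ρ, (w y - quad a' q' H₁ y) ^ 2 ≤ ρ ^ (d + 5) := by
      have hHc : Continuous (quad a' q' H) := (contDiff_quad _ _ _).continuous
      calc ∫ y in closedBall (0 : E) ρ, (w y - quad a' q' H₁ y) ^ 2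
          ≤ ∫ y in closedBall (0 : E) ρ, (2 * (w y - quad a' q' H y) ^ 2 + (Cs * ε) ^ 2) := by
            refine setIntegral_mono_on (Continuous.integrableOn_closedBall (by fun_prop) _ _)
              (Continuous.integrableOn_closedBall (by fun_prop) _ _) measurableSet_closedBall
              fun y hy => ?_
            have hy1 : ‖y‖ ≤ 1 := (mem_closedBall_zero_iff.1 hy).trans (by linarith)
            have e2 : quad a' q' H₁ y = quad a' q' H y + s * ‖y‖ ^ 2 / 2 := by
              simp only [quad, hH₁, add_apply, smul_apply, inner_add_left, real_inner_smul_left,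
                ContinuousLinearMap.id_apply, real_inner_self_eq_norm_sq]
              ring
            have e3 : (s * ‖y‖ ^ 2) ^ 2 ≤ (Cs * ε) ^ 2 := by
              refine sq_le_sq.2 ?_
              rw [abs_mul, abs_of_nonneg (by positivity : 0 ≤ ‖y‖ ^ 2)]
              calc |s| * ‖y‖ ^ 2 ≤ (Cs * ε) * 1 := by
                    gcongr
                    exact pow_le_one₀ (norm_nonneg _) hy1
                _ ≤ |Cs * ε| := by rw [mul_one]; exact le_abs_self _
            rw [e2, ← sub_sub]
            refine sub_sq_le_two_mul_sq_add (le_trans (le_of_eq ?_) e3)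
            ring
        _ = 2 * (∫ y in closedBall (0 : E) ρ, (w y - quad a' q' H y) ^ 2)
            + (Cs * ε) ^ 2 * (ρ ^ d * V) := by
            rw [integral_add (Continuous.integrableOn_closedBall (by fun_prop) _ _)
              (Continuous.integrableOn_closedBall (by fun_prop) _ _), integral_const_mul,
              integral_const, smul_eq_mul, measureReal_restrict_apply_univ,
              measureReal_closedBall_zero hρ0.le]
            ring
        _ ≤ 2 * (C₀ * (ρ ^ (d + 6) + ε ^ 2)) + (Cs * ε) ^ 2 * (1 * V) := by
            gcongr
            · exact hint ρ hρ0.le hρ1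
            · exact pow_le_one₀ hρ0.le (by linarith)
        _ = 2 * C₀ * ρ * ρ ^ (d + 5) + X * ε ^ 2 := by rw [hX]; ring
        _ ≤ 1 / 2 * ρ ^ (d + 5) + ρ ^ (d + 5) / 2 := by gcongr; linarith
        _ = _ := by ring
    calc (κ * t ^ 5) ^ 2 * (∫ y in closedBall (0 : E) ρ, (w y - quad a' q' H₁ y) ^ 2)
          * r ^ finrank ℝ E
        ≤ (κ * t ^ 5) ^ 2 * ρ ^ (d + 5) * r ^ finrank ℝ E := by gcongr
      _ = κ ^ 2 * (r * ρ) ^ (finrank ℝ E + 5) := by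
        rw [hrdef, ← hd]; ring
  · rw [add_sub_cancel_left, hσ5, abs_mul, abs_of_pos (by positivity)]
    calc κ * t ^ 5 * |a'| ≤ κ * t ^ 5 * C := by gcongr; linarith
      _ = _ := by ring
  · rw [hσ3]
    refine dq.trans ?_
    gcongr
    linarith

end ApproximationStep

/-! ### Quadratic expansion of a weak solution at a point -/

section Expansion

open scoped Topology ContDiff
open Module (finrank)

variable {E : Type*} [NormedAddCommGroup E] [InnerProductSpace ℝ E] [FiniteDimensional ℝ E]
  [MeasurableSpace E] [BorelSpace E]

lemma exists_geometric_limit {V : Type*} [NormedAddCommGroup V] [CompleteSpace V] {f : ℕ → V}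
    {C r : ℝ} (hr0 : 0 ≤ r) (hr : r ≤ 1 / 2) (hC : 0 ≤ C)
    (h : ∀ n, ‖f (n + 1) - f n‖ ≤ C * r ^ n) : ∃ b, ∀ n, ‖f n - b‖ ≤ 2 * C * r ^ n := by
  have h' : ∀ n, dist (f n) (f (n + 1)) ≤ C * r ^ n := fun n => by
    rw [dist_comm, dist_eq_norm]; exact h n
  obtain ⟨b, hb⟩ := cauchySeq_tendsto_of_complete (cauchySeq_of_le_geometric r C (by linarith) h')
  refine ⟨b, fun n => ?_⟩
  rw [← dist_eq_norm]
  refine (dist_le_of_le_geometric_of_tendsto r C (by linarith) h' hb n).trans ?_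
  rw [div_le_iff₀ (by linarith)]
  have : 0 ≤ C * r ^ n := by positivity
  nlinarith

variable {B : E →L[ℝ] E} {l : ℝ}

set_option maxHeartbeats 1000000 in
lemma exists_quadratic_expansion [Nontrivial E] (hl : 0 < l)
    (hBs : ∀ x y, ⟪B x, y⟫ = ⟪x, B y⟫) (hB : ∀ v, l * ‖v‖ ^ 2 ≤ ⟪B v, v⟫) :
    ∃ η : ℝ, 0 < η ∧ ∀ (N : E → E) (N' : E → E →L[ℝ] E) (K δ₁ : ℝ), 0 ≤ K → 0 < δ₁ →
      (∀ q ∈ closedBall (0 : E) δ₁, HasFDerivAt N (N' q) q) →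
      (∀ q ∈ closedBall (0 : E) δ₁, ‖N' q‖ ≤ η) →
      (∀ q ∈ closedBall (0 : E) δ₁, ∀ q' ∈ closedBall (0 : E) δ₁,
        ‖N' q' - N' q‖ ≤ K * ‖q' - q‖) →
      ∃ δ Λ : ℝ, 0 < δ ∧ 0 ≤ Λ ∧ ∀ u g : E → ℝ, ContDiff ℝ 1 u → Continuous g → u 0 = 0 →
        (∀ x, ‖gradient u x‖ ≤ δ) → WeakEq B (fun x => N (gradient u x)) g u (ball 0 1) →
        |g 0| ≤ δ → (∀ x ∈ ball (0 : E) 1, |g x - g 0| ≤ δ * ‖x‖) →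
        ∃ (a : ℝ) (q : E) (M : E →L[ℝ] E), (∀ x y, ⟪M x, y⟫ = ⟪x, M y⟫) ∧ ‖M‖ ≤ Λ ∧
          ∀ r, 0 < r → r ≤ 1 →
            ∫ x in closedBall (0 : E) r, (u x - quad a q M x) ^ 2
              ≤ Λ * r ^ (finrank ℝ E + 5) := by
  obtain ⟨C, ε, σ, hC, hε, hε1, hεl, hσ, hσ2, hstep⟩ := exists_quadApprox_step hl hBs hB
  have hC0 : 0 < C := by linarith
  set d := finrank ℝ E with hd
  set V := volume.real (closedBall (0 : E) 1) with hV
  have hV0 : 0 ≤ V := measureReal_nonneg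
  refine ⟨ε, hε, fun N N' K δ₁ hK hδ₁ hN hNε hNK => ?_⟩
  set κ := min (δ₁ / (6 * C)) (ε / (9 * K * C ^ 2 + 1)) with hκdef
  have hκ : 0 < κ := lt_min (by positivity) (by positivity)
  have hκ1 : 6 * C * κ ≤ δ₁ := by
    have : κ ≤ δ₁ / (6 * C) := min_le_left _ _
    rwa [le_div_iff₀ (by positivity), mul_comm] at this
  have hκ2 : 9 * K * C ^ 2 * κ ≤ ε := by
    have : κ ≤ ε / (9 * K * C ^ 2 + 1) := min_le_right _ _
    rw [le_div_iff₀ (by positivity)] at this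
    linarith
  set δ := min (min δ₁ (ε * κ)) (min (l / 2 * κ) (κ / ((1 + 1 / l) * (V + 1)))) with hδdef
  have hδ : 0 < δ := lt_min (lt_min hδ₁ (by positivity)) (lt_min (by positivity) (by positivity))
  have hδδ₁ : δ ≤ δ₁ := (min_le_left _ _).trans (min_le_left _ _)
  have hδε : δ ≤ ε * κ := (min_le_left _ _).trans (min_le_right _ _)
  have hδl : δ ≤ l / 2 * κ := (min_le_right _ _).trans (min_le_left _ _)
  have hδV : δ * ((1 + 1 / l) * (V + 1)) ≤ κ := by
    have : δ ≤ κ / ((1 + 1 / l) * (V + 1)) := (min_le_right _ _).trans (min_le_right _ _)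
    rwa [le_div_iff₀ (by positivity)] at this
  set Λ₁ := (2 * κ ^ 2 + 72 * C ^ 2 * κ ^ 2 * V) with hΛ₁
  have hΛ₁0 : 0 ≤ Λ₁ := by positivity
  set Λ₂ := Λ₁ / (σ ^ 2) ^ (d + 5) with hΛ₂
  have hΛ₂0 : 0 ≤ Λ₂ := by positivity
  refine ⟨δ, 5 * C * κ + Λ₂, hδ, by positivity, fun u g hu hg hu0 huδ hweak hg0 hgL => ?_⟩
  have huc := hu.continuous
  have step := hstep N N' K δ₁ κ hK hκ hN hNε hNK hκ1 hκ2 u g δ hu hg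
    (fun x => (huδ x).trans hδδ₁) hweak hδ.le hgL hδε
  have h0mem : (0 : E) ∈ closedBall (0 : E) δ₁ := mem_closedBall_self hδ₁.le
  obtain ⟨s, hs, hsb⟩ := exists_trace_correction hl hB hεl (hNε 0 h0mem) (-g 0)
  rw [abs_neg] at hsb
  have hsδ : |s| ≤ 2 / l * δ := hsb.trans (by gcongr)
  have init : QuadApprox B N' u (g 0) C κ σ 0 0 0 (s • ContinuousLinearMap.id ℝ E) := by
    refine ⟨?_, ?_, ?_, ?_, ?_⟩
    · intro x y
      simp [real_inner_smul_left, real_inner_smul_right]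
    · rw [ContinuousLinearMap.comp_smul, ContinuousLinearMap.comp_id, opTrace_smul, hs]
    · rw [norm_zero, pow_zero]
      have : 0 < C * κ := by positivity
      linarith
    · rw [norm_smul, Real.norm_eq_abs, pow_zero]
      have h1 : |s| ≤ κ := hsδ.trans (by
        calc 2 / l * δ ≤ 2 / l * (l / 2 * κ) := by gcongr
          _ = κ := by field_simp)
      calc |s| * ‖ContinuousLinearMap.id ℝ E‖ ≤ κ * 1 := by
            gcongr; exact ContinuousLinearMap.norm_id_le
        _ ≤ C * κ * (3 - 2 * 1) := by nlinarith
    · rw [mul_zero, pow_zero, one_pow, mul_one]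
      have hb : ∀ x ∈ closedBall (0 : E) 1,
          ‖(u x - quad 0 0 (s • ContinuousLinearMap.id ℝ E) x) ^ 2‖ ≤ (δ * (1 + 1 / l)) ^ 2 := by
        intro x hx
        have hx1 : ‖x‖ ≤ 1 := mem_closedBall_zero_iff.1 hx
        have h1 : |u x| ≤ δ := by
          have := convex_univ.norm_image_sub_le_of_norm_hasFDerivWithin_le (f := u) (C := δ)
            (fun y _ => (hasGradientAt_iff_hasFDerivAt.1 (hu.hasGradientAt y)).hasFDerivWithinAt)
            (fun y _ => by rw [LinearIsometryEquiv.norm_map]; exact huδ y)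
            (mem_univ 0) (mem_univ x)
          rw [hu0, sub_zero, sub_zero, Real.norm_eq_abs] at this
          nlinarith
        have h2 : |s * ‖x‖ ^ 2 / 2| ≤ δ / l := by
          rw [abs_div, abs_mul, abs_of_nonneg (by positivity : 0 ≤ ‖x‖ ^ 2), abs_two]
          calc |s| * ‖x‖ ^ 2 / 2 ≤ 2 / l * δ * 1 / 2 := by
                gcongr; exact pow_le_one₀ (norm_nonneg _) hx1
            _ = _ := by ring
        have h3 : quad 0 0 (s • ContinuousLinearMap.id ℝ E) x = s * ‖x‖ ^ 2 / 2 := by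
          simp [quad, real_inner_smul_left]
        rw [h3, Real.norm_eq_abs, abs_pow]
        gcongr
        refine (abs_sub _ _).trans ?_
        calc _ ≤ δ + δ / l := add_le_add h1 h2
          _ = _ := by ring
      have hle := norm_setIntegral_le_of_norm_le_const (μ := volume)
        (isCompact_closedBall (0 : E) 1).measure_lt_top hb
      refine (le_abs_self _).trans (hle.trans ?_)
      rw [← hV]
      have e1 : δ * (1 + 1 / l) * (V + 1) ≤ κ := by rw [mul_assoc]; exact hδV
      have e2 : 0 ≤ δ * (1 + 1 / l) := by positivity
      calc (δ * (1 + 1 / l)) ^ 2 * V ≤ (δ * (1 + 1 / l)) ^ 2 * (V + 1) ^ 2 := by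
            gcongr; nlinarith
        _ = (δ * (1 + 1 / l) * (V + 1)) ^ 2 := by ring
        _ ≤ κ ^ 2 := by gcongr
  choose! A Q T hA using step
  let S : ℕ → ℝ × E × (E →L[ℝ] E) := fun n => Nat.rec (0, 0, s • ContinuousLinearMap.id ℝ E)
    (fun k p => (A k p.1 p.2.1 p.2.2, Q k p.1 p.2.1 p.2.2, T k p.1 p.2.1 p.2.2)) n
  have hS : ∀ k, QuadApprox B N' u (g 0) C κ σ k (S k).1 (S k).2.1 (S k).2.2 := by
    intro k
    induction k with
    | zero => exact init
    | succ k ih => exact (hA k _ _ _ ih).1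
  have hCκ : 0 ≤ C * κ := by positivity
  have hσ5 : σ ^ 5 ≤ 1 / 2 := (pow_le_of_le_one hσ.le (by linarith) (by norm_num)).trans hσ2
  have hσ3 : σ ^ 3 ≤ 1 / 2 := (pow_le_of_le_one hσ.le (by linarith) (by norm_num)).trans hσ2
  obtain ⟨a, ha⟩ := exists_geometric_limit (f := fun k => (S k).1) (by positivity) hσ5 hCκ
    fun k => (hA k _ _ _ (hS k)).2.1
  obtain ⟨q, hq⟩ := exists_geometric_limit (f := fun k => (S k).2.1) (by positivity) hσ3 hCκ
    fun k => (hA k _ _ _ (hS k)).2.2.1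
  obtain ⟨M, hM⟩ := exists_geometric_limit (f := fun k => (S k).2.2) hσ.le hσ2 hCκ
    fun k => (hA k _ _ _ (hS k)).2.2.2
  refine ⟨a, q, M, ?_, ?_, fun r hr hr1 => ?_⟩
  · have hlim : Tendsto (fun k => (S k).2.2) atTop (𝓝 M) := by
      rw [tendsto_iff_norm_sub_tendsto_zero]
      refine squeeze_zero (fun _ => norm_nonneg _) hM ?_
      simpa using (tendsto_pow_atTop_nhds_zero_of_lt_one hσ.le
        (by linarith)).const_mul (2 * (C * κ))
    intro x y
    have l1 : Tendsto (fun k => ⟪(S k).2.2 x, y⟫) atTop (𝓝 ⟪M x, y⟫) :=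
      ((ContinuousLinearMap.apply ℝ E x).continuous.tendsto M |>.comp hlim).inner tendsto_const_nhds
    have l2 : Tendsto (fun k => ⟪x, (S k).2.2 y⟫) atTop (𝓝 ⟪x, M y⟫) :=
      tendsto_const_nhds.inner ((ContinuousLinearMap.apply ℝ E y).continuous.tendsto M |>.comp hlim)
    refine tendsto_nhds_unique l1 (l2.congr fun k => ?_)
    rw [(hS k).symm]
  · have h1 := hM 0
    have h2 := (hS 0).norm_M
    have h3 : ‖M‖ ≤ ‖(S 0).2.2‖ + ‖(S 0).2.2 - M‖ := by
      have := norm_sub_le (S 0).2.2 ((S 0).2.2 - M)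
      rwa [sub_sub_cancel] at this
    rw [pow_zero] at h1 h2
    linarith
  · obtain ⟨k, hk1, hk2⟩ := exists_nat_pow_near_of_lt_one hr hr1 (by positivity : 0 < σ ^ 2)
      (by nlinarith : σ ^ 2 < 1)
    set t := σ ^ k with ht
    have ht0 : 0 < t := by positivity
    have e2 : (σ ^ 2) ^ k = t ^ 2 := by rw [ht, ← pow_mul, ← pow_mul, mul_comm]
    have e2' : σ ^ (2 * k) = t ^ 2 := by rw [ht, ← pow_mul, mul_comm]
    have e3 : (σ ^ 3) ^ k = t ^ 3 := by rw [ht, ← pow_mul, ← pow_mul, mul_comm]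
    have e5 : (σ ^ 5) ^ k = t ^ 5 := by rw [ht, ← pow_mul, ← pow_mul, mul_comm]
    have ha := ha k
    have hq := hq k
    have hM := hM k
    have hl2 := (hS k).l2
    rw [e5] at ha
    rw [e3] at hq
    rw [e2'] at hl2
    rw [pow_succ, e2] at hk1
    rw [e2] at hk2
    set R := t ^ 2 with hR
    have hR0 : 0 < R := by positivity
    set P := quad (S k).1 (S k).2.1 (S k).2.2 with hP
    set P' := quad a q M with hP'
    have hPc : Continuous P := (contDiff_quad _ _ _).continuous
    have hPc' : Continuous P' := (contDiff_quad _ _ _).continuous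
    have hdiff : ∀ x ∈ closedBall (0 : E) R, |P x - P' x| ≤ 6 * C * κ * t ^ 5 := by
      intro x hx
      have hx : ‖x‖ ≤ R := mem_closedBall_zero_iff.1 hx
      have e : P x - P' x = ((S k).1 - a) + ⟪(S k).2.1 - q, x⟫ + ⟪((S k).2.2 - M) x, x⟫ / 2 := by
        simp only [hP, hP', quad, inner_sub_left, sub_apply]
        ring
      rw [e]
      have b2 : |⟪(S k).2.1 - q, x⟫| ≤ 2 * (C * κ) * t ^ 3 * R :=
        (abs_real_inner_le_norm _ _).trans (by gcongr)
      have b3 : |⟪((S k).2.2 - M) x, x⟫ / 2| ≤ 2 * (C * κ) * t * R * R := by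
        rw [abs_div, abs_two]
        have : |⟪((S k).2.2 - M) x, x⟫| ≤ 2 * (C * κ) * t * R * R :=
          (abs_real_inner_le_norm _ _).trans (mul_le_mul
            ((ContinuousLinearMap.le_opNorm _ _).trans (by gcongr)) hx (norm_nonneg _)
            (by positivity))
        have h0 : 0 ≤ 2 * (C * κ) * t * R * R := by positivity
        linarith
      refine (abs_add_le _ _).trans ((add_le_add ((abs_add_le _ _).trans
        (add_le_add ha b2)) b3).trans (le_of_eq ?_))
      rw [hR]; ring
    have hsub : closedBall (0 : E) r ⊆ closedBall 0 R := closedBall_subset_closedBall hk2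
    calc ∫ x in closedBall (0 : E) r, (u x - P' x) ^ 2
        ≤ ∫ x in closedBall (0 : E) R, (u x - P' x) ^ 2 :=
          setIntegral_mono_set (Continuous.integrableOn_closedBall (by fun_prop) _ _)
            (ae_of_all _ fun x => sq_nonneg _) (ae_of_all _ hsub)
      _ ≤ ∫ x in closedBall (0 : E) R, (2 * (u x - P x) ^ 2 + 2 * (6 * C * κ * t ^ 5) ^ 2) := by
          refine setIntegral_mono_on (Continuous.integrableOn_closedBall (by fun_prop) _ _)
            (Continuous.integrableOn_closedBall (by fun_prop) _ _) measurableSet_closedBall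
            fun x hx => ?_
          have h1 : (P x - P' x) ^ 2 ≤ (6 * C * κ * t ^ 5) ^ 2 :=
            sq_le_sq.2 ((hdiff x hx).trans (le_abs_self _))
          have h2 := sq_nonneg ((u x - P x) - (P x - P' x))
          linarith [h1, h2]
      _ = 2 * (∫ x in closedBall (0 : E) R, (u x - P x) ^ 2)
            + 2 * (6 * C * κ * t ^ 5) ^ 2 * (R ^ d * V) := by
          rw [integral_add (Continuous.integrableOn_closedBall (by fun_prop) _ _)
            (Continuous.integrableOn_closedBall (by fun_prop) _ _), integral_const_mul,
            integral_const, smul_eq_mul, measureReal_restrict_apply_univ,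
            measureReal_closedBall_zero hR0.le]
          ring
      _ ≤ 2 * (κ ^ 2 * R ^ (d + 5)) + 2 * (6 * C * κ * t ^ 5) ^ 2 * (R ^ d * V) := by gcongr
      _ = Λ₁ * R ^ (d + 5) := by rw [hΛ₁, hR]; ring
      _ ≤ Λ₁ * (r / σ ^ 2) ^ (d + 5) := by
          gcongr
          rw [le_div_iff₀ (by positivity)]
          exact hk1.le
      _ = Λ₂ * r ^ (d + 5) := by rw [hΛ₂, div_pow]; ring
      _ ≤ (5 * C * κ + Λ₂) * r ^ (d + 5) := by
          gcongr
          linarith [mul_nonneg (by norm_num : (0 : ℝ) ≤ 5) hCκ]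

end Expansion

/-! ### Affine changes of variables and odd parts -/

section AffineChange

open scoped Topology ContDiff
open Module (finrank)

variable {E : Type*} [NormedAddCommGroup E] [InnerProductSpace ℝ E] [FiniteDimensional ℝ E]
  [MeasurableSpace E] [BorelSpace E]

omit [MeasurableSpace E] [BorelSpace E] in
lemma gradient_comp_affine {θ : E → ℝ} {z : E} {r : ℝ} {y : E}
    (hθ : DifferentiableAt ℝ θ (z + r • y)) :
    gradient (fun y => θ (z + r • y)) y = r • gradient θ (z + r • y) := by
  have h1 : HasFDerivAt (fun y : E => z + r • y) (r • ContinuousLinearMap.id ℝ E) y :=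
    ((hasFDerivAt_id y).const_smul r).const_add z
  refine ext_inner_right ℝ fun v => ?_
  have h2 : HasFDerivAt (fun y => θ (z + r • y)) _ y :=
    HasFDerivAt.comp (g := θ) y hθ.hasFDerivAt h1
  rw [inner_gradient_eq_fderiv, h2.fderiv, real_inner_smul_left, inner_gradient_eq_fderiv]
  simp

lemma integral_comp_affine {F : Type*} [NormedAddCommGroup F] [NormedSpace ℝ F] (h : E → F) (z : E)
    {r : ℝ} (hr : 0 < r) : ∫ y, h (z + r • y) = (r ^ finrank ℝ E)⁻¹ • ∫ x, h x := by
  have e1 := Measure.integral_comp_smul_of_nonneg (E := E) volume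
    (fun x => h (z + x)) r (hR := hr.le)
  rw [e1, integral_add_left_eq_self]

lemma weak_identity_comp_affine {X : E → E} {G : E → ℝ} {s : Set E}
    (h : ∀ ξ : E → ℝ, ContDiff ℝ 1 ξ → HasCompactSupport ξ → tsupport ξ ⊆ s →
      ∫ x, ⟪X x, gradient ξ x⟫ = ∫ x, G x * ξ x)
    (z : E) {r : ℝ} (hr : 0 < r) {ξ : E → ℝ} (hξ : ContDiff ℝ 1 ξ) (hξc : HasCompactSupport ξ)
    (hξs : ∀ y ∈ tsupport ξ, z + r • y ∈ s) :
    ∫ y, ⟪X (z + r • y), gradient ξ y⟫ = r * ∫ y, G (z + r • y) * ξ y := by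
  set ζ : E → ℝ := fun x => ξ (-(r⁻¹ • z) + r⁻¹ • x) with hζ
  have hζ1 : ContDiff ℝ 1 ζ := hξ.comp (contDiff_const.add (contDiff_const.smul contDiff_id))
  have hsm : ∀ y : E, -(r⁻¹ • z) + r⁻¹ • (z + r • y) = y := fun y => by
    rw [smul_add, smul_smul, inv_mul_cancel₀ hr.ne', one_smul]; abel
  have hsm' : ∀ x : E, z + r • (-(r⁻¹ • z) + r⁻¹ • x) = x := fun y => by
    rw [smul_add, smul_smul, mul_inv_cancel₀ hr.ne', one_smul, smul_neg, smul_smul,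
      mul_inv_cancel₀ hr.ne', one_smul]; abel
  have hζs : tsupport ζ ⊆ (fun y => z + r • y) '' tsupport ξ := by
    refine closure_minimal (fun x hx => ⟨_, subset_tsupport ξ hx, hsm' x⟩) ?_
    exact (hξc.isCompact.image (by fun_prop)).isClosed
  have hζc : HasCompactSupport ζ :=
    (hξc.isCompact.image (f := fun y => z + r • y) (by fun_prop)).of_isClosed_subset
      (isClosed_tsupport ζ) hζs
  have e := h ζ hζ1 hζc fun x hx => by
    obtain ⟨y, hy, rfl⟩ := hζs hx
    exact hξs y hy
  have e1 := integral_comp_affine (fun x => ⟪X x, gradient ζ x⟫) z hr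
  have e2 := integral_comp_affine (fun x => G x * ζ x) z hr
  rw [e, ← e2] at e1
  have hg : ∀ x, gradient ζ x = r⁻¹ • gradient ξ (-(r⁻¹ • z) + r⁻¹ • x) := fun x =>
    gradient_comp_affine (hξ.differentiable one_ne_zero _)
  simp only [hg] at e1
  simp only [hζ, hsm, inner_smul_right] at e1
  rw [integral_const_mul] at e1
  rw [← e1, ← mul_assoc, mul_inv_cancel₀ hr.ne', one_mul]

lemma le_setIntegral_inner_sq (v : E) {r : ℝ} (hr : 0 < r) :
    volume.real (closedBall (0 : E) 1) / 4 ^ (finrank ℝ E + 1) * ‖v‖ ^ 2 * r ^ (finrank ℝ E + 2)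
      ≤ ∫ y in closedBall (0 : E) r, ⟪v, y⟫ ^ 2 := by
  rcases eq_or_ne v 0 with rfl | hv
  · simp
  have hv0 : 0 < ‖v‖ := norm_pos_iff.2 hv
  set e := (3 / 4 * r / ‖v‖) • v with he
  have hen : ‖e‖ = 3 / 4 * r := by
    rw [he, norm_smul, Real.norm_of_nonneg (by positivity)]; field_simp
  have hve : ⟪v, e⟫ = 3 / 4 * r * ‖v‖ := by
    rw [he, inner_smul_right, real_inner_self_eq_norm_sq]; field_simp
  have hsub : closedBall e (r / 4) ⊆ closedBall 0 r := by
    refine closedBall_subset_closedBall' ?_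
    rw [dist_zero_right, hen]; linarith
  have hvol : volume.real (closedBall e (r / 4))
      = (r / 4) ^ finrank ℝ E * volume.real (closedBall (0 : E) 1) := by
    rw [← measureReal_closedBall_zero (by positivity), Measure.real, Measure.real,
      Measure.addHaar_closedBall_center]
  calc _ = ∫ _ in closedBall e (r / 4), (‖v‖ * (r / 2)) ^ 2 := by
        rw [integral_const, measureReal_restrict_apply_univ, hvol, smul_eq_mul, div_pow, pow_succ]
        ring
    _ ≤ ∫ y in closedBall e (r / 4), ⟪v, y⟫ ^ 2 := by
        refine setIntegral_mono_on (Continuous.integrableOn_closedBall (by fun_prop) _ _)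
          (Continuous.integrableOn_closedBall (by fun_prop) _ _) measurableSet_closedBall
          fun y hy => ?_
        have h1 : ⟪v, e - y⟫ ≤ ‖v‖ * (r / 4) := by
          refine (real_inner_le_norm _ _).trans ?_
          gcongr
          rw [← dist_eq_norm, dist_comm]; exact hy
        rw [inner_sub_right, hve] at h1
        have : ‖v‖ * (r / 2) ≤ ⟪v, y⟫ := by linarith
        gcongr
    _ ≤ _ := setIntegral_mono_set (Continuous.integrableOn_closedBall (by fun_prop) _ _)
          (ae_of_all _ fun x => sq_nonneg _) (ae_of_all _ hsub)

lemma setIntegral_closedBall_comp_neg (h : E → ℝ) (r : ℝ) :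
    ∫ y in closedBall (0 : E) r, h (-y) = ∫ y in closedBall (0 : E) r, h y := by
  rw [← integral_indicator measurableSet_closedBall, ← integral_indicator measurableSet_closedBall,
    ← integral_neg_eq_self ((closedBall (0 : E) r).indicator h)]
  congr 1
  ext y
  by_cases hy : y ∈ closedBall (0 : E) r
  · have : -y ∈ closedBall (0 : E) r := by simpa using hy
    rw [indicator_of_mem hy, indicator_of_mem this]
  · have : -y ∉ closedBall (0 : E) r := by simpa using hy
    rw [indicator_of_notMem hy, indicator_of_notMem this]

/-- The linear part of a function that is small in `L²` is small. -/
lemma norm_sq_le_of_odd_part {h : E → ℝ} (hh : Continuous h) {v : E} {r e X : ℝ} (hr : 0 < r)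
    (hodd : ∀ y ∈ closedBall (0 : E) r, |h y - h (-y) - 2 * ⟪v, y⟫| ≤ e)
    (hX : ∫ y in closedBall (0 : E) r, h y ^ 2 ≤ X) :
    volume.real (closedBall (0 : E) 1) / 4 ^ (finrank ℝ E + 1) * ‖v‖ ^ 2 * r ^ (finrank ℝ E + 2)
      ≤ 2 * X + e ^ 2 * (r ^ finrank ℝ E * volume.real (closedBall (0 : E) 1)) := by
  refine (le_setIntegral_inner_sq v hr).trans ?_
  calc ∫ y in closedBall (0 : E) r, ⟪v, y⟫ ^ 2
      ≤ ∫ y in closedBall (0 : E) r, ((h y ^ 2 + h (-y) ^ 2) + e ^ 2) := by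
        refine setIntegral_mono_on (Continuous.integrableOn_closedBall (by fun_prop) _ _)
          (Continuous.integrableOn_closedBall (by fun_prop) _ _) measurableSet_closedBall
          fun y hy => ?_
        have h1 := sq_le_sq.2 ((hodd y hy).trans (le_abs_self _))
        have h2 := sq_nonneg (h y + h (-y))
        have h3 := sq_nonneg (2 * (h y - h (-y)) - 2 * ⟪v, y⟫)
        linarith [sq_nonneg e]
    _ = ((∫ y in closedBall (0 : E) r, h y ^ 2) + ∫ y in closedBall (0 : E) r, h y ^ 2)
          + e ^ 2 * (r ^ finrank ℝ E * volume.real (closedBall (0 : E) 1)) := by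
        rw [integral_add (Continuous.integrableOn_closedBall (by fun_prop) _ _)
          (Continuous.integrableOn_closedBall (by fun_prop) _ _),
          integral_add (Continuous.integrableOn_closedBall (by fun_prop) _ _)
          (Continuous.integrableOn_closedBall (by fun_prop) _ _),
          setIntegral_closedBall_comp_neg (fun y => h y ^ 2), integral_const, smul_eq_mul,
          measureReal_restrict_apply_univ, measureReal_closedBall_zero hr.le]
        ring
    _ ≤ _ := by linarith

end AffineChange

/-! ### From integral expansions to differentiability of the gradient -/

section ExpansionGradient

open scoped Topology ContDiff
open Module (finrank)

variable {E : Type*} [NormedAddCommGroup E] [InnerProductSpace ℝ E] [FiniteDimensional ℝ E]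
  [MeasurableSpace E] [BorelSpace E]

lemma measureReal_closedBall_zero_pos : 0 < volume.real (closedBall (0 : E) 1) :=
  ENNReal.toReal_pos (measure_closedBall_pos volume 0 one_pos).ne'
    (isCompact_closedBall 0 1).measure_lt_top.ne

lemma gradient_eq_of_expansion {W : E → ℝ} (hW : ContDiff ℝ 1 W) {z q : E} {a Λ : ℝ}
    {M : E →L[ℝ] E} (hΛ : 0 ≤ Λ)
    (hexp : ∀ r, 0 < r → r ≤ 1 / 2 → ∫ y in closedBall (0 : E) r, (W (z + y) - quad a q M y) ^ 2
      ≤ Λ * r ^ (finrank ℝ E + 5)) : gradient W z = q := by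
  set d := finrank ℝ E with hd
  set V := volume.real (closedBall (0 : E) 1) with hV
  have hV0 : 0 < V := measureReal_closedBall_zero_pos
  have hWc := hW.continuous
  have key : ∀ κ, 0 < κ → κ ≤ 1 / 2 →
      V / 4 ^ (d + 1) * ‖gradient W z - q‖ ^ 2 ≤ 2 * Λ * κ ^ 3 + 4 * κ ^ 2 * V := by
    intro κ hκ hκ2
    have h1 := (hasGradientAt_iff_isLittleO_nhds_zero.1 (hW.hasGradientAt z)).def hκ
    obtain ⟨ρ, hρ, hb⟩ := Metric.eventually_nhds_iff.1 h1
    set r := min κ (ρ / 2) with hr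
    have hr0 : 0 < r := lt_min hκ (by positivity)
    have hrκ : r ≤ κ := min_le_left _ _
    have hrρ : r < ρ := (min_le_right _ _).trans_lt (by linarith)
    have hb' : ∀ y ∈ closedBall (0 : E) r, |W (z + y) - W z - ⟪gradient W z, y⟫| ≤ κ * r := by
      intro y hy
      have hy' := mem_closedBall_zero_iff.1 hy
      refine (hb (y := y) (by rw [dist_zero_right]; linarith)).trans ?_
      gcongr
    have h2 := norm_sq_le_of_odd_part (h := fun y => W (z + y) - quad a q M y)
      (v := gradient W z - q) (e := 2 * κ * r) (by
        have := (contDiff_quad a q M).continuous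
        fun_prop) hr0 (fun y hy => ?_) (hexp r hr0 (hrκ.trans hκ2))
    · rw [← hV, ← hd] at h2
      have h3 : V / 4 ^ (d + 1) * ‖gradient W z - q‖ ^ 2 * r ^ (d + 2)
          ≤ (2 * Λ * r ^ 3 + 4 * κ ^ 2 * V) * r ^ (d + 2) := by
        refine h2.trans (le_of_eq ?_)
        ring
      refine (le_of_mul_le_mul_right h3 (by positivity)).trans ?_
      gcongr
    · have b1 := hb' y hy
      have b2 := hb' (-y) (by simpa using hy)
      have e : W (z + y) - quad a q M y - (W (z + -y) - quad a q M (-y))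
          - 2 * ⟪gradient W z - q, y⟫ = (W (z + y) - W z - ⟪gradient W z, y⟫)
            - (W (z + -y) - W z - ⟪gradient W z, -y⟫) := by
        simp only [quad, inner_sub_left, inner_neg_right, map_neg, inner_neg_left]
        ring
      rw [e]
      refine (abs_sub _ _).trans ?_
      linarith
  have hlim : Tendsto (fun κ : ℝ => 2 * Λ * κ ^ 3 + 4 * κ ^ 2 * V) (𝓝[>] 0) (𝓝 0) := by
    have : ContinuousAt (fun κ : ℝ => 2 * Λ * κ ^ 3 + 4 * κ ^ 2 * V) 0 := by fun_prop
    have h := this.tendsto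
    norm_num at h
    exact h.mono_left nhdsWithin_le_nhds
  have h0 : V / 4 ^ (d + 1) * ‖gradient W z - q‖ ^ 2 ≤ 0 := by
    refine ge_of_tendsto hlim ?_
    filter_upwards [Ioc_mem_nhdsGT (by norm_num : (0 : ℝ) < 1 / 2)] with κ hκ using key κ hκ.1 hκ.2
  have h1 : ‖gradient W z - q‖ ^ 2 ≤ 0 := by
    by_contra hcon
    push Not at hcon
    exact absurd h0 (not_le.2 (by positivity))
  have h2 : ‖gradient W z - q‖ = 0 := by
    simpa using le_antisymm h1 (sq_nonneg _)
  exact sub_eq_zero.1 (norm_eq_zero.1 h2)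

lemma gradient_sub_sq_le_of_expansion {W : E → ℝ} (hW : Continuous W) {z₀ z₁ q₀ q₁ : E}
    {a₀ a₁ Λ : ℝ} {M₀ M₁ : E →L[ℝ] E} (hM₀ : ∀ x y, ⟪M₀ x, y⟫ = ⟪x, M₀ y⟫)
    (hexp₀ : ∀ r, 0 < r → r ≤ 1 / 2 →
      ∫ y in closedBall (0 : E) r, (W (z₀ + y) - quad a₀ q₀ M₀ y) ^ 2
        ≤ Λ * r ^ (finrank ℝ E + 5))
    (hexp₁ : ∀ r, 0 < r → r ≤ 1 / 2 →
      ∫ y in closedBall (0 : E) r, (W (z₁ + y) - quad a₁ q₁ M₁ y) ^ 2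
        ≤ Λ * r ^ (finrank ℝ E + 5))
    (hne : z₁ ≠ z₀) (hz : ‖z₁ - z₀‖ ≤ 1 / 4) :
    volume.real (closedBall (0 : E) 1) / 4 ^ (finrank ℝ E + 1)
        * ‖q₁ - q₀ - M₀ (z₁ - z₀)‖ ^ 2
      ≤ 4 * Λ * (1 + 2 ^ (finrank ℝ E + 5)) * ‖z₁ - z₀‖ ^ 3 := by
  set d := finrank ℝ E with hd
  set τ := z₁ - z₀ with hτ
  set r := ‖τ‖ with hr
  have hr0 : 0 < r := norm_pos_iff.2 (sub_ne_zero.2 hne)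
  have hc₀ := (contDiff_quad a₀ q₀ M₀).continuous
  have hc₁ := (contDiff_quad a₁ q₁ M₁).continuous
  have hX : ∫ y in closedBall (0 : E) r, (quad a₁ q₁ M₁ y - quad a₀ q₀ M₀ (y + τ)) ^ 2
      ≤ 2 * (Λ * r ^ (d + 5)) + 2 * (Λ * (2 * r) ^ (d + 5)) := by
    have h1 := hexp₁ r hr0 (by linarith)
    have h0 := hexp₀ (2 * r) (by linarith) (by linarith)
    have h2 := setIntegral_comp_sub_le (h := fun y => (W (z₀ + y) - quad a₀ q₀ M₀ y) ^ 2)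
      (by fun_prop) (fun _ => sq_nonneg _) (r := r) (s := 2 * r) (v := -τ)
      (by rw [norm_neg, ← hr]; linarith)
    have e : ∀ y, z₀ + (y + τ) = z₁ + y := fun y => by rw [hτ]; abel
    simp only [sub_neg_eq_add, e] at h2
    calc _ ≤ ∫ y in closedBall (0 : E) r, (2 * (W (z₁ + y) - quad a₁ q₁ M₁ y) ^ 2
            + 2 * (W (z₁ + y) - quad a₀ q₀ M₀ (y + τ)) ^ 2) := by
          refine setIntegral_mono_on (Continuous.integrableOn_closedBall (by fun_prop) _ _)
            (Continuous.integrableOn_closedBall (by fun_prop) _ _) measurableSet_closedBall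
            fun y hy => ?_
          have := sq_nonneg ((W (z₁ + y) - quad a₁ q₁ M₁ y)
            + (W (z₁ + y) - quad a₀ q₀ M₀ (y + τ)))
          linarith
      _ = _ := by
          rw [integral_add (Continuous.integrableOn_closedBall (by fun_prop) _ _)
            (Continuous.integrableOn_closedBall (by fun_prop) _ _), integral_const_mul,
            integral_const_mul]
      _ ≤ _ := by linarith
  have h := norm_sq_le_of_odd_part (h := fun y => quad a₁ q₁ M₁ y - quad a₀ q₀ M₀ (y + τ))
    (v := q₁ - q₀ - M₀ τ) (e := 0) (by fun_prop) hr0 (fun y _ => le_of_eq ?_) hX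
  · rw [← hd] at h
    refine le_of_mul_le_mul_right (h.trans (le_of_eq ?_)) (pow_pos hr0 (d + 2))
    rw [mul_pow]
    ring
  · rw [abs_eq_zero]
    have e := hM₀ y τ
    simp only [quad, inner_sub_left, inner_add_right, inner_add_left, inner_neg_right, map_neg,
      inner_neg_left, map_add]
    rw [real_inner_comm (M₀ τ) y] at e
    linarith

/-- A `C¹` function with uniform second order expansions in `L²` is twice differentiable. -/
lemma hasFDerivAt_gradient_of_expansion {W : E → ℝ} (hW : ContDiff ℝ 1 W) {Λ : ℝ} (hΛ : 0 ≤ Λ)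
    (hexp : ∀ z ∈ ball (0 : E) (1 / 2), ∃ (a : ℝ) (q : E) (M : E →L[ℝ] E),
      (∀ x y, ⟪M x, y⟫ = ⟪x, M y⟫) ∧ ‖M‖ ≤ Λ ∧ ∀ r, 0 < r → r ≤ 1 / 2 →
        ∫ y in closedBall (0 : E) r, (W (z + y) - quad a q M y) ^ 2
          ≤ Λ * r ^ (finrank ℝ E + 5)) :
    ∀ z ∈ ball (0 : E) (1 / 2), ∃ M : E →L[ℝ] E, (∀ x y, ⟪M x, y⟫ = ⟪x, M y⟫) ∧ ‖M‖ ≤ Λ ∧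
      HasFDerivAt (gradient W) M z := by
  intro z hz
  obtain ⟨a, q, M, hMs, hMΛ, hM⟩ := hexp z hz
  refine ⟨M, hMs, hMΛ, .of_isLittleO (Asymptotics.isLittleO_iff.2 fun c hc => ?_)⟩
  have hV0 : 0 < volume.real (closedBall (0 : E) 1) := measureReal_closedBall_zero_pos
  set c₀ := volume.real (closedBall (0 : E) 1) / 4 ^ (finrank ℝ E + 1) with hc₀
  have hc₀0 : 0 < c₀ := by positivity
  set C := 4 * Λ * (1 + 2 ^ (finrank ℝ E + 5)) with hC
  have hC0 : 0 ≤ C := by positivity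
  have hρ : 0 < min (1 / 4) (c₀ * c ^ 2 / (C + 1)) := lt_min (by norm_num) (by positivity)
  filter_upwards [isOpen_ball.mem_nhds hz, ball_mem_nhds z hρ] with z₁ hz₁ hd
  rw [mem_ball, dist_eq_norm, lt_min_iff] at hd
  obtain ⟨a₁, q₁, M₁, -, -, hM₁⟩ := hexp z₁ hz₁
  rcases eq_or_ne z₁ z with rfl | hne
  · simp
  have h := gradient_sub_sq_le_of_expansion hW.continuous hMs hM hM₁ hne hd.1.le
  rw [gradient_eq_of_expansion hW hΛ hM, gradient_eq_of_expansion hW hΛ hM₁]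
  refine le_of_sq_le_sq ?_ (by positivity)
  have h1 : C * ‖z₁ - z‖ ≤ c₀ * c ^ 2 := by
    have := (lt_div_iff₀ (by positivity)).1 hd.2
    linarith [norm_nonneg (z₁ - z)]
  refine le_of_mul_le_mul_left (h.trans ?_) hc₀0
  calc C * ‖z₁ - z‖ ^ 3 = C * ‖z₁ - z‖ * ‖z₁ - z‖ ^ 2 := by ring
    _ ≤ c₀ * c ^ 2 * ‖z₁ - z‖ ^ 2 := by gcongr
    _ = _ := by ring

end ExpansionGradient

/-! ### Differentiability of the gradient for nearly constant coefficients -/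

section LocalRegularity

open scoped Topology ContDiff
open Module (finrank)

variable {E : Type*} [NormedAddCommGroup E] [InnerProductSpace ℝ E] [FiniteDimensional ℝ E]
  [MeasurableSpace E] [BorelSpace E]

variable {B : E →L[ℝ] E} {l : ℝ}

/-- `C¹` solutions with small gradient of an elliptic equation that is a small perturbation of one
with constant coefficients are twice differentiable. -/
lemma exists_hasFDerivAt_gradient_of_weakEq [Nontrivial E] (hl : 0 < l)
    (hBs : ∀ x y, ⟪B x, y⟫ = ⟪x, B y⟫) (hB : ∀ v, l * ‖v‖ ^ 2 ≤ ⟪B v, v⟫) :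
    ∃ η : ℝ, 0 < η ∧ ∀ (N : E → E) (N' : E → E →L[ℝ] E) (K δ₁ : ℝ), 0 ≤ K → 0 < δ₁ →
      (∀ q ∈ closedBall (0 : E) δ₁, HasFDerivAt N (N' q) q) →
      (∀ q ∈ closedBall (0 : E) δ₁, ‖N' q‖ ≤ η) →
      (∀ q ∈ closedBall (0 : E) δ₁, ∀ q' ∈ closedBall (0 : E) δ₁,
        ‖N' q' - N' q‖ ≤ K * ‖q' - q‖) →
      ∃ δ Λ : ℝ, 0 < δ ∧ ∀ W g : E → ℝ, ContDiff ℝ 1 W → Continuous g →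
        (∀ x, ‖gradient W x‖ ≤ δ) → WeakEq B (fun x => N (gradient W x)) g W (ball 0 1) →
        (∀ x ∈ ball (0 : E) 1, |g x| ≤ δ) →
        (∀ x ∈ ball (0 : E) 1, ∀ x' ∈ ball (0 : E) 1, |g x' - g x| ≤ δ * ‖x' - x‖) →
        ∀ z ∈ ball (0 : E) (1 / 2), ∃ M : E →L[ℝ] E, (∀ x y, ⟪M x, y⟫ = ⟪x, M y⟫) ∧ ‖M‖ ≤ Λ ∧
          HasFDerivAt (gradient W) M z := by
  obtain ⟨η, hη, H⟩ := exists_quadratic_expansion hl hBs hB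
  refine ⟨η, hη, fun N N' K δ₁ hK hδ₁ hN hNη hNK => ?_⟩
  obtain ⟨δ, Λ, hδ, hΛ, H⟩ := H N N' K δ₁ hK hδ₁ hN hNη hNK
  refine ⟨δ, 8 * Λ, hδ, fun W g hW hg hWδ hweak hgδ hgL => ?_⟩
  refine hasFDerivAt_gradient_of_expansion hW (by positivity) fun z hz => ?_
  rw [mem_ball_zero_iff] at hz
  have hmem : ∀ y ∈ ball (0 : E) 1, z + (1 / 2 : ℝ) • y ∈ ball (0 : E) 1 := fun y hy => by
    rw [mem_ball_zero_iff] at hy ⊢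
    refine (norm_add_le _ _).trans_lt ?_
    rw [norm_smul, Real.norm_of_nonneg (by norm_num)]
    linarith
  set w : E → ℝ := fun y => 2 * (W (z + (1 / 2 : ℝ) • y) - W z) with hw
  have hw1 : ContDiff ℝ 1 w := contDiff_const.mul
    ((hW.comp (contDiff_const.add (contDiff_const.smul contDiff_id))).sub contDiff_const)
  have hwg : ∀ y, gradient w y = gradient W (z + (1 / 2 : ℝ) • y) := by
    intro y
    have h1 : HasFDerivAt (fun y : E => z + (1 / 2 : ℝ) • y)
        ((1 / 2 : ℝ) • ContinuousLinearMap.id ℝ E) y :=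
      ((hasFDerivAt_id y).const_smul _).const_add z
    have h2 : HasFDerivAt (fun y => W (z + (1 / 2 : ℝ) • y)) _ y :=
      HasFDerivAt.comp (g := W) y (hW.differentiable one_ne_zero _).hasFDerivAt h1
    refine ext_inner_right ℝ fun v => ?_
    rw [inner_gradient_eq_fderiv, inner_gradient_eq_fderiv,
      ((h2.sub_const (W z)).const_mul 2).fderiv]
    simp
  obtain ⟨a, q, M, hMs, hMΛ, hM⟩ := H w (fun y => 1 / 2 * g (z + (1 / 2 : ℝ) • y)) hw1
    (by fun_prop) (by simp [hw]) (fun x => by rw [hwg]; exact hWδ _)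
    (fun ξ hξ hξc hξs => by
      simp only [hwg]
      rw [weak_identity_comp_affine (X := fun x => B (gradient W x) + N (gradient W x)) hweak z
        (by norm_num : (0 : ℝ) < 1 / 2) hξ hξc fun y hy => hmem y (hξs hy),
        ← integral_const_mul]
      congr 1
      ext y
      ring)
    (by
      have := hgδ _ (hmem 0 (mem_ball_self one_pos))
      rw [abs_mul, abs_of_pos (by norm_num : (0 : ℝ) < 1 / 2)]
      linarith)
    (fun x hx => by
      have := hgL _ (hmem 0 (mem_ball_self one_pos)) _ (hmem x hx)
      rw [smul_zero, add_zero, add_sub_cancel_left, norm_smul,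
        Real.norm_of_nonneg (by norm_num)] at this
      rw [← mul_sub, abs_mul, abs_of_pos (by norm_num : (0 : ℝ) < 1 / 2), smul_zero, add_zero]
      have h0 : 0 ≤ δ * ‖x‖ := by positivity
      linarith)
  refine ⟨W z + a / 2, q, (2 : ℝ) • M, fun x y => ?_, ?_, fun r hr hr2 => ?_⟩
  · simp only [smul_apply, real_inner_smul_left, real_inner_smul_right, hMs]
  · rw [norm_smul, Real.norm_of_nonneg (by norm_num)]
    linarith
  · have h1 := hM (2 * r) (by linarith) (by linarith)
    have h2 := setIntegral_closedBall_comp_smul (fun y => (w y - quad a q M y) ^ 2)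
      (by norm_num : (0 : ℝ) < 2) r
    have e : ∀ y, (W (z + y) - quad (W z + a / 2) q ((2 : ℝ) • M) y) ^ 2
        = 1 / 4 * (w ((2 : ℝ) • y) - quad a q M ((2 : ℝ) • y)) ^ 2 := by
      intro y
      simp only [hw, quad, smul_smul, map_smul, smul_apply, real_inner_smul_left,
        real_inner_smul_right]
      norm_num
      ring
    simp only [e]
    rw [integral_const_mul, h2]
    calc _ ≤ 1 / 4 * (((2 : ℝ) ^ finrank ℝ E)⁻¹ * (Λ * (2 * r) ^ (finrank ℝ E + 5))) := by gcongr
      _ = _ := by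
        rw [mul_pow, pow_add 2]
        field_simp
        ring

end LocalRegularity

/-! ### The field `‖q‖ ^ (p - 2) • q` and its derivative -/

section PField

open scoped Topology ContDiff
open Module (finrank)

variable {E : Type*} [NormedAddCommGroup E] [InnerProductSpace ℝ E] [FiniteDimensional ℝ E]
  [MeasurableSpace E] [BorelSpace E]

/-- The vector field `q ↦ |q|^{p-2} q` of the `p`-Laplacian. -/
def pField (p : ℝ) (q : E) : E := ‖q‖ ^ (p - 2) • q

/-- The derivative of `pField`. -/
def pFieldDeriv (p : ℝ) (q : E) : E →L[ℝ] E :=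
  ‖q‖ ^ (p - 2) • ContinuousLinearMap.id ℝ E
    + ((p - 2) * ‖q‖ ^ (p - 4)) • (innerSL ℝ q).smulRight q

omit [FiniteDimensional ℝ E] [MeasurableSpace E] [BorelSpace E] in
lemma pFieldDeriv_apply (p : ℝ) (q v : E) :
    pFieldDeriv p q v = ‖q‖ ^ (p - 2) • v + ((p - 2) * ‖q‖ ^ (p - 4) * ⟪q, v⟫) • q := by
  simp [pFieldDeriv, smul_smul]

omit [FiniteDimensional ℝ E] [MeasurableSpace E] [BorelSpace E] in
lemma hasFDerivAt_pField (p : ℝ) {q : E} (hq : q ≠ 0) :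
    HasFDerivAt (pField p) (pFieldDeriv p q) q := by
  have hq0 : 0 < ‖q‖ := norm_pos_iff.2 hq
  have h1 : HasFDerivAt (fun q : E => (‖q‖ ^ 2) ^ ((p - 2) / 2)) _ q :=
    ((hasStrictFDerivAt_norm_sq q).hasFDerivAt).rpow_const (p := (p - 2) / 2)
      (Or.inl (by positivity))
  have h2 : (fun q : E => (‖q‖ ^ 2) ^ ((p - 2) / 2)) = fun q : E => ‖q‖ ^ (p - 2) := by
    ext q
    rw [← Real.rpow_natCast, ← Real.rpow_mul (norm_nonneg _)]
    congr 1
    push_cast; ring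
  rw [h2] at h1
  have h3 := h1.smul (hasFDerivAt_id q)
  refine h3.congr_fderiv ?_
  ext1 v
  have h4 : (‖q‖ ^ 2) ^ ((p - 2) / 2 - 1) = ‖q‖ ^ (p - 4) := by
    rw [← Real.rpow_natCast, ← Real.rpow_mul (norm_nonneg _)]
    congr 1
    push_cast; ring
  rw [pFieldDeriv_apply, h4]
  simp
  congr 1
  ring

omit [FiniteDimensional ℝ E] [MeasurableSpace E] [BorelSpace E] in
lemma contDiffAt_pFieldDeriv (p : ℝ) {q : E} (hq : q ≠ 0) :
    ContDiffAt ℝ 1 (pFieldDeriv (E := E) p) q := by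
  have hn : ‖q‖ ≠ 0 := norm_ne_zero_iff.2 hq
  have h1 : ∀ s : ℝ, ContDiffAt ℝ 1 (fun q : E => ‖q‖ ^ s) q := fun s =>
    (contDiffAt_norm ℝ hq).rpow_const_of_ne hn
  have h2 : ContDiffAt ℝ 1 (fun q : E => (innerSL ℝ q).smulRight q) q := by
    have : ContDiff ℝ 1 fun q : E =>
        ContinuousLinearMap.smulRightL ℝ E E (innerSL ℝ q) q :=
      ((ContinuousLinearMap.smulRightL ℝ E E).contDiff.comp
        (innerSL ℝ (E := E)).contDiff).clm_apply contDiff_id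
    exact this.contDiffAt
  exact ((h1 _).smul contDiffAt_const).add ((contDiffAt_const.mul (h1 _)).smul h2)

omit [FiniteDimensional ℝ E] [MeasurableSpace E] [BorelSpace E] in
lemma pFieldDeriv_symm (p : ℝ) (q x y : E) :
    ⟪pFieldDeriv p q x, y⟫ = ⟪x, pFieldDeriv p q y⟫ := by
  simp only [pFieldDeriv_apply, inner_add_left, inner_add_right, real_inner_smul_left,
    real_inner_smul_right, real_inner_comm q x]
  ring

omit [FiniteDimensional ℝ E] [MeasurableSpace E] [BorelSpace E] in
lemma le_inner_pFieldDeriv {p : ℝ} {q : E} (hq : q ≠ 0) (v : E) :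
    min 1 (p - 1) * ‖q‖ ^ (p - 2) * ‖v‖ ^ 2 ≤ ⟪pFieldDeriv p q v, v⟫ := by
  have hq0 : 0 < ‖q‖ := norm_pos_iff.2 hq
  set a := ‖q‖ ^ (p - 2) with ha
  set b := ‖q‖ ^ (p - 4) with hb
  have ha0 : 0 < a := by positivity
  have hb0 : 0 < b := by positivity
  have hab : b * ‖q‖ ^ 2 = a := by
    rw [ha, hb, ← Real.rpow_natCast, ← Real.rpow_add hq0]
    congr 1
    push_cast; ring
  have hcs : ⟪q, v⟫ ^ 2 ≤ ‖q‖ ^ 2 * ‖v‖ ^ 2 := by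
    rw [← mul_pow]
    exact sq_le_sq.2 ((abs_real_inner_le_norm q v).trans (le_abs_self _))
  have e : ⟪pFieldDeriv p q v, v⟫ = a * ‖v‖ ^ 2 + (p - 2) * (b * ⟪q, v⟫ ^ 2) := by
    rw [pFieldDeriv_apply, inner_add_left, real_inner_smul_left, real_inner_smul_left,
      real_inner_self_eq_norm_sq]
    ring
  rw [e]
  have hbc : b * ⟪q, v⟫ ^ 2 ≤ a * ‖v‖ ^ 2 := by
    rw [← hab, mul_assoc]; gcongr
  have h0 : 0 ≤ a * ‖v‖ ^ 2 := by positivity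
  have h1 : 0 ≤ b * ⟪q, v⟫ ^ 2 := by positivity
  rcases le_total 2 p with hp | hp
  · calc _ ≤ 1 * a * ‖v‖ ^ 2 := by gcongr; exact min_le_left _ _
      _ ≤ _ := by linarith [mul_nonneg (sub_nonneg.2 hp) h1]
  · calc _ ≤ (p - 1) * a * ‖v‖ ^ 2 := by gcongr; exact min_le_right _ _
      _ ≤ _ := by linarith [mul_le_mul_of_nonneg_left hbc (sub_nonneg.2 hp)]

omit [MeasurableSpace E] [BorelSpace E] in
/-- Near a point of differentiability a `C¹` function is, after rescaling, the sum of an affine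
function and of a function which extends to a `C¹` function on the whole space with small
gradient. -/
lemma exists_rescaled_extension {U : Set E} (hU : IsOpen U) {u : E → ℝ} (hu : ContDiffOn ℝ 1 u U)
    {x₀ : E} (hx₀ : x₀ ∈ U) {δ : ℝ} (hδ : 0 < δ) :
    ∃ ρ₀ : ℝ, 0 < ρ₀ ∧ ∀ ρ, 0 < ρ → ρ ≤ ρ₀ → ∃ W : E → ℝ, ContDiff ℝ 1 W ∧ W 0 = 0 ∧
      (∀ z, ‖gradient W z‖ ≤ δ) ∧ ∀ z ∈ ball (0 : E) 1, x₀ + ρ • z ∈ U ∧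
        gradient u (x₀ + ρ • z) = gradient u x₀ + gradient W z ∧
        u (x₀ + ρ • z) = u x₀ + ρ * (W z + ⟪gradient u x₀, z⟫) := by
  let χ : ContDiffBump (0 : E) := ⟨1, 2, one_pos, one_lt_two⟩
  have hχ : ContDiff ℝ 1 χ := χ.contDiff
  obtain ⟨C, hC⟩ : ∃ C, ∀ z, ‖gradient χ z‖ ≤ C :=
    (hasCompactSupport_gradient χ.hasCompactSupport).exists_bound_of_continuous
      hχ.continuous_gradient
  have hC0 : 0 ≤ C := (norm_nonneg _).trans (hC 0)
  set q := gradient u x₀ with hq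
  set κ := δ / (1 + 3 * C) with hκ
  have hκ0 : 0 < κ := by positivity
  have hκδ : κ + 3 * κ * C = δ := by rw [hκ]; field_simp
  have hgc : ContinuousAt (gradient u) x₀ := by
    have h1 : ContinuousAt (fderiv ℝ u) x₀ :=
      (hu.continuousOn_fderiv_of_isOpen hU le_rfl).continuousAt (hU.mem_nhds hx₀)
    exact (InnerProductSpace.toDual ℝ E).symm.continuous.continuousAt.comp h1
  obtain ⟨s, hs, hsU⟩ := Metric.mem_nhds_iff.1 (Filter.inter_mem (hU.mem_nhds hx₀)
    (hgc (closedBall_mem_nhds q hκ0)))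
  refine ⟨s / 3, by positivity, fun ρ hρ hρs => ?_⟩
  have hmem : ∀ z ∈ ball (0 : E) 3, x₀ + ρ • z ∈ U ∧ ‖gradient u (x₀ + ρ • z) - q‖ ≤ κ := by
    intro z hz
    rw [mem_ball_zero_iff] at hz
    have := @hsU (x₀ + ρ • z) (by
      rw [mem_ball, dist_eq_norm, add_sub_cancel_left, norm_smul, Real.norm_of_nonneg hρ.le]
      calc ρ * ‖z‖ < ρ * 3 := by gcongr
        _ ≤ s := by linarith)
    refine ⟨this.1, ?_⟩
    rw [← dist_eq_norm]
    exact this.2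
  set h : E → ℝ := fun z => ρ⁻¹ * (u (x₀ + ρ • z) - u x₀) - ⟪q, z⟫ with hh
  have hcd : ∀ z ∈ ball (0 : E) 3, ContDiffAt ℝ 1 h z := by
    intro z hz
    have h1 : ContDiffAt ℝ 1 u (x₀ + ρ • z) := hu.contDiffAt (hU.mem_nhds (hmem z hz).1)
    have h2 : ContDiffAt ℝ 1 (fun z => u (x₀ + ρ • z)) z :=
      h1.comp z (contDiff_const.add (contDiff_const.smul contDiff_id)).contDiffAt
    exact (contDiffAt_const.mul (h2.sub contDiffAt_const)).sub
      (contDiff_const.inner ℝ contDiff_id).contDiffAt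
  have hgr : ∀ z ∈ ball (0 : E) 3, gradient h z = gradient u (x₀ + ρ • z) - q := by
    intro z hz
    have h1 : DifferentiableAt ℝ u (x₀ + ρ • z) :=
      (hu.contDiffAt (hU.mem_nhds (hmem z hz).1)).differentiableAt one_ne_zero
    have h2 : HasFDerivAt (fun y : E => x₀ + ρ • y) (ρ • ContinuousLinearMap.id ℝ E) z :=
      ((hasFDerivAt_id z).const_smul _).const_add x₀
    have h3 : HasFDerivAt (fun z => u (x₀ + ρ • z)) _ z :=
      HasFDerivAt.comp (g := u) z h1.hasFDerivAt h2
    have h4 : HasFDerivAt h _ z :=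
      ((h3.sub_const (u x₀)).const_mul ρ⁻¹).sub (innerSL ℝ q).hasFDerivAt
    refine ext_inner_right ℝ fun v => ?_
    rw [inner_gradient_eq_fderiv, h4.fderiv, inner_sub_left, inner_gradient_eq_fderiv]
    simp [hρ.ne']
  have hbd : ∀ z ∈ ball (0 : E) 3, |h z| ≤ 3 * κ := by
    intro z hz
    have := (convex_ball (0 : E) 3).norm_image_sub_le_of_norm_hasFDerivWithin_le (f := h) (C := κ)
      (fun y hy => ((hcd y hy).differentiableAt one_ne_zero).hasFDerivAt.hasFDerivWithinAt)
      (fun y hy => by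
        rw [← LinearIsometryEquiv.norm_map (InnerProductSpace.toDual ℝ E).symm]
        change ‖gradient h y‖ ≤ κ
        rw [hgr y hy]
        exact (hmem y hy).2)
      (mem_ball_self three_pos) hz
    have h0 : h 0 = 0 := by simp [hh]
    rw [h0, sub_zero, sub_zero, Real.norm_eq_abs] at this
    rw [mem_ball_zero_iff] at hz
    refine this.trans ?_
    rw [mul_comm]
    gcongr
  set W : E → ℝ := fun z => χ z * h z with hW
  have hts : tsupport W ⊆ closedBall 0 2 := by
    refine (closure_mono (Function.support_mul_subset_left _ _)).trans ?_
    have : tsupport χ = closedBall 0 2 := χ.tsupport_eq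
    exact this.le
  have hW1 : ContDiff ℝ 1 W := by
    refine contDiff_iff_contDiffAt.2 fun z => ?_
    by_cases hz : z ∈ ball (0 : E) 3
    · exact hχ.contDiffAt.mul (hcd z hz)
    · have : z ∉ tsupport W := fun hz' => hz (closedBall_subset_ball (by norm_num) (hts hz'))
      exact (contDiffAt_const (c := (0 : ℝ))).congr_of_eventuallyEq
        (notMem_tsupport_iff_eventuallyEq.1 this)
  have hWh : ∀ z ∈ ball (0 : E) 1, W =ᶠ[𝓝 z] h := by
    intro z hz
    filter_upwards [isOpen_ball.mem_nhds hz] with y hy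
    have : χ y = 1 := χ.one_of_mem_closedBall (ball_subset_closedBall hy)
    rw [hW]
    simp [this]
  have h13 : ball (0 : E) 1 ⊆ ball 0 3 := ball_subset_ball (by norm_num)
  refine ⟨W, hW1, by simp [hW, hh], fun z => ?_, fun z hz => ⟨(hmem z (h13 hz)).1, ?_, ?_⟩⟩
  · by_cases hz : z ∈ ball (0 : E) 3
    · have e : gradient W z = χ z • gradient h z + h z • gradient χ z := by
        have h1 : HasFDerivAt W _ z := (hχ.differentiable one_ne_zero z).hasFDerivAt.mul
          ((hcd z hz).differentiableAt one_ne_zero).hasFDerivAt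
        refine ext_inner_right ℝ fun v => ?_
        rw [inner_gradient_eq_fderiv, h1.fderiv, inner_add_left, real_inner_smul_left,
          real_inner_smul_left, inner_gradient_eq_fderiv, inner_gradient_eq_fderiv]
        simp
      rw [e]
      have h1 : ‖χ z‖ ≤ 1 := by
        rw [Real.norm_of_nonneg χ.nonneg]; exact χ.le_one
      calc _ ≤ ‖χ z‖ * ‖gradient h z‖ + ‖h z‖ * ‖gradient χ z‖ := by
            rw [← norm_smul, ← norm_smul]; exact norm_add_le _ _
        _ ≤ 1 * κ + 3 * κ * C := by
            gcongr
            · rw [hgr z hz]; exact (hmem z hz).2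
            · exact hbd z hz
            · exact hC z
        _ = δ := by rw [one_mul, hκδ]
    · rw [gradient_eq_zero_of_notMem_tsupport fun hz' =>
        hz (closedBall_subset_ball (by norm_num) (hts hz')), norm_zero]
      exact hδ.le
  · have : gradient W z = gradient h z := by
      rw [gradient, gradient, (hWh z hz).fderiv_eq]
    rw [this, hgr z (h13 hz)]
    abel
  · rw [(hWh z hz).eq_of_nhds]
    simp only [hh]
    field_simp
    ring

end PField

/-! ### Differentiability of the gradient away from critical points -/

section NonCritical

open scoped Topology ContDiff
open Module (finrank)

variable {E : Type*} [NormedAddCommGroup E] [InnerProductSpace ℝ E] [FiniteDimensional ℝ E]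
  [MeasurableSpace E] [BorelSpace E]

lemma exists_bound_of_contDiff {f : ℝ → ℝ} (hf : ContDiff ℝ 1 f) (t₀ : ℝ) :
    ∃ F : ℝ, 0 ≤ F ∧ (∀ t ∈ closedBall t₀ 1, |f t| ≤ F) ∧
      ∀ t ∈ closedBall t₀ 1, ∀ t' ∈ closedBall t₀ 1, |f t' - f t| ≤ F * |t' - t| := by
  obtain ⟨F₀, hF₀⟩ := (isCompact_closedBall t₀ 1).exists_bound_of_continuousOn
    hf.continuous.continuousOn
  obtain ⟨F₁, hF₁⟩ := (isCompact_closedBall t₀ 1).exists_bound_of_continuousOn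
    (hf.continuous_deriv le_rfl).continuousOn
  have ht₀ : t₀ ∈ closedBall t₀ 1 := mem_closedBall_self zero_le_one
  refine ⟨max F₀ F₁, ((norm_nonneg _).trans (hF₀ t₀ ht₀)).trans (le_max_left _ _),
    fun t ht => (hF₀ t ht).trans (le_max_left _ _), fun t ht t' ht' => ?_⟩
  exact (convex_closedBall t₀ 1).norm_image_sub_le_of_norm_deriv_le
    (fun x _ => hf.differentiable one_ne_zero x)
    (fun x hx => (hF₁ x hx).trans (le_max_right _ _)) ht ht'

omit [FiniteDimensional ℝ E] [MeasurableSpace E] [BorelSpace E] in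
lemma exists_pField_remainder_bounds (p : ℝ) {q₀ : E} (hq₀ : q₀ ≠ 0) {η : ℝ} (hη : 0 < η) :
    ∃ K δ₁ : ℝ, 0 ≤ K ∧ 0 < δ₁ ∧
      (∀ q ∈ closedBall (0 : E) δ₁, q₀ + q ≠ 0) ∧
      (∀ q ∈ closedBall (0 : E) δ₁, ‖pFieldDeriv p (q₀ + q) - pFieldDeriv p q₀‖ ≤ η) ∧
      ∀ q ∈ closedBall (0 : E) δ₁, ∀ q' ∈ closedBall (0 : E) δ₁,
        ‖pFieldDeriv p (q₀ + q') - pFieldDeriv p (q₀ + q)‖ ≤ K * ‖q' - q‖ := by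
  have hC := contDiffAt_pFieldDeriv p hq₀
  obtain ⟨K, t, ht, hK⟩ := hC.exists_lipschitzOnWith
  have h1 := hC.continuousAt (closedBall_mem_nhds (pFieldDeriv p q₀) hη)
  obtain ⟨s, hs, hst⟩ := Metric.mem_nhds_iff.1
    (inter_mem (inter_mem ht h1) (isOpen_ne.mem_nhds hq₀))
  have hmem : ∀ q ∈ closedBall (0 : E) (s / 2), q₀ + q ∈ ball q₀ s := fun q hq => by
    rw [mem_closedBall_zero_iff] at hq
    rw [mem_ball, dist_eq_norm, add_sub_cancel_left]
    linarith
  refine ⟨K, s / 2, K.2, by positivity, fun q hq => (hst (hmem q hq)).2, fun q hq => ?_,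
    fun q hq q' hq' => ?_⟩
  · rw [← dist_eq_norm]
    exact (hst (hmem q hq)).1.2
  · have := hK.dist_le_mul _ (hst (hmem q' hq')).1.1 _ (hst (hmem q hq)).1.1
    rwa [dist_eq_norm, dist_eq_norm, add_sub_add_left_eq_sub] at this

/-- A `C¹` weak solution of `-Δ_p u = f(u)` is twice differentiable off the critical set, with
locally bounded second derivatives. -/
theorem exists_hasFDerivAt_gradient [Nontrivial E] {p : ℝ} (hp : 1 < p) {f : ℝ → ℝ}
    (hf : ContDiff ℝ 1 f) {U : Set E} (hU : IsOpen U) {u : E → ℝ} (hu : ContDiffOn ℝ 1 u U)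
    (hweak : ∀ ξ : E → ℝ, ContDiff ℝ 1 ξ → HasCompactSupport ξ → tsupport ξ ⊆ U →
      ∫ x, ⟪pField p (gradient u x), gradient ξ x⟫ = ∫ x, f (u x) * ξ x)
    {x₀ : E} (hx₀ : x₀ ∈ U) (hq₀ : gradient u x₀ ≠ 0) :
    ∃ ρ Λ : ℝ, 0 < ρ ∧ ∀ x ∈ ball x₀ ρ, ∃ M : E →L[ℝ] E,
      (∀ v w, ⟪M v, w⟫ = ⟪v, M w⟫) ∧ ‖M‖ ≤ Λ ∧ HasFDerivAt (gradient u) M x := by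
  set q := gradient u x₀ with hq
  have hn : 0 < ‖q‖ := norm_pos_iff.2 hq₀
  set B := pFieldDeriv p q with hB
  obtain ⟨η, hη, H⟩ := exists_hasFDerivAt_gradient_of_weakEq (B := B)
    (l := min 1 (p - 1) * ‖q‖ ^ (p - 2))
    (mul_pos (lt_min one_pos (by linarith)) (by positivity)) (pFieldDeriv_symm p q)
    (le_inner_pFieldDeriv hq₀)
  obtain ⟨K, δ₁, hK, hδ₁, hne, hNη, hNK⟩ := exists_pField_remainder_bounds p hq₀ hη
  obtain ⟨δ, Λ, hδ, H⟩ := H (fun y => pField p (q + y) - B y)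
    (fun y => pFieldDeriv p (q + y) - B) K δ₁ hK hδ₁
    (fun y hy => by
      have h1 : HasFDerivAt (fun y => pField p (q + y)) _ y := HasFDerivAt.comp (g := pField p) y
        (hasFDerivAt_pField p (hne y hy)) ((hasFDerivAt_id y).const_add q)
      exact h1.sub B.hasFDerivAt)
    hNη (fun y hy y' hy' => by rw [sub_sub_sub_cancel_right]; exact hNK y hy y' hy')
  obtain ⟨ρ₀, hρ₀, hext⟩ := exists_rescaled_extension hU hu hx₀ hδ
  obtain ⟨F, hF0, hFb, hFL⟩ := exists_bound_of_contDiff hf (u x₀)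
  set ρ := min ρ₀ (min (1 / (δ + ‖q‖)) (δ / (F + 1))) with hρ
  have hρ0 : 0 < ρ := lt_min hρ₀ (lt_min (by positivity) (by positivity))
  have hρ1 : ρ * (δ + ‖q‖) ≤ 1 := by
    have : ρ ≤ 1 / (δ + ‖q‖) := (min_le_right _ _).trans (min_le_left _ _)
    rwa [le_div_iff₀ (by positivity)] at this
  have hρ2 : ρ * F ≤ δ := by
    have : ρ ≤ δ / (F + 1) := (min_le_right _ _).trans (min_le_right _ _)
    rw [le_div_iff₀ (by positivity)] at this
    linarith
  obtain ⟨W, hW1, hW0, hWδ, hWu⟩ := hext ρ hρ0 (min_le_left _ _)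
  set t : E → ℝ := fun z => u x₀ + ρ * (W z + ⟪q, z⟫) with ht
  have htc : Continuous t := by
    have := hW1.continuous
    fun_prop
  have htL : ∀ z z', |t z' - t z| ≤ ρ * (δ + ‖q‖) * ‖z' - z‖ := by
    intro z z'
    have h1 := convex_univ.norm_image_sub_le_of_norm_hasFDerivWithin_le (f := W) (C := δ)
      (fun y _ => (hasGradientAt_iff_hasFDerivAt.1 (hW1.hasGradientAt y)).hasFDerivWithinAt)
      (fun y _ => by rw [LinearIsometryEquiv.norm_map]; exact hWδ y)
      (mem_univ z) (mem_univ z')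
    have h2 := abs_real_inner_le_norm q (z' - z)
    have e : t z' - t z = ρ * ((W z' - W z) + ⟪q, z' - z⟫) := by
      simp only [ht, inner_sub_right]; ring
    rw [e, abs_mul, abs_of_pos hρ0, mul_assoc, add_mul]
    gcongr
    exact (abs_add_le _ _).trans (add_le_add h1 h2)
  have htb : ∀ z ∈ ball (0 : E) 1, t z ∈ closedBall (u x₀) 1 := by
    intro z hz
    rw [mem_ball_zero_iff] at hz
    have h1 := htL 0 z
    have h0 : t 0 = u x₀ := by simp [ht, hW0]
    rw [h0, sub_zero] at h1
    rw [mem_closedBall, Real.dist_eq]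
    calc _ ≤ _ := h1
      _ ≤ 1 * 1 := by gcongr
      _ = 1 := one_mul 1
  have hreg := H W (fun z => ρ * f (t z)) hW1 (by have := hf.continuous; fun_prop) hWδ
    (fun ξ hξ hξc hξs => by
      have h1 := weak_identity_comp_affine (X := fun x => pField p (gradient u x))
        (G := fun x => f (u x)) hweak x₀ hρ0 hξ hξc fun y hy => (hWu y (hξs hy)).1
      have e1 : ∀ y, ⟪B (gradient W y) + (pField p (q + gradient W y) - B (gradient W y)),
          gradient ξ y⟫ = ⟪pField p (gradient u (x₀ + ρ • y)), gradient ξ y⟫ := by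
        intro y
        by_cases hy : y ∈ tsupport ξ
        · rw [(hWu y (hξs hy)).2.1, add_sub_cancel]
        · rw [gradient_eq_zero_of_notMem_tsupport hy, inner_zero_right, inner_zero_right]
      have e2 : ∀ y, ρ * f (t y) * ξ y = ρ * (f (u (x₀ + ρ • y)) * ξ y) := by
        intro y
        by_cases hy : y ∈ tsupport ξ
        · rw [(hWu y (hξs hy)).2.2, mul_assoc]
        · rw [image_eq_zero_of_notMem_tsupport hy, mul_zero, mul_zero, mul_zero]
      simp only [e1, e2]
      rw [h1, integral_const_mul])
    (fun z hz => by
      rw [abs_mul, abs_of_pos hρ0]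
      refine le_trans ?_ hρ2
      gcongr
      exact hFb _ (htb z hz))
    (fun z hz z' hz' => by
      rw [← mul_sub, abs_mul, abs_of_pos hρ0]
      calc ρ * |f (t z') - f (t z)| ≤ ρ * (F * (ρ * (δ + ‖q‖) * ‖z' - z‖)) := by
            gcongr
            exact (hFL _ (htb z hz) _ (htb z' hz')).trans (by gcongr; exact htL z z')
        _ = (ρ * F) * ((ρ * (δ + ‖q‖)) * ‖z' - z‖) := by ring
        _ ≤ δ * (1 * ‖z' - z‖) := by gcongr
        _ = _ := by rw [one_mul])
  refine ⟨ρ / 2, ρ⁻¹ * Λ, by positivity, fun x hx => ?_⟩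
  have hback : ∀ y : E, x₀ + ρ • (ρ⁻¹ • (y - x₀)) = y := fun y => by
    rw [smul_smul, mul_inv_cancel₀ hρ0.ne', one_smul, add_sub_cancel]
  have hball : ∀ y ∈ ball x₀ (ρ / 2), ρ⁻¹ • (y - x₀) ∈ ball (0 : E) (1 / 2) := fun y hy => by
    rw [mem_ball, dist_eq_norm] at hy
    rw [mem_ball_zero_iff, norm_smul, norm_inv, Real.norm_of_nonneg hρ0.le,
      inv_mul_lt_iff₀ hρ0]
    linarith
  obtain ⟨M, hMs, hMΛ, hM⟩ := hreg _ (hball x hx)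
  refine ⟨ρ⁻¹ • M, fun v w => ?_, ?_, ?_⟩
  · simp only [smul_apply, real_inner_smul_left, real_inner_smul_right, hMs]
  · rw [norm_smul, norm_inv, Real.norm_of_nonneg hρ0.le]
    gcongr
  · have h1 : HasFDerivAt (fun y : E => ρ⁻¹ • (y - x₀)) (ρ⁻¹ • ContinuousLinearMap.id ℝ E) x :=
      ((hasFDerivAt_id x).sub_const x₀).const_smul ρ⁻¹
    have h2 : HasFDerivAt (fun y => q + gradient W (ρ⁻¹ • (y - x₀))) _ x :=
      (HasFDerivAt.comp (g := gradient W) x hM h1).const_add q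
    refine (h2.congr_fderiv ?_).congr_of_eventuallyEq ?_
    · ext1 v; simp
    · filter_upwards [isOpen_ball.mem_nhds hx] with y hy
      have := (hWu _ (ball_subset_ball (by norm_num) (hball y hy))).2.1
      rwa [hback] at this

end NonCritical

/-! ### Differentiation of integrals along dilations -/

section Dilations

open scoped Topology ContDiff
open Module (finrank)

variable {E : Type*} [NormedAddCommGroup E] [InnerProductSpace ℝ E] [FiniteDimensional ℝ E]
  [MeasurableSpace E] [BorelSpace E]

section Dilation

variable {F : Type*} [NormedAddCommGroup F] [InnerProductSpace ℝ F] [FiniteDimensional ℝ F]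

omit [FiniteDimensional ℝ E] [MeasurableSpace E] [BorelSpace E] [FiniteDimensional ℝ F] in
lemma exists_fderiv_bound_dilation {Φ : E → F} {K Ω : Set E} (hK : IsCompact K) (hΩ : IsOpen Ω)
    (hKΩ : K ⊆ Ω) (hΦ : ∀ x ∈ Ω, ∃ C, ∀ᶠ y in 𝓝 x, ‖fderiv ℝ Φ y‖ ≤ C) :
    ∃ s ∈ 𝓝 (1 : ℝ), ∃ C, ∀ t ∈ s, ∀ y ∈ K, t • y ∈ Ω ∧ ‖fderiv ℝ Φ (t • y)‖ ≤ C := by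
  refine hK.induction_on (p := fun A => ∃ s ∈ 𝓝 (1 : ℝ), ∃ C, ∀ t ∈ s, ∀ y ∈ A,
    t • y ∈ Ω ∧ ‖fderiv ℝ Φ (t • y)‖ ≤ C) ⟨univ, univ_mem, 0, by simp⟩ ?_ ?_ ?_
  · rintro A A' hA ⟨s, hs, C, h⟩
    exact ⟨s, hs, C, fun t ht y hy => h t ht y (hA hy)⟩
  · rintro A A' ⟨s, hs, C, h⟩ ⟨s', hs', C', h'⟩
    refine ⟨s ∩ s', inter_mem hs hs', max C C', fun t ht y hy => ?_⟩
    rcases hy with hy | hy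
    · exact ⟨(h t ht.1 y hy).1, (h t ht.1 y hy).2.trans (le_max_left _ _)⟩
    · exact ⟨(h' t ht.2 y hy).1, (h' t ht.2 y hy).2.trans (le_max_right _ _)⟩
  · intro x hx
    obtain ⟨C, hC⟩ := hΦ x (hKΩ hx)
    have h1 : Tendsto (fun p : ℝ × E => p.1 • p.2) (𝓝 1 ×ˢ 𝓝 x) (𝓝 x) := by
      have : Continuous fun p : ℝ × E => p.1 • p.2 := by fun_prop
      simpa [nhds_prod_eq] using this.tendsto ((1 : ℝ), x)
    have h2 : ∀ᶠ y in 𝓝 x, y ∈ Ω ∧ ‖fderiv ℝ Φ y‖ ≤ C :=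
      (hΩ.eventually_mem (hKΩ hx)).and hC
    obtain ⟨a, ha, b, hb, hab⟩ := Filter.eventually_prod_iff.1 (h1.eventually h2)
    exact ⟨{y | b y}, mem_nhdsWithin_of_mem_nhds hb, {t | a t}, ha, C,
      fun t ht y hy => hab ht hy⟩

lemma integrable_inner_of_bound {Y Z : E → F} {K : Set E} (hK : IsCompact K)
    (hY : AEStronglyMeasurable Y) {C : ℝ} (hYC : ∀ x ∈ K, ‖Y x‖ ≤ C) (hZ : ContinuousOn Z K)
    (hZ0 : ∀ x ∉ K, Z x = 0) : Integrable fun x => ⟪Y x, Z x⟫ := by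
  have hind : (fun x => ⟪Y x, Z x⟫) = K.indicator fun x => ⟪Y x, Z x⟫ := by
    ext x
    by_cases hx : x ∈ K
    · rw [indicator_of_mem hx]
    · rw [indicator_of_notMem hx, hZ0 x hx, inner_zero_right]
  rw [hind, integrable_indicator_iff hK.measurableSet]
  have hZm := hZ.aestronglyMeasurable (μ := volume) hK.measurableSet
  refine Integrable.mono' (g := fun x => C * ‖Z x‖)
    ((hZ.norm.integrableOn_compact hK).const_mul C) (hY.restrict.inner hZm) ?_
  filter_upwards [ae_restrict_mem hK.measurableSet] with x hx
  refine (norm_inner_le_norm _ _).trans ?_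
  gcongr
  exact hYC x hx

lemma hasDerivAt_integral_dilation [MeasurableSpace F] [BorelSpace F] {Φ X : E → F} {Ω : Set E}
    (hΩ : IsOpen Ω) (hX : Continuous X) (hXc : HasCompactSupport X) (hXΩ : tsupport X ⊆ Ω)
    (hd : ∀ x ∈ Ω, DifferentiableAt ℝ Φ x)
    (hΦ : ∀ x ∈ Ω, ∃ C, ∀ᶠ y in 𝓝 x, ‖fderiv ℝ Φ y‖ ≤ C) :
    HasDerivAt (fun t : ℝ => ∫ y, ⟪Φ (t • y), X y⟫) (∫ y, ⟪fderiv ℝ Φ y y, X y⟫) 1 := by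
  obtain ⟨s, hs, C, h⟩ := exists_fderiv_bound_dilation hXc.isCompact hΩ hXΩ hΦ
  have hX0 : ∀ x ∉ tsupport X, X x = 0 := fun x hx => image_eq_zero_of_notMem_tsupport hx
  have hint : ∀ t ∈ s, Integrable fun y => ⟪Φ (t • y), X y⟫ := by
    intro t ht
    have hind : (fun y => ⟪Φ (t • y), X y⟫)
        = (tsupport X).indicator fun y => ⟪Φ (t • y), X y⟫ := by
      ext x
      by_cases hx : x ∈ tsupport X
      · rw [indicator_of_mem hx]
      · rw [indicator_of_notMem hx, hX0 x hx, inner_zero_right]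
    rw [hind, integrable_indicator_iff hXc.isCompact.measurableSet]
    refine ContinuousOn.integrableOn_compact hXc.isCompact fun y hy => ?_
    have h1 : ContinuousAt (fun y : E => Φ (t • y)) y :=
      ContinuousAt.comp (g := Φ) (hd _ (h t ht y hy).1).continuousAt
        (continuous_const_smul t).continuousAt
    exact (h1.inner hX.continuousAt).continuousWithinAt
  have key := hasDerivAt_integral_of_dominated_loc_of_deriv_le (μ := (volume : Measure E))
    (F := fun (t : ℝ) y => ⟪Φ (t • y), X y⟫) (F' := fun t y => ⟪fderiv ℝ Φ (t • y) y, X y⟫)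
    (bound := fun y => C * ‖y‖ * ‖X y‖) (x₀ := 1) hs
    (by filter_upwards [hs] with t ht using (hint t ht).aestronglyMeasurable)
    (hint 1 (mem_of_mem_nhds hs)) ?_ ?_ ?_ ?_
  · simpa only [one_smul] using key.2
  · simp only [one_smul]
    have h1 : StronglyMeasurable (fderiv ℝ Φ) := (measurable_fderiv ℝ Φ).stronglyMeasurable
    have h2 : StronglyMeasurable fun y => fderiv ℝ Φ y y :=
      isBoundedBilinearMap_apply.continuous.comp_stronglyMeasurable
        (h1.prodMk stronglyMeasurable_id)
    exact h2.aestronglyMeasurable.inner hX.aestronglyMeasurable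
  · refine ae_of_all _ fun y t ht => ?_
    by_cases hy : y ∈ tsupport X
    · refine (norm_inner_le_norm _ _).trans ?_
      gcongr
      refine (ContinuousLinearMap.le_opNorm _ _).trans ?_
      gcongr
      exact (h t ht y hy).2
    · simp [hX0 y hy]
  · refine Continuous.integrable_of_hasCompactSupport (by fun_prop) ?_
    exact hXc.norm.mul_left
  · refine ae_of_all _ fun y t ht => ?_
    by_cases hy : y ∈ tsupport X
    · have h1 : HasDerivAt (fun t : ℝ => t • y) ((1 : ℝ) • y) t := (hasDerivAt_id t).smul_const y
      have h2 : HasDerivAt (fun t : ℝ => Φ (t • y)) _ t :=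
        HasFDerivAt.comp_hasDerivAt (l := Φ) t (hd _ (h t ht y hy).1).hasFDerivAt h1
      rw [one_smul] at h2
      simpa using h2.inner ℝ (hasDerivAt_const t (X y))
    · simpa [hX0 y hy] using hasDerivAt_const t (0 : ℝ)

end Dilation

end Dilations

/-! ### The equation satisfied by `x ↦ ⟪x, ∇u x⟫` -/

section Linearized

open scoped Topology ContDiff
open Module (finrank)

variable {E : Type*} [NormedAddCommGroup E] [InnerProductSpace ℝ E] [FiniteDimensional ℝ E]
  [MeasurableSpace E] [BorelSpace E]

omit [FiniteDimensional ℝ E] [MeasurableSpace E] [BorelSpace E] in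
lemma pFieldDeriv_self (p : ℝ) {q : E} (hq : q ≠ 0) :
    pFieldDeriv p q q = (p - 1) • pField p q := by
  have hq0 : 0 < ‖q‖ := norm_pos_iff.2 hq
  have hab : ‖q‖ ^ (p - 4) * ‖q‖ ^ 2 = ‖q‖ ^ (p - 2) := by
    rw [← Real.rpow_natCast, ← Real.rpow_add hq0]
    congr 1
    push_cast; ring
  rw [pFieldDeriv_apply, real_inner_self_eq_norm_sq, mul_assoc, hab, pField]
  module

omit [MeasurableSpace E] [BorelSpace E] in
lemma gradient_inner_self_gradient {u : E → ℝ} {M : E →L[ℝ] E} {x : E}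
    (hMs : ∀ v w, ⟪M v, w⟫ = ⟪v, M w⟫) (hM : HasFDerivAt (gradient u) M x) :
    gradient (fun y => ⟪y, gradient u y⟫) x = gradient u x + M x := by
  have h := (hasFDerivAt_id x).inner ℝ hM
  refine ext_inner_right ℝ fun v => ?_
  have h' : HasFDerivAt (fun y => ⟪y, gradient u y⟫) _ x := h
  rw [inner_gradient_eq_fderiv, h'.fderiv, inner_add_left, hMs x v]
  simp [fderivInnerCLM_apply, add_comm]

/-- The weak formulation of the equation satisfied by `x ↦ ⟪x, ∇u x⟫`. -/
theorem integral_linearized_dilation [Nontrivial E] {p : ℝ} (hp : 1 < p) {f : ℝ → ℝ}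
    (hf : ContDiff ℝ 1 f) {U : Set E} (hU : IsOpen U) {u : E → ℝ} (hu : ContDiffOn ℝ 1 u U)
    (hweak : ∀ ξ : E → ℝ, ContDiff ℝ 1 ξ → HasCompactSupport ξ → tsupport ξ ⊆ U →
      ∫ x, ⟪pField p (gradient u x), gradient ξ x⟫ = ∫ x, f (u x) * ξ x)
    {ξ : E → ℝ} (hξ : ContDiff ℝ 1 ξ) (hξc : HasCompactSupport ξ)
    (hξs : tsupport ξ ⊆ U ∩ {x | 0 < ‖gradient u x‖}) :
    (∫ x, ‖gradient u x‖ ^ (p - 2) *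
        ⟪gradient (fun y => ⟪y, gradient u y⟫) x, gradient ξ x⟫)
      + (p - 2) * (∫ x, ‖gradient u x‖ ^ (p - 4) *
          ⟪gradient (fun y => ⟪y, gradient u y⟫) x, gradient u x⟫ * ⟪gradient u x, gradient ξ x⟫)
      - (∫ x, deriv f (u x) * ⟪x, gradient u x⟫ * ξ x)
      = p * ∫ x, ‖gradient u x‖ ^ (p - 2) * ⟪gradient u x, gradient ξ x⟫ := by
  set Ω := U ∩ {x | 0 < ‖gradient u x‖} with hΩ
  set K := tsupport ξ with hK
  set c : E → ℝ := fun y => ⟪y, gradient u y⟫ with hc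
  set V : E → E := fun x => pField p (gradient u x) with hV
  have hKc : IsCompact K := hξc.isCompact
  have hgc : ContinuousOn (gradient u) U :=
    (InnerProductSpace.toDual ℝ E).symm.continuous.comp_continuousOn
      (hu.continuousOn_fderiv_of_isOpen hU le_rfl)
  have hΩo : IsOpen Ω := hgc.norm.isOpen_inter_preimage hU isOpen_Ioi
  have hne : ∀ x ∈ Ω, gradient u x ≠ 0 := fun x hx => norm_pos_iff.1 hx.2
  have hloc : ∀ x ∈ Ω, ∃ C, ∀ᶠ y in 𝓝 x, ‖fderiv ℝ (gradient u) y‖ ≤ C := by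
    intro x hx
    obtain ⟨ρ, C, hρ, h⟩ := exists_hasFDerivAt_gradient hp hf hU hu hweak hx.1 (hne x hx)
    refine ⟨C, ?_⟩
    filter_upwards [ball_mem_nhds x hρ] with y hy
    obtain ⟨M, -, hMC, hM⟩ := h y hy
    rwa [hM.fderiv]
  have hex : ∀ x ∈ Ω, ∃ M : E →L[ℝ] E, (∀ v w, ⟪M v, w⟫ = ⟪v, M w⟫) ∧
      HasFDerivAt (gradient u) M x := by
    intro x hx
    obtain ⟨ρ, C, hρ, h⟩ := exists_hasFDerivAt_gradient hp hf hU hu hweak hx.1 (hne x hx)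
    obtain ⟨M, hMs, -, hM⟩ := h x (mem_ball_self hρ)
    exact ⟨M, hMs, hM⟩
  have hVd : ∀ x ∈ Ω, HasFDerivAt V
      ((pFieldDeriv p (gradient u x)).comp (fderiv ℝ (gradient u) x)) x := by
    intro x hx
    obtain ⟨M, -, hM⟩ := hex x hx
    rw [hM.fderiv]
    exact (hasFDerivAt_pField p (hne x hx)).comp x hM
  have hVloc : ∀ x ∈ Ω, ∃ C, ∀ᶠ y in 𝓝 x, ‖fderiv ℝ V y‖ ≤ C := by
    intro x hx
    obtain ⟨C, hC⟩ := hloc x hx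
    have h1 : ContinuousAt (fun y => ‖pFieldDeriv p (gradient u y)‖) x :=
      (ContinuousAt.comp (g := pFieldDeriv p) (contDiffAt_pFieldDeriv p (hne x hx)).continuousAt
        (hgc.continuousAt (hU.mem_nhds hx.1))).norm
    refine ⟨(‖pFieldDeriv p (gradient u x)‖ + 1) * C, ?_⟩
    filter_upwards [hC, h1.eventually_le_const (lt_add_one _), hΩo.mem_nhds hx] with y hy1 hy2 hy3
    rw [(hVd y hy3).fderiv]
    refine (ContinuousLinearMap.opNorm_comp_le _ _).trans ?_
    gcongr
  have hfu : ContDiffOn ℝ 1 (fun x => f (u x)) U := hf.comp_contDiffOn hu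
  have hud : ∀ x ∈ U, DifferentiableAt ℝ u x := fun x hx =>
    (hu.contDiffAt (hU.mem_nhds hx)).differentiableAt one_ne_zero
  have hfd : ∀ x ∈ U, fderiv ℝ (fun x => f (u x)) x x = deriv f (u x) * c x := by
    intro x hx
    have h1 : HasFDerivAt (fun x => f (u x)) _ x :=
      ((hf.differentiable one_ne_zero (u x)).hasDerivAt).comp_hasFDerivAt x (hud x hx).hasFDerivAt
    rw [h1.fderiv]
    simp [hc]
  have hfuloc : ∀ x ∈ Ω, ∃ C, ∀ᶠ y in 𝓝 x, ‖fderiv ℝ (fun x => f (u x)) y‖ ≤ C := by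
    intro x hx
    have h1 : ContinuousAt (fun y => ‖fderiv ℝ (fun x => f (u x)) y‖) x :=
      ((hfu.continuousOn_fderiv_of_isOpen hU le_rfl).continuousAt (hU.mem_nhds hx.1)).norm
    exact ⟨_, h1.eventually_le_const (lt_add_one _)⟩
  have hg0 : ∀ x ∉ K, gradient ξ x = 0 := fun x hx => gradient_eq_zero_of_notMem_tsupport hx
  have hgts : tsupport (gradient ξ) ⊆ K :=
    closure_minimal (fun x hx => by_contra fun h => hx (hg0 x h)) (isClosed_tsupport ξ)
  have hgcont := hξ.continuous_gradient
  have hJ1 := hasDerivAt_integral_dilation hΩo hgcont (hasCompactSupport_gradient hξc)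
    (hgts.trans hξs) (fun x hx => (hVd x hx).differentiableAt) hVloc
  have hJ2 := hasDerivAt_integral_dilation hΩo hξ.continuous hξc hξs
    (fun x hx => (hfu.contDiffAt (hU.mem_nhds hx.1)).differentiableAt one_ne_zero) hfuloc
  have hJ3 := (hasDerivAt_id (1 : ℝ)).mul hJ2
  obtain ⟨s, hs, C, hsC⟩ := exists_fderiv_bound_dilation hKc hΩo hξs hloc
  have heq : (fun t : ℝ => ∫ y, ⟪V (t • y), gradient ξ y⟫)
      =ᶠ[𝓝 1] fun t : ℝ => t * ∫ y, ⟪f (u (t • y)), ξ y⟫ := by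
    filter_upwards [hs, lt_mem_nhds zero_lt_one] with t ht ht0
    have h1 := weak_identity_comp_affine (X := V) (G := fun x => f (u x)) hweak 0 ht0 hξ hξc
      fun y hy => by rw [zero_add]; exact (hsC t ht y hy).1.1
    simp only [zero_add] at h1
    rw [h1]
    simp only [RCLike.inner_apply, conj_trivial, mul_comm]
  have hder : ∫ y, ⟪fderiv ℝ V y y, gradient ξ y⟫
      = (∫ y, ⟪V y, gradient ξ y⟫) + ∫ y, deriv f (u y) * c y * ξ y := by
    have h1 := hJ1.unique (hJ3.congr_of_eventuallyEq heq)
    simp only [id, one_smul, one_mul] at h1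
    rw [h1, hweak ξ hξ hξc fun x hx => (hξs hx).1]
    congr 1
    · congr 1; ext y; simp [mul_comm]
    · congr 1; ext y
      by_cases hy : y ∈ K
      · rw [← hfd y (hξs hy).1]
        simp [mul_comm]
      · rw [image_eq_zero_of_notMem_tsupport hy, inner_zero_right, mul_zero]
  have hgK : ContinuousOn (gradient u) K := hgc.mono fun x hx => (hξs hx).1
  have hnK : ∀ r : ℝ, ContinuousOn (fun x => ‖gradient u x‖ ^ r) K := fun r =>
    hgK.norm.rpow_const fun x hx => Or.inl (hξs hx).2.ne'
  have hcx : ∀ x ∈ Ω, gradient c x = gradient u x + fderiv ℝ (gradient u) x x := by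
    intro x hx
    obtain ⟨M, hMs, hM⟩ := hex x hx
    rw [hM.fderiv, hc, gradient_inner_self_gradient hMs hM]
  have hcm : AEStronglyMeasurable (gradient c) :=
    ((InnerProductSpace.toDual ℝ E).symm.continuous.comp_stronglyMeasurable
      (measurable_fderiv ℝ c).stronglyMeasurable).aestronglyMeasurable
  obtain ⟨R, hR⟩ := hKc.exists_bound_of_continuousOn hgK
  obtain ⟨R', hR'⟩ := hKc.exists_bound_of_continuousOn (f := fun x : E => x) continuousOn_id
  have hcb : ∀ x ∈ K, ‖gradient c x‖ ≤ R + C * R' := by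
    intro x hx
    have hMC := (hsC 1 (mem_of_mem_nhds hs) x hx).2
    rw [one_smul] at hMC
    rw [hcx x (hξs hx)]
    refine (norm_add_le _ _).trans (add_le_add (hR x hx) ?_)
    refine (ContinuousLinearMap.le_opNorm _ _).trans ?_
    exact mul_le_mul hMC (hR' x hx) (norm_nonneg _) ((norm_nonneg _).trans hMC)
  have hA : Integrable fun x => ‖gradient u x‖ ^ (p - 2) * ⟪gradient c x, gradient ξ x⟫ := by
    have h := integrable_inner_of_bound hKc hcm hcb
      (Z := fun x => ‖gradient u x‖ ^ (p - 2) • gradient ξ x)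
      ((hnK _).smul hgcont.continuousOn) fun x hx => by rw [hg0 x hx, smul_zero]
    simpa only [real_inner_smul_right] using h
  have hB : Integrable fun x =>
      ‖gradient u x‖ ^ (p - 4) * ⟪gradient c x, gradient u x⟫ * ⟪gradient u x, gradient ξ x⟫ := by
    have h := integrable_inner_of_bound hKc hcm hcb
      (Z := fun x => (‖gradient u x‖ ^ (p - 4) * ⟪gradient u x, gradient ξ x⟫) • gradient u x)
      (((hnK _).mul (hgK.inner hgcont.continuousOn)).smul hgK) fun x hx => by
        rw [hg0 x hx, inner_zero_right, mul_zero, zero_smul]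
    refine h.congr (ae_of_all _ fun x => ?_)
    simp only [real_inner_smul_right]
    ring
  have hVint : Integrable fun x => ‖gradient u x‖ ^ (p - 2) * ⟪gradient u x, gradient ξ x⟫ := by
    have h := integrable_inner_of_bound hKc hgcont.aestronglyMeasurable
      (hKc.exists_bound_of_continuousOn hgcont.continuousOn).choose_spec
      (Z := fun x => K.indicator (fun x => ‖gradient u x‖ ^ (p - 2) • gradient u x) x)
      (((hnK _).smul hgK).congr fun x hx => indicator_of_mem hx _)
      fun x hx => indicator_of_notMem hx _
    refine h.congr (ae_of_all _ fun x => ?_)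
    by_cases hx : x ∈ K
    · simp only [indicator_of_mem hx, real_inner_smul_right, real_inner_comm]
    · simp only [hg0 x hx, inner_zero_left, inner_zero_right, mul_zero]
  have hpt : ∀ x, ⟪fderiv ℝ V x x, gradient ξ x⟫
      = ‖gradient u x‖ ^ (p - 2) * ⟪gradient c x, gradient ξ x⟫
        + (p - 2) * (‖gradient u x‖ ^ (p - 4) * ⟪gradient c x, gradient u x⟫
            * ⟪gradient u x, gradient ξ x⟫)
        - (p - 1) * (‖gradient u x‖ ^ (p - 2) * ⟪gradient u x, gradient ξ x⟫) := by
    intro x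
    by_cases hx : x ∈ K
    · have hq := hne x (hξs hx)
      have h1 : fderiv ℝ V x x
          = pFieldDeriv p (gradient u x) (gradient c x) - (p - 1) • pField p (gradient u x) := by
        rw [hcx x (hξs hx), map_add, pFieldDeriv_self p hq, (hVd x (hξs hx)).fderiv,
          add_sub_cancel_left, ContinuousLinearMap.comp_apply]
      rw [h1, pFieldDeriv_apply, pField, inner_sub_left, inner_add_left]
      simp only [real_inner_smul_left, real_inner_comm (gradient u x) (gradient c x)]
      ring
    · simp only [hg0 x hx, inner_zero_right, mul_zero, add_zero, sub_zero]
  have hVeq : ∀ x, ⟪V x, gradient ξ x⟫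
      = ‖gradient u x‖ ^ (p - 2) * ⟪gradient u x, gradient ξ x⟫ := fun x =>
    real_inner_smul_left _ _ _
  simp only [hpt, hVeq] at hder
  have hAB := hA.add (hB.const_mul (p - 2))
  simp only [Pi.add_def] at hAB
  rw [integral_sub hAB (hVint.const_mul _), integral_add hA (hB.const_mul _), integral_const_mul, integral_const_mul] at hder
  linarith

end Linearized

/-- for a regular solution `u` of `−Δ_p u = f(u)` in `B₁` and `c(x) = x·∇u(x)`,
the identity
`∫ |∇u|^{p−2} ∇c·∇ξ + (p−2) ∫ |∇u|^{p−4} (∇c·∇u)(∇u·∇ξ) − ∫ f′(u) c ξ = p ∫ |∇u|^{p−2} ∇u·∇ξ`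
holds for every `C¹` test function `ξ` with compact support in `B₁ ∩ {|∇u| > 0}`,
all integrals being over `B₁ ∩ {|∇u| > 0}`. -/
theorem statement1 (n : ℕ) (p : ℝ) (hp : 1 < p)
    (f : ℝ → ℝ) (hf : ContDiff ℝ 1 f) (u : Euc n → ℝ)
    (hu : IsRegularSolution n p (ball 0 1) f u)
    (ξ : Euc n → ℝ) (hξ : ContDiff ℝ 1 ξ) (hξc : HasCompactSupport ξ)
    (hξs : tsupport ξ ⊆ ball (0 : Euc n) 1 ∩ {x | 0 < ‖gradient u x‖}) :
    (∫ x in ball (0 : Euc n) 1 ∩ {x | 0 < ‖gradient u x‖},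
        ‖gradient u x‖ ^ (p - 2) *
          ⟪gradient (fun y => ⟪y, gradient u y⟫) x, gradient ξ x⟫)
      + (p - 2) *
        (∫ x in ball (0 : Euc n) 1 ∩ {x | 0 < ‖gradient u x‖},
          ‖gradient u x‖ ^ (p - 4) *
            ⟪gradient (fun y => ⟪y, gradient u y⟫) x, gradient u x⟫ *
            ⟪gradient u x, gradient ξ x⟫)
      - (∫ x in ball (0 : Euc n) 1 ∩ {x | 0 < ‖gradient u x‖},
          deriv f (u x) * ⟪x, gradient u x⟫ * ξ x)
      = p * ∫ x in ball (0 : Euc n) 1 ∩ {x | 0 < ‖gradient u x‖},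
          ‖gradient u x‖ ^ (p - 2) * ⟪gradient u x, gradient ξ x⟫ := by
  have hweak : ∀ ξ : Euc n → ℝ, ContDiff ℝ 1 ξ → HasCompactSupport ξ → tsupport ξ ⊆ ball 0 1 →
      ∫ x, ⟪pField p (gradient u x), gradient ξ x⟫ = ∫ x, f (u x) * ξ x := by
    intro ξ hξ hξc hξs
    have h := hu.2.2 ξ hξ hξc hξs
    rw [setIntegral_eq_integral_of_forall_compl_eq_zero fun x hx => by
        rw [gradient_eq_zero_of_notMem_tsupport fun h => hx (hξs h), inner_zero_right, mul_zero],
      setIntegral_eq_integral_of_forall_compl_eq_zero fun x hx => by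
        rw [image_eq_zero_of_notMem_tsupport fun h => hx (hξs h), mul_zero]] at h
    simpa only [pField, real_inner_smul_left] using h
  have hg0 : ∀ x ∉ ball (0 : Euc n) 1 ∩ {x | 0 < ‖gradient u x‖}, gradient ξ x = 0 := fun x hx =>
    gradient_eq_zero_of_notMem_tsupport fun h => hx (hξs h)
  rw [setIntegral_eq_integral_of_forall_compl_eq_zero fun x hx => by
      rw [hg0 x hx, inner_zero_right, mul_zero],
    setIntegral_eq_integral_of_forall_compl_eq_zero fun x hx => by
      rw [hg0 x hx, inner_zero_right, mul_zero],
    setIntegral_eq_integral_of_forall_compl_eq_zero fun x hx => by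
      rw [image_eq_zero_of_notMem_tsupport fun h => hx (hξs h), mul_zero],
    setIntegral_eq_integral_of_forall_compl_eq_zero fun x hx => by
      rw [hg0 x hx, inner_zero_right, mul_zero]]
  rcases subsingleton_or_nontrivial (Euc n) with h | h
  · have hξ0 : ∀ x, ξ x = 0 := fun x => image_eq_zero_of_notMem_tsupport fun hx =>
      norm_pos_iff.1 (hξs hx).2 (Subsingleton.elim _ _)
    simp [hξ0, Subsingleton.elim (gradient ξ _) 0]
  · exact integral_linearized_dilation hp hf isOpen_ball hu.1 hweak hξ hξc hξs
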